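/- Let n∈ℕ, p∈(1,∞) and s∈((p−2)_+/p, 1), and let Ω⊆ℝⁿ be a bounded open set. Let u:ℝⁿ→ℝ be a local weak solution of (−Δ_p)^s u = 0 in Ω, and assume in addition that u is continuously differentiable on Ω. Then for every q∈[p,∞) there exists a constant c = c(n,p,s,q) such that for every ball B_{2R}(x_o) whose closure is contained in Ω one has ‖∇u‖_{L^q(B_R(x_o))} ≤ c R^{n/q − 1} [ R^{1 − n/p} ‖∇u‖_{L^p(B_{2R}(x_o))} + Tail(u−(u)_{B_{2R}(x_o)}; B_{2R}(x_o)) ]. -/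

import Mathlib

open MeasureTheory Metric Set
open scoped ENNReal

noncomputable section

/-- Double Gagliardo integral `∬_{D×D} |u(x)-u(y)|^p / |x-y|^{n+sp} dx dy` in `ℝ≥0∞`. -/
def gagliardoE (n : ℕ) (s p : ℝ) (D : Set (EuclideanSpace ℝ (Fin n)))
    (u : EuclideanSpace ℝ (Fin n) → ℝ) : ℝ≥0∞ :=
  ∫⁻ x in D, ∫⁻ y in D, ENNReal.ofReal (|u x - u y| ^ p / dist x y ^ ((n : ℝ) + s * p))

/-- Nonlocal tail `Tail(u; B_R(x₀))` in `ℝ≥0∞`. -/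
def tailE (n : ℕ) (s p : ℝ) (u : EuclideanSpace ℝ (Fin n) → ℝ)
    (x₀ : EuclideanSpace ℝ (Fin n)) (R : ℝ) : ℝ≥0∞ :=
  (ENNReal.ofReal (R ^ (s * p)) *
      ∫⁻ x in (ball x₀ R)ᶜ,
        ENNReal.ofReal (|u x| ^ (p - 1) / dist x x₀ ^ ((n : ℝ) + s * p))) ^ (1 / (p - 1))

/-- `f ∈ L^q_loc(D)`. -/
def MemLploc (n : ℕ) (q : ℝ) (D : Set (EuclideanSpace ℝ (Fin n)))
    (f : EuclideanSpace ℝ (Fin n) → ℝ) : Prop :=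
  Measurable f ∧
    ∀ K : Set (EuclideanSpace ℝ (Fin n)), K ⊆ D → IsCompact K →
      (∫⁻ x in K, ENNReal.ofReal (|f x| ^ q)) < ⊤

/-- `u` is a local weak solution of `(-Δ_p)^s u = f` in `D`. -/
def IsLocalWeakSolution (n : ℕ) (p s : ℝ) (D : Set (EuclideanSpace ℝ (Fin n)))
    (f u : EuclideanSpace ℝ (Fin n) → ℝ) : Prop :=
  Measurable u ∧
  (∀ K : Set (EuclideanSpace ℝ (Fin n)), K ⊆ D → IsCompact K →
      (∫⁻ x in K, ENNReal.ofReal (|u x| ^ p)) < ⊤ ∧ gagliardoE n s p K u < ⊤) ∧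
  (∫⁻ x, ENNReal.ofReal (|u x| ^ (p - 1) / (1 + ‖x‖) ^ ((n : ℝ) + s * p))) < ⊤ ∧
  ∀ φ : EuclideanSpace ℝ (Fin n) → ℝ, Measurable φ →
    (∃ K : Set (EuclideanSpace ℝ (Fin n)), IsCompact K ∧ K ⊆ D ∧
      ∀ᵐ x, x ∉ K → φ x = 0) →
    (∫⁻ x, ENNReal.ofReal (|φ x| ^ p)) < ⊤ →
    gagliardoE n s p Set.univ φ < ⊤ →
    (∫ x, ∫ y,
        |u x - u y| ^ (p - 2) * (u x - u y) * (φ x - φ y) / dist x y ^ ((n : ℝ) + s * p)) =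
      ∫ x in D, f x * φ x

/-- The signed `γ`-power `𝐚^γ = |a|^{γ-1} a`. -/
def sgnPow (γ a : ℝ) : ℝ := |a| ^ (γ - 1) * a

/-- `J(t) = |t|^{p-2} t`. -/
def Jp (p t : ℝ) : ℝ := |t| ^ (p - 2) * t

lemma Jp_neg (p t : ℝ) : Jp p (-t) = - Jp p t := by simp [Jp]

lemma Jp_zero (p : ℝ) : Jp p 0 = 0 := by simp [Jp]

lemma Jp_of_nonneg {p t : ℝ} (hp : 1 < p) (ht : 0 ≤ t) : Jp p t = t ^ (p - 1) := by
  rcases ht.eq_or_lt with rfl | h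
  · rw [Jp_zero, Real.zero_rpow (by linarith)]
  · rw [Jp, abs_of_pos h]
    nth_rewrite 2 [← Real.rpow_one t]
    rw [← Real.rpow_add h]; congr 1; ring

lemma abs_Jp {p : ℝ} (hp : 1 < p) (t : ℝ) : |Jp p t| = |t| ^ (p - 1) := by
  rw [← Jp_of_nonneg hp (abs_nonneg t)]
  simp [Jp, abs_mul, Real.abs_rpow_of_nonneg]

lemma one_sub_rpow_bounds {p t : ℝ} (hp : 1 < p) (h0 : 0 ≤ t) (h1 : t ≤ 1) :
    min 1 (p - 1) * (1 - t) ≤ 1 - t ^ (p - 1) ∧ 1 - t ^ (p - 1) ≤ max 1 (p - 1) * (1 - t) := by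
  rcases le_total 2 p with h | h
  · have e1 : t ^ (p - 1) ≤ t := by
      simpa using Real.rpow_le_rpow_of_exponent_ge' h0 h1 (zero_le_one) (by linarith : 1 ≤ p - 1)
    have e2 := one_add_mul_self_le_rpow_one_add (s := t - 1) (by linarith) (p := p - 1) (by linarith)
    rw [add_sub_cancel] at e2
    rw [min_eq_left (by linarith), max_eq_right (by linarith)]
    constructor <;> nlinarith
  · have e1 : t ≤ t ^ (p - 1) := by
      simpa using Real.rpow_le_rpow_of_exponent_ge' h0 h1 (by linarith) (by linarith : p - 1 ≤ 1)
    have e2 := rpow_one_add_le_one_add_mul_self (s := t - 1) (by linarith) (p := p - 1)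
      (by linarith) (by linarith)
    rw [add_sub_cancel] at e2
    rw [min_eq_right (by linarith), max_eq_left (by linarith)]
    constructor <;> nlinarith

/-- Core one-dimensional estimate when `|a| ≤ b`. -/
lemma Jp_core {p a b : ℝ} (hp : 1 < p) (hb : 0 < b) (hab : |a| ≤ b) :
    min 1 (p - 1) / 2 * (b ^ (p - 2) * (b - a)) ≤ Jp p b - Jp p a ∧
      Jp p b - Jp p a ≤ max 1 (p - 1) * 2 * (b ^ (p - 2) * (b - a)) := by
  have hbp : 0 < b ^ (p - 1) := Real.rpow_pos_of_pos hb _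
  have hb2 : b ^ (p - 2) * b = b ^ (p - 1) := by
    nth_rewrite 2 [← Real.rpow_one b]
    rw [← Real.rpow_add hb]; congr 1; ring
  have hmin0 : 0 < min 1 (p - 1) := lt_min one_pos (by linarith)
  have hmin1 : min 1 (p - 1) ≤ 1 := min_le_left _ _
  have hmax1 : 1 ≤ max 1 (p - 1) := le_max_left _ _
  obtain ⟨t, rfl⟩ : ∃ t, a = b * t := ⟨a / b, by field_simp⟩
  have ht : |t| ≤ 1 := by
    rw [abs_mul, abs_of_pos hb] at hab
    by_contra h
    push Not at h
    nlinarith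
  have e : b ^ (p - 2) * (b - b * t) = b ^ (p - 1) * (1 - t) := by rw [← hb2]; ring
  rw [e, Jp_of_nonneg hp hb.le]
  rcases le_total 0 t with h | h
  · rw [Jp_of_nonneg hp (by positivity), Real.mul_rpow hb.le h]
    rw [abs_of_nonneg h] at ht
    obtain ⟨h1, h2⟩ := one_sub_rpow_bounds hp h ht
    have : 0 ≤ 1 - t := by linarith
    constructor
    · have : min 1 (p - 1) / 2 * (1 - t) ≤ 1 - t ^ (p - 1) := by nlinarith
      nlinarith
    · have : 1 - t ^ (p - 1) ≤ max 1 (p - 1) * 2 * (1 - t) := by nlinarith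
      nlinarith
  · have : Jp p (b * t) = - (b ^ (p - 1) * (-t) ^ (p - 1)) := by
      rw [← Real.mul_rpow hb.le (by linarith), ← Jp_of_nonneg hp (by nlinarith), ← Jp_neg]; ring_nf
    rw [this]
    rw [abs_of_nonpos h] at ht
    have h1 : 0 ≤ (-t) ^ (p - 1) := Real.rpow_nonneg (by linarith) _
    have h2 : (-t) ^ (p - 1) ≤ 1 := Real.rpow_le_one (by linarith) ht (by linarith)
    constructor
    · have : min 1 (p - 1) / 2 * (1 - t) ≤ 1 + (-t) ^ (p - 1) := by nlinarith
      nlinarith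
    · have : 1 + (-t) ^ (p - 1) ≤ max 1 (p - 1) * 2 * (1 - t) := by nlinarith
      nlinarith

lemma rpow_two_sided {γ b S : ℝ} (hb : 0 < b) (h1 : b ≤ S) (h2 : S ≤ 2 * b) :
    b ^ γ ≤ 2 ^ |γ| * S ^ γ ∧ S ^ γ ≤ 2 ^ |γ| * b ^ γ := by
  have hS : 0 < S := lt_of_lt_of_le hb h1
  have hone : (1 : ℝ) ≤ 2 ^ |γ| := Real.one_le_rpow (by norm_num) (abs_nonneg _)
  rcases le_total 0 γ with h | h
  · rw [abs_of_nonneg h] at *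
    constructor
    · have := Real.rpow_le_rpow hb.le h1 h
      have := Real.rpow_pos_of_pos hS γ
      nlinarith
    · rw [← Real.mul_rpow (by norm_num) hb.le]
      exact Real.rpow_le_rpow hS.le h2 h
  · rw [abs_of_nonpos h] at *
    constructor
    · have e := Real.rpow_le_rpow_of_nonpos hS h2 h
      rw [Real.mul_rpow (by norm_num) hb.le] at e
      rw [Real.rpow_neg (by norm_num)]
      have : (0:ℝ) < 2 ^ γ := Real.rpow_pos_of_pos (by norm_num) _
      rw [inv_mul_eq_div, le_div_iff₀ this]; linarith
    · have := Real.rpow_le_rpow_of_nonpos hb h1 h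
      have := Real.rpow_pos_of_pos hb γ
      nlinarith

lemma Jp_two_sided {p : ℝ} (hp : 1 < p) :
    ∃ c C : ℝ, 0 < c ∧ 0 < C ∧ ∀ a b : ℝ,
      c * ((|a| + |b|) ^ (p - 2) * (b - a) ^ 2) ≤ (Jp p b - Jp p a) * (b - a) ∧
      |Jp p b - Jp p a| ≤ C * ((|a| + |b|) ^ (p - 2) * |b - a|) := by
  have hmin0 : 0 < min 1 (p - 1) := lt_min one_pos (by linarith)
  have hmax1 : 1 ≤ max 1 (p - 1) := le_max_left _ _
  have hK : (0:ℝ) < 2 ^ |p - 2| := Real.rpow_pos_of_pos (by norm_num) _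
  refine ⟨min 1 (p - 1) / 2 / 2 ^ |p - 2|, max 1 (p - 1) * 2 * 2 ^ |p - 2|, by positivity,
    by positivity, ?_⟩
  -- the main case
  have main : ∀ a b : ℝ, |a| ≤ b → 
      min 1 (p - 1) / 2 / 2 ^ |p - 2| * ((|a| + |b|) ^ (p - 2) * (b - a) ^ 2) ≤
        (Jp p b - Jp p a) * (b - a) ∧
      |Jp p b - Jp p a| ≤ max 1 (p - 1) * 2 * 2 ^ |p - 2| * ((|a| + |b|) ^ (p - 2) * |b - a|) := by
    intro a b hab
    have hb : 0 ≤ b := (abs_nonneg a).trans hab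
    rcases hb.eq_or_lt with rfl | hb
    · have : a = 0 := abs_eq_zero.1 (le_antisymm hab (abs_nonneg _))
      subst this; simp
    · obtain ⟨h1, h2⟩ := Jp_core hp hb hab
      have hba : 0 ≤ b - a := by linarith [le_abs_self a]
      obtain ⟨g1, g2⟩ := rpow_two_sided (γ := p - 2) hb (S := |a| + |b|)
        (by rw [abs_of_pos hb]; linarith [abs_nonneg a]) (by rw [abs_of_pos hb]; linarith)
      have hbp : 0 < b ^ (p - 2) := Real.rpow_pos_of_pos hb _
      have h3 : 0 ≤ Jp p b - Jp p a := le_trans (by positivity) h1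
      rw [abs_of_nonneg h3, abs_of_nonneg hba]
      constructor
      · have : (|a| + |b|) ^ (p - 2) / 2 ^ |p - 2| ≤ b ^ (p - 2) := by
          rw [div_le_iff₀ hK]; linarith
        calc _ = min 1 (p - 1) / 2 * ((|a| + |b|) ^ (p - 2) / 2 ^ |p - 2| * (b - a)) * (b - a) := by
              ring
          _ ≤ min 1 (p - 1) / 2 * (b ^ (p - 2) * (b - a)) * (b - a) := by gcongr
          _ ≤ _ := by gcongr
      · calc _ ≤ _ := h2
          _ ≤ max 1 (p - 1) * 2 * ((2 ^ |p - 2| * (|a| + |b|) ^ (p - 2)) * (b - a)) := by gcongr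
          _ = _ := by ring
  intro a b
  -- reduce by symmetry
  rcases le_total |a| |b| with h | h
  · rcases le_total 0 b with hb | hb
    · exact main a b (by rwa [abs_of_nonneg hb] at h)
    · have := main (-a) (-b) (by rwa [abs_of_nonpos hb, ← abs_neg a] at h)
      simp only [abs_neg, Jp_neg] at this
      have e1 : (- b - -a) = -(b - a) := by ring
      have e2 : (- Jp p b - -Jp p a) = -(Jp p b - Jp p a) := by ring
      rw [e1, e2] at this
      rw [abs_neg, abs_neg, neg_sq, neg_mul_neg] at this
      exact this
  · rcases le_total 0 a with hb | hb
    · have := main b a (by rwa [abs_of_nonneg hb] at h)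
      rw [add_comm |b| |a|, abs_sub_comm a b, abs_sub_comm (Jp p a)] at this
      refine ⟨?_, this.2⟩
      have e := this.1
      nlinarith
    · have := main (-b) (-a) (by rwa [abs_of_nonpos hb, ← abs_neg b] at h)
      simp only [abs_neg, Jp_neg] at this
      have e1 : (- a - -b) = (b - a) := by ring
      have e2 : (- Jp p a - -Jp p b) = (Jp p b - Jp p a) := by ring
      rw [e1, e2, add_comm |b| |a|] at this
      exact this


lemma mul_rpow_le_add {x y a b : ℝ} (hx : 0 ≤ x) (hy : 0 ≤ y) (ha : 0 ≤ a) (hb : 0 ≤ b) :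
    x ^ a * y ^ b ≤ x ^ (a + b) + y ^ (a + b) := by
  rcases le_total x y with h | h
  · calc x ^ a * y ^ b ≤ y ^ a * y ^ b := by gcongr
      _ = y ^ (a + b) := (Real.rpow_add_of_nonneg hy ha hb).symm
      _ ≤ _ := by have := Real.rpow_nonneg hx (a + b); linarith
  · calc x ^ a * y ^ b ≤ x ^ a * x ^ b := by gcongr
      _ = x ^ (a + b) := (Real.rpow_add_of_nonneg hx ha hb).symm
      _ ≤ _ := by have := Real.rpow_nonneg hy (a + b); linarith

/-- Young-type absorption of the cross term. -/
lemma young_cross {p β : ℝ} (hp : 1 < p) (hβ : 1 ≤ β) {κ L : ℝ} (hκ : 0 < κ) (hL : 0 ≤ L) :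
    ∃ C : ℝ, 0 ≤ C ∧ ∀ S d W D E δ H : ℝ, 0 ≤ d → d ≤ S → d ≤ W → 0 ≤ D → 0 ≤ E → E ≤ 2 →
      0 < δ → 0 < H → D ≤ L * δ →
      S ^ (p - 2) * d * W ^ β * D * E ≤ κ * (S ^ (p - 2) * d ^ 2 * W ^ (β - 1)) * E ^ 2 +
        C * (δ ^ p * H ^ ((p + β - 1) - max (p - 2) 0) *
          ((S / δ) ^ (p + β - 1) + (W / H) ^ (p + β - 1))) := by
  refine ⟨max (L ^ 2 / κ) (2 * (1 / κ) ^ (p - 1) * L ^ p), le_max_of_le_left (by positivity), ?_⟩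
  intro S d W D E δ H hd hdS hdW hD hE hE2 hδ hH hDL
  have hS : 0 ≤ S := hd.trans hdS
  have hW : 0 ≤ W := hd.trans hdW
  have hSp : 0 ≤ S ^ (p - 2) := Real.rpow_nonneg hS _
  have hWβ : W ^ β = W ^ (β - 1) * W := by
    nth_rewrite 3 [← Real.rpow_one W]
    rw [← Real.rpow_add_of_nonneg hW (by linarith) (by norm_num)]; congr 1; ring
  have hWb : 0 ≤ W ^ (β - 1) := Real.rpow_nonneg hW _
  have hT1 : 0 ≤ (S / δ) ^ (p + β - 1) := Real.rpow_nonneg (by positivity) _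
  have hT2 : 0 ≤ (W / H) ^ (p + β - 1) := Real.rpow_nonneg (by positivity) _
  have hT : 0 ≤ δ ^ p * H ^ ((p + β - 1) - max (p - 2) 0) *
          ((S / δ) ^ (p + β - 1) + (W / H) ^ (p + β - 1)) := by positivity
  rcases le_total (W * D) (κ * (d * E)) with h | h
  · have : S ^ (p - 2) * d * W ^ β * D * E ≤
        κ * (S ^ (p - 2) * d ^ 2 * W ^ (β - 1)) * E ^ 2 := by
      calc S ^ (p - 2) * d * W ^ β * D * E = (S ^ (p - 2) * d * W ^ (β - 1) * E) * (W * D) := by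
            rw [hWβ]; ring
        _ ≤ (S ^ (p - 2) * d * W ^ (β - 1) * E) * (κ * (d * E)) := by gcongr
        _ = _ := by ring
    have h2 : 0 ≤ max (L ^ 2 / κ) (2 * (1 / κ) ^ (p - 1) * L ^ p) :=
      le_max_of_le_left (by positivity)
    have := mul_nonneg h2 hT
    linarith
  · have h' : d * E ≤ 1 / κ * (W * D) := by
      rw [one_div, inv_mul_eq_div, le_div_iff₀ hκ]; linarith
    have hX : 0 ≤ κ * (S ^ (p - 2) * d ^ 2 * W ^ (β - 1)) * E ^ 2 := by positivity
    refine le_trans ?_ (le_add_of_nonneg_left hX)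
    set ω := W / H with hω
    set ς := S / δ with hς
    have hω0 : 0 ≤ ω := by positivity
    have hς0 : 0 ≤ ς := by positivity
    have eW : W = H * ω := by rw [hω]; field_simp
    have eS : S = δ * ς := by rw [hς]; field_simp
    rcases le_total 2 p with h2 | h2
    · refine le_trans ?_ (mul_le_mul_of_nonneg_right (le_max_left _ _) hT)
      rw [max_eq_left (by linarith)]
      calc S ^ (p - 2) * d * W ^ β * D * E = (S ^ (p - 2) * W ^ β * D) * (d * E) := by ring
        _ ≤ (S ^ (p - 2) * W ^ β * D) * (1 / κ * (W * D)) := by gcongr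
        _ = 1 / κ * (S ^ (p - 2) * (W ^ β * W)) * D ^ 2 := by ring
        _ ≤ 1 / κ * (S ^ (p - 2) * (W ^ β * W)) * (L * δ) ^ 2 := by gcongr
        _ = L ^ 2 / κ * ((S ^ (p - 2) * δ ^ (2:ℝ)) * W ^ (β + 1)) := by
            rw [Real.rpow_add_of_nonneg hW (by linarith) (by norm_num), Real.rpow_one]
            simp; ring
        _ = L ^ 2 / κ * ((δ ^ p * ς ^ (p - 2)) * (H ^ (β + 1) * ω ^ (β + 1))) := by
            rw [eS, eW, Real.mul_rpow hδ.le hς0, Real.mul_rpow hH.le hω0]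
            have : δ ^ p = δ ^ (p - 2) * δ ^ (2:ℝ) := by
              rw [← Real.rpow_add hδ]; congr 1; ring
            rw [this]; ring
        _ = L ^ 2 / κ * (δ ^ p * H ^ (β + 1) * (ς ^ (p - 2) * ω ^ (β + 1))) := by ring
        _ ≤ L ^ 2 / κ * (δ ^ p * H ^ (β + 1) *
              (ς ^ (p - 2 + (β + 1)) + ω ^ (p - 2 + (β + 1)))) := by
            gcongr
            exact mul_rpow_le_add hς0 hω0 (by linarith) (by linarith)
        _ = _ := by
            have e1 : p - 2 + (β + 1) = p + β - 1 := by ring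
            have e2 : p + β - 1 - (p - 2) = β + 1 := by ring
            rw [e1, e2]
    · refine le_trans ?_ (mul_le_mul_of_nonneg_right (le_max_right _ _) hT)
      rw [max_eq_right (by linarith), sub_zero]
      rcases hd.eq_or_lt with rfl | hd
      · rw [max_eq_right (by linarith), sub_zero] at hT
        simp only [mul_zero, zero_mul]
        positivity
      have hSd : S ^ (p - 2) ≤ d ^ (p - 2) := Real.rpow_le_rpow_of_nonpos hd hdS (by linarith)
      have hdd : d ^ (p - 2) * d = d ^ (p - 1) := by
        nth_rewrite 2 [← Real.rpow_one d]
        rw [← Real.rpow_add hd]; congr 1; ring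
      have hEE : E ≤ 2 * E ^ (p - 1) := by
        rcases hE.eq_or_lt with rfl | hE
        · rw [Real.zero_rpow (by linarith)]; simp
        have e1 : E = E ^ (2 - p) * E ^ (p - 1) := by
          rw [← Real.rpow_add hE]; ring_nf; simp
        have e2 : E ^ (2 - p) ≤ 2 := by
          calc E ^ (2 - p) ≤ 2 ^ (2 - p) := Real.rpow_le_rpow hE.le hE2 (by linarith)
            _ ≤ 2 ^ (1:ℝ) := Real.rpow_le_rpow_of_exponent_le (by norm_num) (by linarith)
            _ = 2 := by norm_num
        calc E = E ^ (2 - p) * E ^ (p - 1) := e1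
          _ ≤ 2 * E ^ (p - 1) := by gcongr
      have hDp : D ^ (p - 1) * D = D ^ p := by
        nth_rewrite 2 [← Real.rpow_one D]
        rw [← Real.rpow_add_of_nonneg hD (by linarith) (by norm_num)]; congr 1; ring
      calc S ^ (p - 2) * d * W ^ β * D * E ≤ d ^ (p - 2) * d * W ^ β * D * (2 * E ^ (p - 1)) := by
            gcongr
        _ = 2 * (d ^ (p - 1) * E ^ (p - 1)) * W ^ β * D := by rw [hdd]; ring
        _ = 2 * (d * E) ^ (p - 1) * W ^ β * D := by rw [Real.mul_rpow hd.le hE]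
        _ ≤ 2 * (1 / κ * (W * D)) ^ (p - 1) * W ^ β * D := by
            have : (d * E) ^ (p - 1) ≤ (1 / κ * (W * D)) ^ (p - 1) :=
              Real.rpow_le_rpow (by positivity) h' (by linarith)
            gcongr
        _ = 2 * (1 / κ) ^ (p - 1) * (W ^ (p - 1) * W ^ β) * (D ^ (p - 1) * D) := by
            rw [Real.mul_rpow (by positivity) (by positivity), Real.mul_rpow hW hD]; ring
        _ = 2 * (1 / κ) ^ (p - 1) * W ^ (p + β - 1) * D ^ p := by
            rw [hDp, ← Real.rpow_add_of_nonneg hW (by linarith) (by linarith)]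
            congr 3; ring
        _ ≤ 2 * (1 / κ) ^ (p - 1) * W ^ (p + β - 1) * (L * δ) ^ p := by
            have : D ^ p ≤ (L * δ) ^ p := Real.rpow_le_rpow hD hDL (by linarith)
            gcongr
        _ = 2 * (1 / κ) ^ (p - 1) * L ^ p * (δ ^ p * H ^ (p + β - 1) * ω ^ (p + β - 1)) := by
            rw [Real.mul_rpow hL hδ.le, eW, Real.mul_rpow hH.le hω0]; ring
        _ ≤ _ := by
            gcongr
            linarith

set_option maxHeartbeats 1000000 in
/-- The pointwise energy inequality. -/
lemma key_pointwise {p β : ℝ} (hp : 1 < p) (hβ : 1 ≤ β) {L : ℝ} (hL : 0 ≤ L) :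
    ∃ C C' : ℝ, 0 < C ∧ 0 ≤ C' ∧ ∀ a b wx wy ex ey δ H : ℝ, 0 ≤ ex → ex ≤ 1 → 0 ≤ ey → ey ≤ 1 →
      b - a = wx - wy → 0 < δ → 0 < H → |ex - ey| ≤ L * δ →
      (ex ^ 2 + ey ^ 2) * ((|a| + |b|) ^ (p - 2) * |wx - wy| ^ (β + 1)) ≤
        C * ((Jp p b - Jp p a) * (ex ^ 2 * Jp (β + 1) wx - ey ^ 2 * Jp (β + 1) wy)) +
        C' * (δ ^ p * H ^ ((p + β - 1) - max (p - 2) 0) *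
          (((|a| + |b|) / δ) ^ (p + β - 1) + ((|wx| + |wy|) / H) ^ (p + β - 1))) := by
  obtain ⟨c1, C1, hc1, hC1, h1⟩ := Jp_two_sided hp
  obtain ⟨c2, C2, hc2, hC2, h2⟩ := Jp_two_sided (p := β + 1) (by linarith)
  obtain ⟨C3, hC3, h3⟩ := young_cross hp hβ (κ := c1 * c2 / (8 * C1)) (L := L) (by positivity) hL
  refine ⟨4 / (c1 * c2), 4 / (c1 * c2) * C1 * C3, by positivity, by positivity, ?_⟩
  intro a b wx wy ex ey δ H hex hex1 hey hey1 hd hδ hH hD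
  obtain ⟨p1, p2⟩ := h1 a b
  obtain ⟨g1, -⟩ := h2 wy wx
  set S := |a| + |b| with hS
  set W := |wx| + |wy| with hW
  have hWc : |wy| + |wx| = W := by rw [hW, add_comm]
  rw [hWc] at g1
  set P := Jp p b - Jp p a with hP
  set d := |wx - wy| with hdd
  have hS0 : 0 ≤ S := by positivity
  have hW0 : 0 ≤ W := by positivity
  have hdS : d ≤ S := by rw [hdd, ← hd, hS, add_comm]; exact abs_sub b a
  have hdW : d ≤ W := abs_sub wx wy
  have hd0 : 0 ≤ d := abs_nonneg _
  have hdsq : (wx - wy) ^ 2 = d ^ 2 := (sq_abs _).symm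
  rw [hd] at p1 p2
  rw [hdsq] at p1 g1
  have hSp : 0 ≤ S ^ (p - 2) := Real.rpow_nonneg hS0 _
  have hWb : 0 ≤ W ^ (β - 1) := Real.rpow_nonneg hW0 _
  have eb : β + 1 - 2 = β - 1 := by ring
  rw [eb] at g1
  set X := S ^ (p - 2) * d ^ 2 * W ^ (β - 1) with hX
  have hX0 : 0 ≤ X := by positivity
  set gx := Jp (β + 1) wx
  set gy := Jp (β + 1) wy
  -- product of monotonicities
  have hPG : c1 * c2 * X ≤ P * (gx - gy) := by
    by_cases hz : wx - wy = 0
    · have hd' : d = 0 := by rw [hdd, hz, abs_zero]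
      have : gx - gy = 0 := by
        have : wx = wy := by linarith
        simp only [gx, gy, this, sub_self]
      rw [this, hX, hd']; simp
    · have hpos : 0 < (wx - wy) ^ 2 := by positivity
      have e1 : (c1 * (S ^ (p - 2) * d ^ 2)) * (c2 * (W ^ (β - 1) * d ^ 2)) ≤
          (P * (wx - wy)) * ((gx - gy) * (wx - wy)) :=
        mul_le_mul p1 g1 (by positivity) (le_trans (by positivity) p1)
      have e2 : c1 * c2 * X * (wx - wy) ^ 2 ≤ P * (gx - gy) * (wx - wy) ^ 2 := by
        rw [hX]; calc _ = (c1 * (S ^ (p - 2) * d ^ 2)) * (c2 * (W ^ (β - 1) * d ^ 2)) := by rw [hdsq]; ring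
          _ ≤ _ := e1
          _ = _ := by ring
      exact le_of_mul_le_mul_right e2 hpos
  have hY : S ^ (p - 2) * d ^ (β + 1) ≤ X := by
    have : d ^ (β + 1) = d ^ 2 * d ^ (β - 1) := by
      have e : β + 1 = 2 + (β - 1) := by ring
      rw [e, Real.rpow_add_of_nonneg hd0 (by norm_num) (by linarith)]; simp
    rw [this, hX, mul_assoc]
    have := Real.rpow_le_rpow hd0 hdW (by linarith : 0 ≤ β - 1)
    gcongr
  have hgg : |gx + gy| ≤ 2 * W ^ β := by
    have e1 : |gx| ≤ W ^ β := by
      rw [abs_Jp (by linarith), add_sub_cancel_right]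
      exact Real.rpow_le_rpow (abs_nonneg _) (by rw [hW]; linarith [abs_nonneg wy]) (by linarith)
    have e2 : |gy| ≤ W ^ β := by
      rw [abs_Jp (by linarith), add_sub_cancel_right]
      exact Real.rpow_le_rpow (abs_nonneg _) (by rw [hW]; linarith [abs_nonneg wx]) (by linarith)
    linarith [abs_add_le gx gy]
  set D := |ex - ey| with hDd
  set T := (δ ^ p * H ^ ((p + β - 1) - max (p - 2) 0) *
          ((S / δ) ^ (p + β - 1) + (W / H) ^ (p + β - 1))) with hT
  have hT0 : 0 ≤ T := by
    have : 0 ≤ (S / δ) ^ (p + β - 1) := Real.rpow_nonneg (by positivity) _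
    have : 0 ≤ (W / H) ^ (p + β - 1) := Real.rpow_nonneg (by positivity) _
    positivity
  have hcross := h3 S d W D (ex + ey) δ H hd0 hdS hdW (abs_nonneg _) (by linarith) (by linarith)
    hδ hH hD
  have hc : |(1/2) * ((ex - ey) * (ex + ey)) * (P * (gx + gy))| ≤
      C1 * (S ^ (p - 2) * d * W ^ β * D * (ex + ey)) := by
    rw [abs_mul, abs_mul, abs_mul, abs_mul, abs_of_nonneg (by linarith : 0 ≤ ex + ey)]
    have hh : |P| * |gx + gy| ≤ (C1 * (S ^ (p - 2) * d)) * (2 * W ^ β) :=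
      mul_le_mul p2 hgg (abs_nonneg _) (by positivity)
    have hn : (0:ℝ) ≤ |1/2| * (D * (ex + ey)) := by positivity
    calc _ ≤ |1/2| * (D * (ex + ey)) * ((C1 * (S ^ (p - 2) * d)) * (2 * W ^ β)) :=
          mul_le_mul_of_nonneg_left hh hn
      _ = _ := by rw [abs_of_pos (by norm_num : (0:ℝ) < 1/2)]; ring
  have hident : P * (ex ^ 2 * gx - ey ^ 2 * gy) = (1/2) * (ex ^ 2 + ey ^ 2) * (P * (gx - gy)) +
      (1/2) * ((ex - ey) * (ex + ey)) * (P * (gx + gy)) := by ring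
  have hlow := (abs_le.1 hc).1
  have hE2 : (ex + ey) ^ 2 ≤ 2 * (ex ^ 2 + ey ^ 2) := by nlinarith [sq_nonneg (ex - ey)]
  have hE0 : 0 ≤ ex ^ 2 + ey ^ 2 := by positivity
  have hfin : c1 * c2 / 4 * ((ex ^ 2 + ey ^ 2) * X) ≤
      P * (ex ^ 2 * gx - ey ^ 2 * gy) + C1 * C3 * T := by
    have t1 : (1/2) * (ex ^ 2 + ey ^ 2) * (c1 * c2 * X) ≤
        (1/2) * (ex ^ 2 + ey ^ 2) * (P * (gx - gy)) := by gcongr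
    have t2 : C1 * (S ^ (p - 2) * d * W ^ β * D * (ex + ey)) ≤
        C1 * (c1 * c2 / (8 * C1) * X * (ex + ey) ^ 2 + C3 * T) := by gcongr
    have t3 : C1 * (c1 * c2 / (8 * C1) * X * (ex + ey) ^ 2) = c1 * c2 / 8 * X * (ex + ey) ^ 2 := by
      rw [div_mul_eq_div_div]; field_simp
    have t4 : c1 * c2 / 8 * X * (ex + ey) ^ 2 ≤ c1 * c2 / 8 * X * (2 * (ex ^ 2 + ey ^ 2)) := by
      gcongr
    rw [mul_add C1 (c1 * c2 / (8 * C1) * X * (ex + ey) ^ 2) (C3 * T), t3] at t2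
    linarith
  have hT3 : 0 ≤ P * (ex ^ 2 * gx - ey ^ 2 * gy) + C1 * C3 * T := le_trans (by positivity) hfin
  have f2 : (ex ^ 2 + ey ^ 2) * (S ^ (p - 2) * d ^ (β + 1)) ≤ (ex ^ 2 + ey ^ 2) * X := by gcongr
  have f1 : (ex ^ 2 + ey ^ 2) * X ≤
      4 / (c1 * c2) * (P * (ex ^ 2 * gx - ey ^ 2 * gy) + C1 * C3 * T) := by
    rw [div_mul_eq_mul_div, le_div_iff₀ (by positivity)]
    linarith
  refine f2.trans (f1.trans (le_of_eq ?_))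
  ring


/-- Conversion of the weighted difference into the `q`-th power. -/
lemma conv_pointwise {p q ε S d : ℝ} (hp : 1 < p) (hq : p ≤ q) (hε : 0 < ε) (hε1 : ε ≤ 1)
    (hd : 0 ≤ d) (hdS : d ≤ S) :
    d ^ q ≤ ε ^ (-(max (2 - p) 0)) * (S ^ (p - 2) * d ^ (q + 2 - p)) + ε ^ q * S ^ q := by
  have hS : 0 ≤ S := hd.trans hdS
  rcases hd.eq_or_lt with rfl | hd'
  · rw [Real.zero_rpow (by linarith), Real.zero_rpow (by linarith)]; positivity
  have hS' : 0 < S := hd'.trans_le hdS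
  rcases le_total d (ε * S) with h | h
  · have : d ^ q ≤ ε ^ q * S ^ q := by
      rw [← Real.mul_rpow hε.le hS]; exact Real.rpow_le_rpow hd h (by linarith)
    have h2 : 0 ≤ ε ^ (-(max (2 - p) 0)) * (S ^ (p - 2) * d ^ (q + 2 - p)) := by positivity
    linarith
  · have h2 : 0 ≤ ε ^ q * S ^ q := by positivity
    have key : d ^ (p - 2) ≤ ε ^ (-(max (2 - p) 0)) * S ^ (p - 2) := by
      rcases le_total 2 p with h3 | h3
      · rw [max_eq_right (by linarith), neg_zero, Real.rpow_zero, one_mul]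
        exact Real.rpow_le_rpow hd hdS (by linarith)
      · rw [max_eq_left (by linarith), neg_sub, ← Real.mul_rpow hε.le hS]
        exact Real.rpow_le_rpow_of_nonpos (by positivity) h (by linarith)
    have e : d ^ q = d ^ (p - 2) * d ^ (q + 2 - p) := by
      rw [← Real.rpow_add hd']; congr 1; ring
    rw [e]
    have : d ^ (p - 2) * d ^ (q + 2 - p) ≤
      ε ^ (-(max (2 - p) 0)) * S ^ (p - 2) * d ^ (q + 2 - p) := by gcongr
    linarith

/-- Pointwise bounds for the far part. -/
lemma far_pointwise {p β : ℝ} (hp : 1 < p) (hβ : 1 ≤ β) :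
    ∃ C : ℝ, 0 ≤ C ∧ ∀ a b y H : ℝ, 0 < H → H ≤ 1 →
      |b - a| ^ β * |Jp p (b - y) - Jp p (a - y)| ≤
        C * (H ^ ((p + β - 1) - max (p - 2) 0) *
          ((|b - a| / H) ^ (p + β - 1) + (1 + |a| + |b|) ^ (p + β - 1))) * (1 + |y|) ^ (p - 1) ∧
      |b - a| ^ β * (H * |Jp p (a - y)|) ≤
        C * (H ^ ((p + β - 1) - max (p - 2) 0) *
          ((|b - a| / H) ^ (p + β - 1) + (1 + |a| + |b|) ^ (p + β - 1))) * (1 + |y|) ^ (p - 1) := by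
  obtain ⟨c1, C1, hc1, hC1, h1⟩ := Jp_two_sided hp
  refine ⟨max 1 (C1 * 2 ^ |p - 2|), by positivity, ?_⟩
  intro a b y H hH hH1
  obtain ⟨-, g⟩ := h1 (a - y) (b - y)
  rw [show b - y - (a - y) = b - a by ring] at g
  set w := |b - a| with hw
  set Q := 1 + |a| + |b| with hQ
  set S := |a - y| + |b - y| with hS
  have hw0 : 0 ≤ w := abs_nonneg _
  have hQ1 : 1 ≤ Q := by rw [hQ]; linarith [abs_nonneg a, abs_nonneg b]
  have hQ0 : 0 ≤ Q := by linarith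
  have hY1 : 1 ≤ 1 + |y| := by linarith [abs_nonneg y]
  have hS0 : 0 ≤ S := by positivity
  have hSQ : S ≤ 2 * (Q * (1 + |y|)) := by
    have := abs_sub a y
    have := abs_sub b y
    have := mul_nonneg (abs_nonneg a) (abs_nonneg y)
    have := mul_nonneg (abs_nonneg b) (abs_nonneg y)
    rw [hS, hQ]; nlinarith [abs_nonneg a, abs_nonneg b]
  have hwS : w ≤ S := by
    have : b - a = (b - y) - (a - y) := by ring
    rw [hw, this, hS, add_comm]; exact abs_sub _ _
  have haQ : |a - y| ≤ Q * (1 + |y|) := by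
    have := abs_sub a y
    have := mul_nonneg (abs_nonneg a) (abs_nonneg y)
    have := mul_nonneg (abs_nonneg b) (abs_nonneg y)
    rw [hQ]; nlinarith [abs_nonneg a, abs_nonneg b]
  set ω := w / H with hω
  have hω0 : 0 ≤ ω := by positivity
  have eW : w = H * ω := by rw [hω]; field_simp
  set μ := (p + β - 1) - max (p - 2) 0 with hμ
  have hμ1 : μ ≤ β + 1 := by
    have := le_max_left (p - 2) 0
    rw [hμ]; linarith
  have hHμ : H ^ (β + 1) ≤ H ^ μ := Real.rpow_le_rpow_of_exponent_ge hH hH1 hμ1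
  have hYp : 1 ≤ (1 + |y|) ^ (p - 1) := Real.one_le_rpow hY1 (by linarith)
  have hR0 : 0 ≤ H ^ μ * (ω ^ (p + β - 1) + Q ^ (p + β - 1)) := by positivity
  constructor
  · rcases le_total 2 p with h2 | h2
    · have eμ : μ = β + 1 := by rw [hμ, max_eq_left (by linarith)]; ring
      have hSp : S ^ (p - 2) ≤ 2 ^ |p - 2| * (Q ^ (p - 2) * (1 + |y|) ^ (p - 1)) := by
        rw [abs_of_nonneg (by linarith)]
        calc S ^ (p - 2) ≤ (2 * (Q * (1 + |y|))) ^ (p - 2) :=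
              Real.rpow_le_rpow hS0 hSQ (by linarith)
          _ = 2 ^ (p - 2) * (Q ^ (p - 2) * (1 + |y|) ^ (p - 2)) := by
              rw [Real.mul_rpow (by norm_num) (by positivity), Real.mul_rpow hQ0 (by positivity)]
          _ ≤ _ := by
              have := Real.rpow_le_rpow_of_exponent_le hY1 (by linarith : p - 2 ≤ p - 1)
              gcongr
      have eww : w ^ β * w = H ^ (β + 1) * ω ^ (β + 1) := by
        rw [← Real.mul_rpow hH.le hω0, ← eW,
          Real.rpow_add_of_nonneg hw0 (by linarith) (by norm_num), Real.rpow_one]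
      calc w ^ β * |Jp p (b - y) - Jp p (a - y)| ≤ w ^ β * (C1 * (S ^ (p - 2) * w)) := by gcongr
        _ = C1 * S ^ (p - 2) * (w ^ β * w) := by ring
        _ ≤ C1 * (2 ^ |p - 2| * (Q ^ (p - 2) * (1 + |y|) ^ (p - 1))) * (w ^ β * w) := by gcongr
        _ = C1 * 2 ^ |p - 2| * (H ^ μ * (ω ^ (β + 1) * Q ^ (p - 2))) * (1 + |y|) ^ (p - 1) := by
            rw [eww, eμ]; ring
        _ ≤ C1 * 2 ^ |p - 2| * (H ^ μ * (ω ^ (β + 1 + (p - 2)) + Q ^ (β + 1 + (p - 2)))) *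
              (1 + |y|) ^ (p - 1) := by
            have := mul_rpow_le_add hω0 hQ0 (by linarith : 0 ≤ β + 1) (by linarith : 0 ≤ p - 2)
            gcongr
        _ = C1 * 2 ^ |p - 2| * (H ^ μ * (ω ^ (p + β - 1) + Q ^ (p + β - 1))) *
              (1 + |y|) ^ (p - 1) := by
            rw [show β + 1 + (p - 2) = p + β - 1 by ring]
        _ ≤ _ := by
            gcongr
            exact le_max_right _ _
    · have eμ : μ = p + β - 1 := by rw [hμ, max_eq_right (by linarith)]; ring
      rcases hw0.eq_or_lt with h0 | hw'
      · have : w ^ β = 0 := by rw [← h0]; exact Real.zero_rpow (by linarith)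
        rw [this, zero_mul]; positivity
      have hSw : S ^ (p - 2) ≤ w ^ (p - 2) := Real.rpow_le_rpow_of_nonpos hw' hwS (by linarith)
      have h2' : (1:ℝ) ≤ 2 ^ |p - 2| := Real.one_le_rpow (by norm_num) (abs_nonneg _)
      have eww : w ^ β * (w ^ (p - 2) * w) = H ^ μ * ω ^ (p + β - 1) := by
        rw [eμ, ← Real.mul_rpow hH.le hω0, ← eW]
        nth_rewrite 3 [← Real.rpow_one w]
        rw [← Real.rpow_add hw', ← Real.rpow_add hw']; congr 1; ring
      calc w ^ β * |Jp p (b - y) - Jp p (a - y)| ≤ w ^ β * (C1 * (S ^ (p - 2) * w)) := by gcongr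
        _ ≤ w ^ β * (C1 * (w ^ (p - 2) * w)) := by gcongr
        _ = C1 * 1 * (w ^ β * (w ^ (p - 2) * w)) * 1 := by ring
        _ = C1 * 1 * (H ^ μ * (ω ^ (p + β - 1) + 0)) * 1 := by rw [eww, add_zero]
        _ ≤ C1 * 2 ^ |p - 2| * (H ^ μ * (ω ^ (p + β - 1) + Q ^ (p + β - 1))) *
              (1 + |y|) ^ (p - 1) := by
            gcongr
            positivity
        _ ≤ _ := by
            gcongr
            exact le_max_right _ _
  · rw [abs_Jp hp]
    have e1 : |a - y| ^ (p - 1) ≤ Q ^ (p - 1) * (1 + |y|) ^ (p - 1) := by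
      rw [← Real.mul_rpow hQ0 (by positivity)]
      exact Real.rpow_le_rpow (abs_nonneg _) haQ (by linarith)
    have e2 : w ^ β * H = H ^ (β + 1) * ω ^ β := by
      rw [eW, Real.mul_rpow hH.le hω0, Real.rpow_add hH, Real.rpow_one]; ring
    calc w ^ β * (H * |a - y| ^ (p - 1)) ≤
          w ^ β * (H * (Q ^ (p - 1) * (1 + |y|) ^ (p - 1))) := by gcongr
      _ = (w ^ β * H) * Q ^ (p - 1) * (1 + |y|) ^ (p - 1) := by ring
      _ = 1 * (H ^ (β + 1) * (ω ^ β * Q ^ (p - 1))) * (1 + |y|) ^ (p - 1) := by rw [e2]; ring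
      _ ≤ 1 * (H ^ μ * (ω ^ (β + (p - 1)) + Q ^ (β + (p - 1)))) * (1 + |y|) ^ (p - 1) := by
          have := mul_rpow_le_add hω0 hQ0 (by linarith : 0 ≤ β) (by linarith : 0 ≤ p - 1)
          gcongr
      _ = 1 * (H ^ μ * (ω ^ (p + β - 1) + Q ^ (p + β - 1))) * (1 + |y|) ^ (p - 1) := by
          rw [show β + (p - 1) = p + β - 1 by ring]
      _ ≤ _ := by
          gcongr
          exact le_max_left _ _

/-- Euclidean space. -/
abbrev Eu (n : ℕ) := EuclideanSpace ℝ (Fin n)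

lemma Eu_nontrivial {n : ℕ} (hn : 1 ≤ n) : Nontrivial (Eu n) := by
  have : Nonempty (Fin n) := ⟨⟨0, hn⟩⟩
  infer_instance

lemma lint_ball_norm_rpow {n : ℕ} (hn : 1 ≤ n) {γ : ℝ} (hγ : -(n : ℝ) < γ) (r : ℝ) :
    ∫⁻ z in ball (0 : Eu n) r, ENNReal.ofReal (‖z‖ ^ γ) < ⊤ := by
  have := Eu_nontrivial hn
  have h : IntegrableOn (fun z : Eu n => ‖z‖ ^ γ) (ball 0 r) volume := by
    rw [integrableOn_fun_norm_addHaar (μ := (volume : Measure (Eu n))) (f := fun t => t ^ γ)]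
    simp only [finrank_euclideanSpace, Fintype.card_fin, smul_eq_mul]
    have h1 : IntegrableOn (fun y : ℝ => y ^ ((n : ℝ) - 1 + γ)) (Ioo 0 r) volume := by
      rcases le_or_gt r 0 with hr | hr
      · simp [Ioo_eq_empty (not_lt.mpr hr)]
      · exact (intervalIntegral.integrableOn_Ioo_rpow_iff hr).2 (by linarith)
    refine h1.congr_fun (fun y hy => ?_) measurableSet_Ioo
    have hy0 : 0 < y := hy.1
    simp only
    rw [Real.rpow_add hy0, ← Real.rpow_natCast, Nat.cast_sub hn]
    simp
  have := h.2
  rw [hasFiniteIntegral_iff_ofReal] at this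
  · exact this
  · exact Filter.Eventually.of_forall fun z => Real.rpow_nonneg (norm_nonneg _) _

lemma lint_rpow_le {α : Type*} [MeasurableSpace α] (μ : Measure α) {q : ℝ} (hq : 1 ≤ q)
    {g : α → ℝ≥0∞} (hg : AEMeasurable g μ) :
    (∫⁻ x, g x ∂μ) ^ q ≤ μ univ ^ (q - 1) * ∫⁻ x, g x ^ q ∂μ := by
  rcases eq_or_lt_of_le hq with rfl | hq1
  · simp
  have hc : q.HolderConjugate (q / (q - 1)) := Real.HolderConjugate.conjExponent hq1
  have h := ENNReal.lintegral_mul_le_Lp_mul_Lq μ hc hg (aemeasurable_const (b := (1 : ℝ≥0∞)))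
  have hq0 : 0 < q := by linarith
  calc (∫⁻ x, g x ∂μ) ^ q ≤ ((∫⁻ x, g x ^ q ∂μ) ^ (1 / q) * (∫⁻ x, (1 : ℝ≥0∞) ^ (q / (q - 1)) ∂μ) ^ (1 / (q / (q - 1)))) ^ q := by
        refine ENNReal.rpow_le_rpow ?_ hq0.le
        simpa using h
    _ = _ := by
        rw [ENNReal.mul_rpow_of_nonneg _ _ hq0.le, ← ENNReal.rpow_mul, ← ENNReal.rpow_mul]
        simp only [ENNReal.one_rpow, lintegral_const, one_mul]
        rw [one_div_mul_cancel hq0.ne', ENNReal.rpow_one, mul_comm]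
        congr 2
        have : q - 1 ≠ 0 := by linarith
        field_simp

lemma diff_pointwise {n : ℕ} {q : ℝ} (hq : 1 ≤ q) {u : Eu n → ℝ} {Ω : Set (Eu n)}
    (hΩ : IsOpen Ω) (hu : ContDiffOn ℝ 1 u Ω) (x z : Eu n)
    (hseg : ∀ t ∈ Icc (0 : ℝ) 1, x + t • z ∈ Ω) :
    ENNReal.ofReal (|u (x + z) - u x| ^ q) ≤
      ∫⁻ t in Ioc (0 : ℝ) 1, ENNReal.ofReal ((‖fderiv ℝ u (x + t • z)‖ * ‖z‖) ^ q) := by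
  have hq0 : 0 ≤ q := by linarith
  have hline : ∀ t : ℝ, HasDerivAt (fun t : ℝ => x + t • z) z t := by
    intro t
    simpa using ((hasDerivAt_id t).smul_const z).const_add x
  have hder : ∀ t ∈ uIcc (0 : ℝ) 1, HasDerivAt (fun t : ℝ => u (x + t • z))
      (fderiv ℝ u (x + t • z) z) t := by
    intro t ht
    rw [uIcc_of_le zero_le_one] at ht
    have hd : DifferentiableAt ℝ u (x + t • z) :=
      (hu.differentiableOn (by norm_num)).differentiableAt (hΩ.mem_nhds (hseg t ht))
    exact hd.hasFDerivAt.comp_hasDerivAt t (hline t)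
  have hcf : ContinuousOn (fun t : ℝ => fderiv ℝ u (x + t • z)) (Icc 0 1) := by
    have := hu.continuousOn_fderiv_of_isOpen hΩ (by norm_num)
    exact this.comp (by fun_prop) hseg
  have hc : ContinuousOn (fun t : ℝ => fderiv ℝ u (x + t • z) z) (uIcc 0 1) := by
    rw [uIcc_of_le zero_le_one]
    exact hcf.clm_apply continuousOn_const
  have hftc := intervalIntegral.integral_eq_sub_of_hasDerivAt hder hc.intervalIntegrable
  simp only [one_smul, zero_smul, add_zero] at hftc
  have h1 : ENNReal.ofReal (|u (x + z) - u x|) ≤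
      ∫⁻ t in Ioc (0 : ℝ) 1, ENNReal.ofReal (‖fderiv ℝ u (x + t • z)‖ * ‖z‖) := by
    rw [← hftc, intervalIntegral.integral_of_le zero_le_one, ← Real.norm_eq_abs, ofReal_norm]
    refine (enorm_integral_le_lintegral_enorm _).trans (lintegral_mono fun t => ?_)
    rw [← ofReal_norm]
    exact ENNReal.ofReal_le_ofReal ((fderiv ℝ u (x + t • z)).le_opNorm z)
  have hm : Measurable (fun t : ℝ => ENNReal.ofReal (‖fderiv ℝ u (x + t • z)‖ * ‖z‖)) := by
    have := (measurable_fderiv ℝ u).comp (by fun_prop : Measurable (fun t : ℝ => x + t • z))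
    have := this.norm
    exact (this.mul_const _).ennreal_ofReal
  have h2 := lint_rpow_le (volume.restrict (Ioc (0 : ℝ) 1)) hq hm.aemeasurable
  rw [← ENNReal.ofReal_rpow_of_nonneg (abs_nonneg _) hq0]
  refine (ENNReal.rpow_le_rpow h1 hq0).trans (h2.trans (le_of_eq ?_))
  simp only [Measure.restrict_apply_univ, Real.volume_Ioc, sub_zero, ENNReal.ofReal_one,
    ENNReal.one_rpow, one_mul]
  refine lintegral_congr fun t => ?_
  rw [ENNReal.ofReal_rpow_of_nonneg (by positivity) hq0]

lemma measurable_gradpow {n : ℕ} (u : Eu n → ℝ) (q : ℝ) :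
    Measurable fun x => ENNReal.ofReal (‖fderiv ℝ u x‖ ^ q) :=
  ((measurable_fderiv ℝ u).norm.pow_const q).ennreal_ofReal

lemma lint_translate_le {n : ℕ} {A B : Set (Eu n)} (hA : MeasurableSet A) (hB : MeasurableSet B)
    (z : Eu n) (h : ∀ x ∈ A, x + z ∈ B) (G : Eu n → ℝ≥0∞) :
    ∫⁻ x in A, G (x + z) ≤ ∫⁻ x in B, G x := by
  rw [← lintegral_indicator hA, ← lintegral_indicator hB,
    ← lintegral_add_right_eq_self (fun x => B.indicator G x) z]
  refine lintegral_mono fun x => ?_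
  by_cases hx : x ∈ A
  · simp [hx, h x hx]
  · simp [hx]

lemma diff_lint {n : ℕ} {q : ℝ} (hq : 1 ≤ q) {u : Eu n → ℝ} {Ω A B : Set (Eu n)}
    (hΩ : IsOpen Ω) (hu : ContDiffOn ℝ 1 u Ω) (hBΩ : B ⊆ Ω) (hA : MeasurableSet A)
    (hB : MeasurableSet B) (z : Eu n)
    (hseg : ∀ x ∈ A, ∀ t ∈ Icc (0 : ℝ) 1, x + t • z ∈ B) :
    ∫⁻ x in A, ENNReal.ofReal (|u (x + z) - u x| ^ q) ≤
      ENNReal.ofReal (‖z‖ ^ q) * ∫⁻ x in B, ENNReal.ofReal (‖fderiv ℝ u x‖ ^ q) := by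
  have hm := measurable_gradpow u q
  calc ∫⁻ x in A, ENNReal.ofReal (|u (x + z) - u x| ^ q)
      ≤ ∫⁻ x in A, ∫⁻ t in Ioc (0 : ℝ) 1, ENNReal.ofReal (‖z‖ ^ q) *
          ENNReal.ofReal (‖fderiv ℝ u (x + t • z)‖ ^ q) := by
        refine setLIntegral_mono' hA fun x hx => ?_
        refine (diff_pointwise hq hΩ hu x z fun t ht => hBΩ (hseg x hx t ht)).trans ?_
        refine lintegral_mono fun t => ?_
        simp only
        rw [Real.mul_rpow (norm_nonneg _) (norm_nonneg _), mul_comm,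
          ENNReal.ofReal_mul (by positivity)]
    _ = ∫⁻ t in Ioc (0 : ℝ) 1, ∫⁻ x in A, ENNReal.ofReal (‖z‖ ^ q) *
          ENNReal.ofReal (‖fderiv ℝ u (x + t • z)‖ ^ q) := by
        apply lintegral_lintegral_swap
        refine Measurable.aemeasurable ?_
        refine Measurable.const_mul ?_ _
        exact hm.comp (by fun_prop : Measurable (fun p : Eu n × ℝ => p.1 + p.2 • z))
    _ ≤ ∫⁻ t in Ioc (0 : ℝ) 1, ENNReal.ofReal (‖z‖ ^ q) * ∫⁻ x in B, ENNReal.ofReal (‖fderiv ℝ u x‖ ^ q) := by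
        refine setLIntegral_mono' measurableSet_Ioc fun t ht => ?_
        rw [lintegral_const_mul' _ _ ENNReal.ofReal_ne_top]
        refine mul_le_mul' le_rfl ?_
        exact lint_translate_le hA hB (t • z) (fun x hx => hseg x hx t ⟨ht.1.le, ht.2⟩)
          (fun x => ENNReal.ofReal (‖fderiv ℝ u x‖ ^ q))
    _ = _ := by simp

lemma dd_lint {n : ℕ} {q : ℝ} (hq : 1 ≤ q) (ρ : ℝ) (hρ : 0 < ρ) {u : Eu n → ℝ} {Ω : Set (Eu n)}
    (hΩ : IsOpen Ω) (hu : ContDiffOn ℝ 1 u Ω) (hum : Measurable u) (hB : ball 0 ρ ⊆ Ω) :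
    ∫⁻ x in ball (0 : Eu n) ρ, ∫⁻ y in ball (0 : Eu n) ρ, ENNReal.ofReal (|u y - u x| ^ q) ≤
      (ENNReal.ofReal ((2 * ρ) ^ q) * volume (ball (0 : Eu n) (2 * ρ))) *
        ∫⁻ x in ball (0 : Eu n) ρ, ENNReal.ofReal (‖fderiv ℝ u x‖ ^ q) := by
  set B := ball (0 : Eu n) ρ with hBdef
  have hBm : MeasurableSet B := measurableSet_ball
  set I := ∫⁻ x in B, ENNReal.ofReal (‖fderiv ℝ u x‖ ^ q) with hI
  have hq0 : 0 ≤ q := by linarith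
  have e1 : ∀ x, ∫⁻ y in B, ENNReal.ofReal (|u y - u x| ^ q) =
      ∫⁻ z, B.indicator (fun y => ENNReal.ofReal (|u y - u x| ^ q)) (x + z) := by
    intro x
    rw [← lintegral_indicator hBm, lintegral_add_left_eq_self
      (fun y => B.indicator (fun y => ENNReal.ofReal (|u y - u x| ^ q)) y) x]
  calc ∫⁻ x in B, ∫⁻ y in B, ENNReal.ofReal (|u y - u x| ^ q)
      = ∫⁻ x in B, ∫⁻ z, B.indicator (fun y => ENNReal.ofReal (|u y - u x| ^ q)) (x + z) := by
        simp_rw [e1]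
    _ = ∫⁻ z, ∫⁻ x in B, B.indicator (fun y => ENNReal.ofReal (|u y - u x| ^ q)) (x + z) := by
        apply lintegral_lintegral_swap
        refine Measurable.aemeasurable ?_
        have : (Function.uncurry fun x z => B.indicator (fun y => ENNReal.ofReal (|u y - u x| ^ q)) (x + z))
          = ({w : Eu n × Eu n | w.1 + w.2 ∈ B}).indicator (fun w => ENNReal.ofReal (|u (w.1 + w.2) - u w.1| ^ q)) := by
          funext w
          simp only [Function.uncurry, indicator, mem_ofPred_eq]
        rw [this]
        refine Measurable.indicator (by fun_prop) ?_
        exact hBm.preimage (by fun_prop : Measurable (fun w : Eu n × Eu n => w.1 + w.2))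
    _ ≤ ∫⁻ z, (ball (0 : Eu n) (2 * ρ)).indicator (fun _ => ENNReal.ofReal ((2 * ρ) ^ q) * I) z := by
        refine lintegral_mono fun z => ?_
        simp only
        by_cases hz : z ∈ ball (0 : Eu n) (2 * ρ)
        · rw [indicator_of_mem hz]
          set A := {x : Eu n | x ∈ B ∧ x + z ∈ B} with hA
          have hAm : MeasurableSet A := hBm.inter (hBm.preimage (by fun_prop : Measurable (fun x : Eu n => x + z)))
          have h := diff_lint (B := B) hq hΩ hu hB hAm hBm z (by
            intro x hx t ht
            have hc : Convex ℝ B := convex_ball _ _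
            have := hc.add_smul_sub_mem hx.1 hx.2 ht
            simpa using this)
          calc _ = ∫⁻ x in A, ENNReal.ofReal (|u (x + z) - u x| ^ q) := by
                rw [← lintegral_indicator hBm, ← lintegral_indicator hAm]
                refine lintegral_congr fun x => ?_
                by_cases h1 : x ∈ B <;> by_cases h2 : x + z ∈ B <;> simp [hA, h1, h2]
            _ ≤ _ := h
            _ ≤ _ := by
                gcongr
                exact (mem_ball_zero_iff.1 hz).le
        · rw [indicator_of_notMem hz]
          rw [nonpos_iff_eq_zero]
          refine setLIntegral_eq_zero hBm fun x hx => ?_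
          have : x + z ∉ B := by
            intro h
            apply hz
            have h1 : ‖x‖ < ρ := by simpa [hBdef] using hx
            have h2 : ‖x + z‖ < ρ := by simpa [hBdef] using h
            have : ‖z‖ ≤ ‖x + z‖ + ‖x‖ := by simpa using norm_sub_le (x + z) x
            simp; linarith
          simp [this]
    _ = _ := by
        rw [lintegral_indicator measurableSet_ball]
        simp
        ring

lemma poincare_aux {n : ℕ} {q : ℝ} (hq : 1 ≤ q) (ρ : ℝ) (hρ : 0 < ρ) :
    ∃ C : ℝ≥0∞, C ≠ ⊤ ∧ ∀ (u : Eu n → ℝ) (Ω : Set (Eu n)), IsOpen Ω → ContDiffOn ℝ 1 u Ω →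
      Measurable u → ball 0 ρ ⊆ Ω →
      (∫⁻ x in ball (0 : Eu n) ρ, (∫⁻ y in ball (0 : Eu n) ρ, ENNReal.ofReal (|u y - u x|)) ^ q) ≤
        C * ∫⁻ x in ball (0 : Eu n) ρ, ENNReal.ofReal (‖fderiv ℝ u x‖ ^ q) := by
  have hq0 : 0 ≤ q := by linarith
  have hv : volume (ball (0 : Eu n) ρ) ≠ ⊤ := measure_ball_lt_top.ne
  have hv2 : volume (ball (0 : Eu n) (2 * ρ)) ≠ ⊤ := measure_ball_lt_top.ne
  refine ⟨(volume (ball (0 : Eu n) ρ)) ^ (q - 1) * (ENNReal.ofReal ((2 * ρ) ^ q) * volume (ball (0 : Eu n) (2 * ρ))),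
    ?_, fun u Ω hΩ hu hum hB => ?_⟩
  · exact ENNReal.mul_ne_top (ENNReal.rpow_ne_top_of_nonneg (by linarith) hv)
      (ENNReal.mul_ne_top ENNReal.ofReal_ne_top hv2)
  rw [mul_assoc]
  refine le_trans ?_ (mul_le_mul' le_rfl (dd_lint hq ρ hρ hΩ hu hum hB))
  rw [← lintegral_const_mul' _ _ (ENNReal.rpow_ne_top_of_nonneg (by linarith) hv)]
  refine lintegral_mono fun x => ?_
  have := lint_rpow_le (volume.restrict (ball (0 : Eu n) ρ)) hq
    (g := fun y => ENNReal.ofReal (|u y - u x|)) (by fun_prop)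
  refine this.trans (le_of_eq ?_)
  rw [Measure.restrict_apply_univ]
  congr 1
  refine lintegral_congr fun y => ?_
  rw [ENNReal.ofReal_rpow_of_nonneg (abs_nonneg _) hq0]

lemma C1_integrableOn_ball {n : ℕ} {ρ : ℝ} {u : Eu n → ℝ} {Ω : Set (Eu n)}
    (hu : ContDiffOn ℝ 1 u Ω) (hB : closedBall 0 ρ ⊆ Ω) : IntegrableOn u (ball 0 ρ) volume := by
  have : IntegrableOn u (closedBall 0 ρ) volume :=
    (hu.continuousOn.mono hB).integrableOn_compact (isCompact_closedBall _ _)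
  exact this.mono_set ball_subset_closedBall

lemma poincare_mean {n : ℕ} {q : ℝ} (hq : 1 ≤ q) (ρ : ℝ) (hρ : 0 < ρ) :
    ∃ C : ℝ≥0∞, C ≠ ⊤ ∧ ∀ (u : Eu n → ℝ) (Ω : Set (Eu n)), IsOpen Ω → ContDiffOn ℝ 1 u Ω →
      Measurable u → closedBall 0 ρ ⊆ Ω → ∫ x in ball (0 : Eu n) ρ, u x = 0 →
      ∫⁻ x in ball (0 : Eu n) ρ, ENNReal.ofReal (|u x| ^ q) ≤
        C * ∫⁻ x in ball (0 : Eu n) ρ, ENNReal.ofReal (‖fderiv ℝ u x‖ ^ q) := by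
  have hq0 : 0 ≤ q := by linarith
  obtain ⟨C, hC, h⟩ := poincare_aux (n := n) hq ρ hρ
  set V := volume (ball (0 : Eu n) ρ) with hV
  have hVt : V ≠ ⊤ := measure_ball_lt_top.ne
  have hV0 : V ≠ 0 := (measure_ball_pos volume 0 hρ).ne'
  refine ⟨(V⁻¹) ^ q * C, ENNReal.mul_ne_top (ENNReal.rpow_ne_top_of_nonneg hq0 (ENNReal.inv_ne_top.2 hV0)) hC, ?_⟩
  intro u Ω hΩ hu hum hB hmean
  rw [mul_assoc]
  refine le_trans ?_ (mul_le_mul' le_rfl (h u Ω hΩ hu hum (ball_subset_closedBall.trans hB)))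
  rw [← lintegral_const_mul' _ _ (ENNReal.rpow_ne_top_of_nonneg hq0 (ENNReal.inv_ne_top.2 hV0))]
  refine lintegral_mono fun x => ?_
  have hintg := C1_integrableOn_ball hu hB
  have h1 : V * ENNReal.ofReal (|u x|) ≤ ∫⁻ y in ball (0 : Eu n) ρ, ENNReal.ofReal (|u y - u x|) := by
    have e : ∫ y in ball (0 : Eu n) ρ, (u y - u x) = - (V.toReal * u x) := by
      rw [integral_sub hintg (integrableOn_const hVt), hmean]
      simp [hV, Measure.real]
    have h2 := enorm_integral_le_lintegral_enorm (μ := volume.restrict (ball (0 : Eu n) ρ)) (fun y => u y - u x)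
    rw [e, enorm_neg, enorm_mul] at h2
    simp only [← ofReal_norm, Real.norm_eq_abs] at h2
    rwa [abs_of_nonneg ENNReal.toReal_nonneg, ENNReal.ofReal_toReal hVt] at h2
  have h3 : ENNReal.ofReal (|u x|) ≤ V⁻¹ * ∫⁻ y in ball (0 : Eu n) ρ, ENNReal.ofReal (|u y - u x|) := by
    calc ENNReal.ofReal (|u x|) = V⁻¹ * (V * ENNReal.ofReal (|u x|)) := by
          rw [← mul_assoc, ENNReal.inv_mul_cancel hV0 hVt, one_mul]
      _ ≤ _ := mul_le_mul' le_rfl h1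
  rw [← ENNReal.ofReal_rpow_of_nonneg (abs_nonneg _) hq0, ← ENNReal.mul_rpow_of_nonneg _ _ hq0]
  exact ENNReal.rpow_le_rpow h3 hq0

lemma ennreal_add_rpow_le {q : ℝ} (hq : 0 ≤ q) (a b : ℝ≥0∞) :
    (a + b) ^ q ≤ 2 ^ q * (a ^ q + b ^ q) := by
  rw [mul_add]
  rcases le_total a b with h | h
  · refine le_trans ?_ le_add_self
    rw [← ENNReal.mul_rpow_of_nonneg _ _ hq, two_mul]
    gcongr
  · refine le_trans ?_ le_self_add
    rw [← ENNReal.mul_rpow_of_nonneg _ _ hq, two_mul]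
    gcongr

lemma poincare_L1 {n : ℕ} {q : ℝ} (hq : 1 ≤ q) (ρ : ℝ) (hρ : 0 < ρ) :
    ∃ C : ℝ≥0∞, C ≠ ⊤ ∧ ∀ (u : Eu n → ℝ) (Ω : Set (Eu n)), IsOpen Ω → ContDiffOn ℝ 1 u Ω →
      Measurable u → ball 0 ρ ⊆ Ω →
      ∫⁻ x in ball (0 : Eu n) ρ, ENNReal.ofReal (|u x| ^ q) ≤
        C * ((∫⁻ x in ball (0 : Eu n) ρ, ENNReal.ofReal (‖fderiv ℝ u x‖ ^ q)) +
          (∫⁻ x in ball (0 : Eu n) ρ, ENNReal.ofReal (|u x|)) ^ q) := by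
  have hq0 : 0 ≤ q := by linarith
  obtain ⟨C, hC, h⟩ := poincare_aux (n := n) hq ρ hρ
  set V := volume (ball (0 : Eu n) ρ) with hV
  have hVt : V ≠ ⊤ := measure_ball_lt_top.ne
  have hV0 : V ≠ 0 := (measure_ball_pos volume 0 hρ).ne'
  have hVi : (V⁻¹) ^ q ≠ ⊤ := ENNReal.rpow_ne_top_of_nonneg hq0 (ENNReal.inv_ne_top.2 hV0)
  have h2t : (2 : ℝ≥0∞) ^ q ≠ ⊤ := ENNReal.rpow_ne_top_of_nonneg hq0 (by norm_num)
  refine ⟨(V⁻¹) ^ q * 2 ^ q * (C + V), ENNReal.mul_ne_top (ENNReal.mul_ne_top hVi h2t) (ENNReal.add_ne_top.2 ⟨hC, hVt⟩), ?_⟩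
  intro u Ω hΩ hu hum hB
  set I := ∫⁻ x in ball (0 : Eu n) ρ, ENNReal.ofReal (‖fderiv ℝ u x‖ ^ q)
  set U := ∫⁻ x in ball (0 : Eu n) ρ, ENNReal.ofReal (|u x|) with hU
  have hpt : ∀ x, ENNReal.ofReal (|u x| ^ q) ≤ (V⁻¹) ^ q * 2 ^ q *
      ((∫⁻ y in ball (0 : Eu n) ρ, ENNReal.ofReal (|u y - u x|)) ^ q + U ^ q) := by
    intro x
    have h1 : V * ENNReal.ofReal (|u x|) ≤ (∫⁻ y in ball (0 : Eu n) ρ, ENNReal.ofReal (|u y - u x|)) + U := by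
      rw [hU, ← lintegral_add_left (by fun_prop)]
      have : V * ENNReal.ofReal (|u x|) = ∫⁻ y in ball (0 : Eu n) ρ, ENNReal.ofReal (|u x|) := by
        simp [hV, mul_comm]
      rw [this]
      refine lintegral_mono fun y => ?_
      simp only
      rw [← ENNReal.ofReal_add (abs_nonneg _) (abs_nonneg _)]
      refine ENNReal.ofReal_le_ofReal ?_
      have := abs_sub (u y) (u y - u x)
      rw [sub_sub_cancel] at this; linarith
    have h3 : ENNReal.ofReal (|u x|) ≤ V⁻¹ * ((∫⁻ y in ball (0 : Eu n) ρ, ENNReal.ofReal (|u y - u x|)) + U) := by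
      calc ENNReal.ofReal (|u x|) = V⁻¹ * (V * ENNReal.ofReal (|u x|)) := by
            rw [← mul_assoc, ENNReal.inv_mul_cancel hV0 hVt, one_mul]
        _ ≤ _ := mul_le_mul' le_rfl h1
    rw [← ENNReal.ofReal_rpow_of_nonneg (abs_nonneg _) hq0]
    refine (ENNReal.rpow_le_rpow h3 hq0).trans ?_
    rw [ENNReal.mul_rpow_of_nonneg _ _ hq0, mul_assoc]
    exact mul_le_mul' le_rfl (ennreal_add_rpow_le hq0 _ _)
  calc ∫⁻ x in ball (0 : Eu n) ρ, ENNReal.ofReal (|u x| ^ q)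
      ≤ ∫⁻ x in ball (0 : Eu n) ρ, (V⁻¹) ^ q * 2 ^ q *
      ((∫⁻ y in ball (0 : Eu n) ρ, ENNReal.ofReal (|u y - u x|)) ^ q + U ^ q) := lintegral_mono hpt
    _ = (V⁻¹) ^ q * 2 ^ q * ((∫⁻ x in ball (0 : Eu n) ρ, (∫⁻ y in ball (0 : Eu n) ρ, ENNReal.ofReal (|u y - u x|)) ^ q) + U ^ q * V) := by
        rw [lintegral_const_mul' _ _ (ENNReal.mul_ne_top hVi h2t), lintegral_add_right _ measurable_const]
        simp [hV]
    _ ≤ (V⁻¹) ^ q * 2 ^ q * (C * I + U ^ q * V) := by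
        refine mul_le_mul' le_rfl (add_le_add (h u Ω hΩ hu hum hB) le_rfl)
    _ ≤ (V⁻¹) ^ q * 2 ^ q * ((C + V) * (I + U ^ q)) := by
        refine mul_le_mul' le_rfl ?_
        calc C * I + U ^ q * V ≤ (C * I + U ^ q * V) + (C * U ^ q + V * I) := le_self_add
          _ = _ := by ring
    _ = _ := by ring

/-- Normalised solution on the ball of radius two. -/
structure NData (n : ℕ) (s p : ℝ) (u : Eu n → ℝ) : Prop where
  meas : Measurable u
  c1 : ∃ Ω : Set (Eu n), IsOpen Ω ∧ closedBall 0 2 ⊆ Ω ∧ ContDiffOn ℝ 1 u Ω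
  eqn : ∀ φ : Eu n → ℝ, Measurable φ →
    (∃ L : ℝ, (∀ x, |φ x| ≤ L) ∧ ∀ x y, |φ x - φ y| ≤ L * ‖x - y‖) →
    (∃ r < (2 : ℝ), ∀ x, r ≤ ‖x‖ → φ x = 0) →
    ∫ x, ∫ y, Jp p (u x - u y) * (φ x - φ y) / dist x y ^ ((n : ℝ) + s * p) = 0
  grad : ∫⁻ x in ball (0 : Eu n) 2, ENNReal.ofReal (‖fderiv ℝ u x‖ ^ p) ≤ 1
  tail : ∫⁻ x in (ball (0 : Eu n) 2)ᶜ,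
    ENNReal.ofReal (|u x| ^ (p - 1) / ‖x‖ ^ ((n : ℝ) + s * p)) ≤ 1
  mean : ∫ x in ball (0 : Eu n) 2, u x = 0

lemma real_add_rpow_le {q : ℝ} (hq : 0 ≤ q) {a b : ℝ} (ha : 0 ≤ a) (hb : 0 ≤ b) :
    (a + b) ^ q ≤ 2 ^ q * (a ^ q + b ^ q) := by
  rcases le_total a b with h | h
  · calc (a + b) ^ q ≤ (2 * b) ^ q := Real.rpow_le_rpow (by positivity) (by linarith) hq
      _ = 2 ^ q * b ^ q := Real.mul_rpow (by norm_num) hb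
      _ ≤ _ := by gcongr; linarith [Real.rpow_nonneg ha q]
  · calc (a + b) ^ q ≤ (2 * a) ^ q := Real.rpow_le_rpow (by positivity) (by linarith) hq
      _ = 2 ^ q * a ^ q := Real.mul_rpow (by norm_num) ha
      _ ≤ _ := by gcongr; linarith [Real.rpow_nonneg hb q]

lemma NData.u_Lp {n : ℕ} {s p : ℝ} (hp : 1 < p) : ∃ C : ℝ≥0∞, C ≠ ⊤ ∧ ∀ u : Eu n → ℝ,
    NData n s p u → ∫⁻ x in ball (0 : Eu n) 2, ENNReal.ofReal (|u x| ^ p) ≤ C := by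
  obtain ⟨C, hC, h⟩ := poincare_mean (n := n) hp.le 2 (by norm_num)
  refine ⟨C, hC, fun u hu => ?_⟩
  obtain ⟨Ω, hΩ, hB, hc⟩ := hu.c1
  refine (h u Ω hΩ hc hu.meas hB hu.mean).trans ?_
  calc _ ≤ C * 1 := mul_le_mul' le_rfl hu.grad
    _ = C := mul_one _

lemma NData.weight {n : ℕ} {s p : ℝ} (hp : 1 < p) (hs : 0 < s * p) :
    ∃ C : ℝ≥0∞, C ≠ ⊤ ∧ ∀ u : Eu n → ℝ, NData n s p u →
    ∫⁻ y, ENNReal.ofReal ((1 + |u y|) ^ (p - 1) * (1 + ‖y‖) ^ (-((n : ℝ) + s * p))) ≤ C := by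
  obtain ⟨C, hC, h⟩ := NData.u_Lp (n := n) (s := s) hp
  set m := (n : ℝ) + s * p with hm
  have hm0 : 0 < m := by positivity
  have hW : ∫⁻ y : Eu n, ENNReal.ofReal ((1 + ‖y‖) ^ (-m)) < ⊤ :=
    finite_integral_one_add_norm (by simp [hm]; linarith)
  set W := ∫⁻ y : Eu n, ENNReal.ofReal ((1 + ‖y‖) ^ (-m))
  set V := volume (ball (0 : Eu n) 2) with hV
  have hVt : V ≠ ⊤ := measure_ball_lt_top.ne
  refine ⟨ENNReal.ofReal (2 ^ p) * (V + C) + ENNReal.ofReal (2 ^ (p - 1)) * (W + 1), ?_, ?_⟩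
  · have := hW.ne
    finiteness
  intro u hu
  have hum := hu.meas
  rw [← lintegral_add_compl _ (measurableSet_ball (x := (0 : Eu n)) (ε := 2))]
  refine add_le_add ?_ ?_
  · calc ∫⁻ y in ball (0 : Eu n) 2, ENNReal.ofReal ((1 + |u y|) ^ (p - 1) * (1 + ‖y‖) ^ (-m))
        ≤ ∫⁻ y in ball (0 : Eu n) 2, ENNReal.ofReal (2 ^ p) * (1 + ENNReal.ofReal (|u y| ^ p)) := by
          refine lintegral_mono fun y => ?_
          simp only
          rw [← ENNReal.ofReal_one, ← ENNReal.ofReal_add (by norm_num) (by positivity),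
            ← ENNReal.ofReal_mul (by positivity)]
          refine ENNReal.ofReal_le_ofReal ?_
          have h1 : (1 + ‖y‖) ^ (-m) ≤ 1 :=
            Real.rpow_le_one_of_one_le_of_nonpos (by linarith [norm_nonneg y]) (by linarith)
          have h2 : (1 + |u y|) ^ (p - 1) ≤ (1 + |u y|) ^ p :=
            Real.rpow_le_rpow_of_exponent_le (by linarith [abs_nonneg (u y)]) (by linarith)
          have h3 := real_add_rpow_le (q := p) (by linarith) zero_le_one (abs_nonneg (u y))
          rw [Real.one_rpow] at h3
          calc _ ≤ (1 + |u y|) ^ p * 1 := by gcongr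
            _ ≤ _ := by linarith
      _ = ENNReal.ofReal (2 ^ p) * (V + ∫⁻ y in ball (0 : Eu n) 2, ENNReal.ofReal (|u y| ^ p)) := by
          rw [lintegral_const_mul' _ _ ENNReal.ofReal_ne_top, lintegral_add_left measurable_const]
          simp [hV]
      _ ≤ _ := by
          have := h u hu
          gcongr
  · calc ∫⁻ y in (ball (0 : Eu n) 2)ᶜ, ENNReal.ofReal ((1 + |u y|) ^ (p - 1) * (1 + ‖y‖) ^ (-m))
        ≤ ∫⁻ y in (ball (0 : Eu n) 2)ᶜ, ENNReal.ofReal (2 ^ (p - 1)) * (ENNReal.ofReal ((1 + ‖y‖) ^ (-m)) + ENNReal.ofReal (|u y| ^ (p - 1) / ‖y‖ ^ m)) := by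
          refine setLIntegral_mono' measurableSet_ball.compl fun y hy => ?_
          rw [← ENNReal.ofReal_add (by positivity) (by positivity),
            ← ENNReal.ofReal_mul (by positivity)]
          refine ENNReal.ofReal_le_ofReal ?_
          have hy2 : 2 ≤ ‖y‖ := by simpa using hy
          have h1 : (1 + ‖y‖) ^ (-m) ≤ (‖y‖ ^ m)⁻¹ := by
            rw [← Real.rpow_neg (norm_nonneg _)]
            exact Real.rpow_le_rpow_of_nonpos (by linarith) (by linarith) (by linarith)
          have h3 := real_add_rpow_le (q := p - 1) (by linarith) zero_le_one (abs_nonneg (u y))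
          rw [Real.one_rpow] at h3
          have h4 : 0 ≤ (1 + ‖y‖) ^ (-m) := by positivity
          calc _ ≤ (2 ^ (p - 1) * (1 + |u y| ^ (p - 1))) * (1 + ‖y‖) ^ (-m) := by gcongr
            _ = 2 ^ (p - 1) * ((1 + ‖y‖) ^ (-m) + |u y| ^ (p - 1) * (1 + ‖y‖) ^ (-m)) := by ring
            _ ≤ _ := by
              rw [div_eq_mul_inv]
              gcongr
      _ = ENNReal.ofReal (2 ^ (p - 1)) * ((∫⁻ y in (ball (0 : Eu n) 2)ᶜ, ENNReal.ofReal ((1 + ‖y‖) ^ (-m))) +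
            ∫⁻ y in (ball (0 : Eu n) 2)ᶜ, ENNReal.ofReal (|u y| ^ (p - 1) / ‖y‖ ^ m)) := by
          rw [lintegral_const_mul' _ _ ENNReal.ofReal_ne_top, lintegral_add_left (by fun_prop)]
      _ ≤ _ := by
          refine mul_le_mul' le_rfl (add_le_add (setLIntegral_le_lintegral _ _) hu.tail)

lemma NData.u_Lq {n : ℕ} {s p : ℝ} (hp : 1 < p) {q : ℝ} (hq : 1 ≤ q) {ρ : ℝ} (hρ : 0 < ρ)
    (hρ2 : ρ ≤ 2) {G : ℝ≥0∞} (hG : G ≠ ⊤) :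
    ∃ C : ℝ≥0∞, C ≠ ⊤ ∧ ∀ u : Eu n → ℝ, NData n s p u →
      ∫⁻ x in ball (0 : Eu n) ρ, ENNReal.ofReal (‖fderiv ℝ u x‖ ^ q) ≤ G →
      ∫⁻ x in ball (0 : Eu n) ρ, ENNReal.ofReal (|u x| ^ q) ≤ C := by
  obtain ⟨C, hC, h⟩ := NData.u_Lp (n := n) (s := s) hp
  obtain ⟨C', hC', h'⟩ := poincare_L1 (n := n) hq ρ hρ
  set V := volume (ball (0 : Eu n) 2) with hV
  have hVt : V ≠ ⊤ := measure_ball_lt_top.ne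
  refine ⟨C' * (G + (V + C) ^ q), ?_, ?_⟩
  · have : (V + C) ^ q ≠ ⊤ := ENNReal.rpow_ne_top_of_nonneg (by linarith) (by finiteness)
    finiteness
  intro u hu hg
  obtain ⟨Ω, hΩ, hB, hc⟩ := hu.c1
  have hsub : ball (0 : Eu n) ρ ⊆ ball 0 2 := ball_subset_ball hρ2
  refine (h' u Ω hΩ hc hu.meas (hsub.trans (ball_subset_closedBall.trans hB))).trans ?_
  have : ∫⁻ x in ball (0 : Eu n) ρ, ENNReal.ofReal (|u x|) ≤ V + C := by
    calc _ ≤ ∫⁻ x in ball (0 : Eu n) 2, ENNReal.ofReal (|u x|) := lintegral_mono_set hsub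
      _ ≤ ∫⁻ x in ball (0 : Eu n) 2, (1 + ENNReal.ofReal (|u x| ^ p)) := by
          refine lintegral_mono fun x => ?_
          simp only
          rw [← ENNReal.ofReal_one, ← ENNReal.ofReal_add (by norm_num) (by positivity)]
          refine ENNReal.ofReal_le_ofReal ?_
          rcases le_total (|u x|) 1 with h1 | h1
          · linarith [Real.rpow_nonneg (abs_nonneg (u x)) p]
          · have := Real.rpow_le_rpow_of_exponent_le h1 hp.le
            rw [Real.rpow_one] at this; linarith
      _ ≤ _ := by
          rw [lintegral_add_left measurable_const]
          have := h u hu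
          simp only [lintegral_const, Measure.restrict_apply_univ, one_mul]
          gcongr
  gcongr

/-- Regular part of the kernel. -/
def K2 {n : ℕ} (m r : ℝ) (z : Eu n) : ℝ := (max ‖z‖ r) ^ (-m)

/-- Singular part of the kernel. -/
def K1 {n : ℕ} (m r : ℝ) (z : Eu n) : ℝ := max 0 (‖z‖ ^ (-m) - K2 m r z)

section kernels
variable {n : ℕ} {m r : ℝ}

lemma K2_nonneg (hr : 0 < r) (z : Eu n) : 0 ≤ K2 m r z := by unfold K2; positivity
lemma K1_nonneg (z : Eu n) : 0 ≤ K1 m r z := le_max_left _ _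
lemma K2_neg (z : Eu n) : K2 m r (-z) = K2 m r z := by simp [K2]
lemma K1_neg (z : Eu n) : K1 m r (-z) = K1 m r z := by simp [K1, K2]
lemma K2_meas : Measurable (K2 m r : Eu n → ℝ) := by unfold K2; fun_prop
lemma K1_meas : Measurable (K1 m r : Eu n → ℝ) := by unfold K1 K2; fun_prop

lemma K1_le (hr : 0 < r) (z : Eu n) : K1 m r z ≤ ‖z‖ ^ (-m) := by
  unfold K1
  have := K2_nonneg (m := m) hr z
  exact max_le (by positivity) (by linarith)

lemma K1_zero (z : Eu n) (h : r ≤ ‖z‖) : K1 m r z = 0 := by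
  simp [K1, K2, max_eq_left h]

lemma K_add (hr : 0 < r) (hm : 0 ≤ m) {z : Eu n} (hz : z ≠ 0) : ‖z‖ ^ (-m) = K1 m r z + K2 m r z := by
  unfold K1
  rw [max_eq_right]; · ring
  unfold K2
  have : 0 < ‖z‖ := norm_pos_iff.2 hz
  have := Real.rpow_le_rpow_of_nonpos this (le_max_left ‖z‖ r) (by linarith : -m ≤ 0)
  linarith

lemma K1_lower (hr : 0 < r) (z : Eu n) (hz : z ≠ 0) (hm : 0 < m) (h : ‖z‖ ≤ r / 2) :
    (1 - 2 ^ (-m)) * ‖z‖ ^ (-m) ≤ K1 m r z := by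
  unfold K1
  refine le_trans ?_ (le_max_right _ _)
  unfold K2
  rw [max_eq_right (by linarith)]
  have hz : z ≠ 0 := hz
  · have hz0 : 0 < ‖z‖ := norm_pos_iff.2 hz
    have : r ^ (-m) ≤ 2 ^ (-m) * ‖z‖ ^ (-m) := by
      rw [← Real.mul_rpow (by norm_num) hz0.le]
      exact Real.rpow_le_rpow_of_nonpos (by positivity) (by linarith) (by linarith)
    linarith

lemma rpow_neg_sub_le {a b : ℝ} (ha : 0 < a) (hab : a ≤ b) (hm : 0 ≤ m) :
    a ^ (-m) - b ^ (-m) ≤ m * ((b - a) / a) * a ^ (-m) := by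
  have hb : 0 < b := ha.trans_le hab
  have h1 : b ^ (-m) = (b / a) ^ (-m) * a ^ (-m) := by
    rw [← Real.mul_rpow (by positivity) ha.le, div_mul_cancel₀ _ ha.ne']
  have h2 : 1 - m * (b / a - 1) ≤ (b / a) ^ (-m) := by
    rw [Real.rpow_def_of_pos (by positivity)]
    have h3 := Real.log_le_sub_one_of_pos (by positivity : 0 < b / a)
    have h4 := Real.add_one_le_exp (Real.log (b / a) * -m)
    nlinarith
  have h5 : (b - a) / a = b / a - 1 := by field_simp
  rw [h1, h5]
  have : 0 ≤ a ^ (-m) := by positivity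
  nlinarith

lemma K2_lip (hr : 0 < r) (hm : 0 ≤ m) (z h : Eu n) (hh : ‖h‖ ≤ r) :
    |K2 m r (z + h) - K2 m r z| ≤ (m * 2 ^ m / r) * ‖h‖ * K2 m r z := by
  unfold K2
  set t := max ‖z‖ r with ht
  set t' := max ‖z + h‖ r with ht'
  have htr : r ≤ t := le_max_right _ _
  have htr' : r ≤ t' := le_max_right _ _
  have ht0 : 0 < t := by linarith
  have ht0' : 0 < t' := by linarith
  have hd : |t' - t| ≤ ‖h‖ := by
    refine (abs_max_sub_max_le_abs _ _ _).trans ?_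
    have := abs_norm_sub_norm_le (z + h) z
    simpa using this
  have h1 : t' ^ (-m) ≤ 2 ^ m * t ^ (-m) := by
    have : t / 2 ≤ t' := by
      have := abs_le.1 hd; linarith
    calc t' ^ (-m) ≤ (t / 2) ^ (-m) := Real.rpow_le_rpow_of_nonpos (by positivity) this (by linarith)
      _ = _ := by
        rw [Real.div_rpow ht0.le (by norm_num), Real.rpow_neg (by norm_num : (0:ℝ) ≤ 2)]
        field_simp
  have h2 : (1 : ℝ) ≤ 2 ^ m := Real.one_le_rpow (by norm_num) hm
  have hpos : 0 ≤ t ^ (-m) := by positivity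
  have key : ∀ d, 0 ≤ d → d ≤ ‖h‖ → ∀ a, r ≤ a → a ^ (-m) ≤ 2 ^ m * t ^ (-m) →
      m * (d / a) * a ^ (-m) ≤ (m * 2 ^ m / r) * ‖h‖ * t ^ (-m) := by
    intro d hd0 hd a ha hat
    have ha0 : 0 < a := by linarith
    calc m * (d / a) * a ^ (-m) ≤ m * (‖h‖ / r) * (2 ^ m * t ^ (-m)) := by gcongr
      _ = _ := by ring
  rcases le_total t t' with h | h
  · rw [abs_sub_comm, abs_of_nonneg (by
      have := Real.rpow_le_rpow_of_nonpos ht0 h (by linarith : -m ≤ 0); linarith)]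
    refine (rpow_neg_sub_le ht0 h hm).trans (key _ (by linarith) ?_ t htr ?_)
    · rw [abs_of_nonneg (by linarith)] at hd; exact hd
    · nlinarith
  · rw [abs_of_nonneg (by
      have := Real.rpow_le_rpow_of_nonpos ht0' h (by linarith : -m ≤ 0); linarith)]
    refine (rpow_neg_sub_le ht0' h hm).trans (key _ (by linarith) ?_ t' htr' h1)
    · rw [abs_sub_comm, abs_of_nonneg (by linarith)] at hd; exact hd

lemma K2_le (hr : 0 < r) (hm : 0 ≤ m) (x y : Eu n) (hx : ‖x‖ ≤ 3) :
    K2 m r (x - y) ≤ (4 / r + 1) ^ m * (1 + ‖y‖) ^ (-m) := by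
  unfold K2
  set t := max ‖x - y‖ r with ht
  have htr : r ≤ t := le_max_right _ _
  have ht0 : 0 < t := by linarith
  have h1 : 1 + ‖y‖ ≤ (4 / r + 1) * t := by
    have e : ‖y‖ ≤ ‖x‖ + ‖x - y‖ := by
      have := norm_sub_le x (x - y); simpa using this
    have e2 : ‖x - y‖ ≤ t := le_max_left _ _
    have e3 : 4 ≤ 4 / r * t := by
      rw [div_mul_eq_mul_div, le_div_iff₀ hr]; linarith
    nlinarith
  have h0 : 0 < 1 + ‖y‖ := by positivity
  calc t ^ (-m) = (4 / r + 1) ^ m * ((4 / r + 1) * t) ^ (-m) := by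
        rw [Real.mul_rpow (by positivity) ht0.le, ← mul_assoc, ← Real.rpow_add (by positivity)]
        simp
    _ ≤ _ := by
        gcongr ?_ * ?_
        exact Real.rpow_le_rpow_of_nonpos h0 h1 (by linarith)

end kernels

lemma Jp_meas {p : ℝ} : Measurable (Jp p) := by unfold Jp; fun_prop

lemma Jp_comp_meas {α : Type*} [MeasurableSpace α] {p : ℝ} {f : α → ℝ} (hf : Measurable f) :
    Measurable fun x => Jp p (f x) := Jp_meas.comp hf

lemma int_K1 {n : ℕ} (hn : 1 ≤ n) {s p : ℝ} (hp : 1 < p) (hs1 : s * p < p) {r : ℝ} (hr : 0 < r)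
    {a M L : ℝ} {v φ : Eu n → ℝ} (hv : Measurable v) (hφ : Measurable φ) (hM : 0 ≤ M)
    (hvl : ∀ x y, ‖x‖ < a + r → ‖y‖ < a + r → |v x - v y| ≤ M * ‖x - y‖)
    (hφL : ∀ x y, |φ x - φ y| ≤ L * ‖x - y‖) (hφ0 : ∀ x, a ≤ ‖x‖ → φ x = 0) :
    Integrable (fun w : Eu n × Eu n => Jp p (v w.1 - v w.2) * (φ w.1 - φ w.2) *
      K1 ((n : ℝ) + s * p) r (w.1 - w.2)) (volume.prod volume) := by
  set m := (n : ℝ) + s * p with hm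
  have hmeas : Measurable (fun w : Eu n × Eu n => Jp p (v w.1 - v w.2) * (φ w.1 - φ w.2) *
      K1 m r (w.1 - w.2)) := by
    refine Measurable.mul (Measurable.mul (Jp_comp_meas (by fun_prop)) (by fun_prop)) ?_
    exact K1_meas.comp (by fun_prop)
  refine ⟨hmeas.aestronglyMeasurable, ?_⟩
  set g : Eu n → ℝ≥0∞ := (ball (0 : Eu n) r).indicator (fun z => ENNReal.ofReal (M ^ (p - 1) * L) * ENNReal.ofReal (‖z‖ ^ (p - m))) with hg
  have hgm : Measurable g := by
    refine Measurable.indicator ?_ measurableSet_ball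
    fun_prop
  have hgf : ∫⁻ z, g z < ⊤ := by
    rw [hg, lintegral_indicator measurableSet_ball, lintegral_const_mul' _ _ ENNReal.ofReal_ne_top]
    exact ENNReal.mul_lt_top ENNReal.ofReal_lt_top (lint_ball_norm_rpow hn (by simp [hm]; linarith) r)
  have hpt : ∀ x y, ‖Jp p (v x - v y) * (φ x - φ y) * K1 m r (x - y)‖ₑ ≤
      (ball (0 : Eu n) (a + r)).indicator 1 x * g (x - y) := by
    intro x y
    by_cases hxy : x = y
    · subst hxy; simp [Jp_zero]
    by_cases hd : r ≤ ‖x - y‖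
    · simp [K1_zero _ hd]
    by_cases h0 : a ≤ ‖x‖ ∧ a ≤ ‖y‖
    · simp [hφ0 x h0.1, hφ0 y h0.2]
    have hd' : ‖x - y‖ < r := not_le.1 hd
    have hx : ‖x‖ < a + r ∧ ‖y‖ < a + r := by
      have e1 : ‖x‖ ≤ ‖y‖ + ‖x - y‖ := by have := norm_add_le y (x - y); simpa using this
      have e2 : ‖y‖ ≤ ‖x‖ + ‖x - y‖ := by have := norm_sub_le x (x - y); simpa using this
      rw [not_and_or, not_le, not_le] at h0
      rcases h0 with h0 | h0 <;> constructor <;> linarith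
    have hz : 0 < ‖x - y‖ := norm_pos_iff.2 (sub_ne_zero.2 hxy)
    rw [hg, indicator_of_mem (by simpa using hx.1), indicator_of_mem (by simpa using hd'),
      Pi.one_apply, one_mul, ← ofReal_norm, ← ENNReal.ofReal_mul' (by positivity)]
    refine ENNReal.ofReal_le_ofReal ?_
    rw [norm_mul, norm_mul, Real.norm_eq_abs, abs_Jp hp, Real.norm_eq_abs, Real.norm_eq_abs,
      abs_of_nonneg (K1_nonneg _)]
    have hL0 : 0 ≤ L * ‖x - y‖ := (abs_nonneg _).trans (hφL x y)
    calc _ ≤ (M * ‖x - y‖) ^ (p - 1) * (L * ‖x - y‖) * ‖x - y‖ ^ (-m) := by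
          have hk := K1_nonneg (m := m) (r := r) (x - y)
          have hp1 : 0 ≤ p - 1 := by linarith
          gcongr
          · exact hvl x y hx.1 hx.2
          · exact hφL x y
          · exact K1_le hr _
      _ = _ := by
          rw [Real.mul_rpow hM hz.le]
          have : ‖x - y‖ ^ (p - m) = ‖x - y‖ ^ (p - 1) * ‖x - y‖ * ‖x - y‖ ^ (-m) := by
            conv_rhs => rw [← Real.rpow_add_one hz.ne', ← Real.rpow_add hz]
            congr 1; ring
          rw [this]; ring
  unfold HasFiniteIntegral
  rw [lintegral_prod _ hmeas.enorm.aemeasurable]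
  calc _ ≤ ∫⁻ x, ∫⁻ y, (ball (0 : Eu n) (a + r)).indicator 1 x * g (x - y) :=
        lintegral_mono fun x => lintegral_mono fun y => hpt x y
    _ = ∫⁻ x, (ball (0 : Eu n) (a + r)).indicator 1 x * ∫⁻ z, g z := by
        refine lintegral_congr fun x => ?_
        rw [lintegral_const_mul _ (by fun_prop), lintegral_sub_left_eq_self]
    _ = volume (ball (0 : Eu n) (a + r)) * ∫⁻ z, g z := by
        rw [lintegral_mul_const _ (measurable_one.indicator measurableSet_ball), lintegral_indicator_one measurableSet_ball]
    _ < ⊤ := ENNReal.mul_lt_top measure_ball_lt_top hgf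

lemma J_far_bound {n : ℕ} {p m r : ℝ} (hp : 1 < p) (hm : 0 ≤ m) (hr : 0 < r) {M t : ℝ}
    (ht : |t| ≤ M) (τ : ℝ) (x y : Eu n) (hx : ‖x‖ ≤ 3) :
    |Jp p (t - τ) * K2 m r (x - y)| ≤
      (1 + M) ^ (p - 1) * (4 / r + 1) ^ m * ((1 + |τ|) ^ (p - 1) * (1 + ‖y‖) ^ (-m)) := by
  have hM : 0 ≤ M := (abs_nonneg _).trans ht
  rw [abs_mul, abs_Jp hp, abs_of_nonneg (K2_nonneg hr _)]
  calc _ ≤ ((1 + M) * (1 + |τ|)) ^ (p - 1) * ((4 / r + 1) ^ m * (1 + ‖y‖) ^ (-m)) := by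
        have hk := K2_nonneg (m := m) hr (x - y)
        gcongr ?_ * ?_
        · refine Real.rpow_le_rpow (abs_nonneg _) ?_ (by linarith)
          have := abs_sub t τ
          nlinarith [abs_nonneg τ, abs_nonneg t]
        · exact K2_le hr hm x y hx
    _ = _ := by
        rw [Real.mul_rpow (by positivity) (by positivity)]; ring

lemma int_K2_inner {n : ℕ} {p m r : ℝ} (hp : 1 < p) (hm : 0 ≤ m) (hr : 0 < r)
    {v : Eu n → ℝ} (hv : Measurable v)
    (hw : Integrable (fun y => (1 + |v y|) ^ (p - 1) * (1 + ‖y‖) ^ (-m)) volume)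
    (t : ℝ) (x : Eu n) (hx : ‖x‖ ≤ 3) :
    Integrable (fun y => Jp p (t - v y) * K2 m r (x - y)) volume := by
  refine (hw.const_mul ((1 + |t|) ^ (p - 1) * (4 / r + 1) ^ m)).mono' ?_ ?_
  · refine Measurable.aestronglyMeasurable ?_
    exact (Jp_comp_meas (by fun_prop)).mul (K2_meas.comp (by fun_prop))
  · exact Filter.Eventually.of_forall fun y => J_far_bound hp hm hr le_rfl _ x y hx

lemma int_K2 {n : ℕ} {p m r : ℝ} (hp : 1 < p) (hm : 0 ≤ m) (hr : 0 < r) {a M L : ℝ} (ha : a ≤ 3)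
    {v φ : Eu n → ℝ} (hv : Measurable v) (hφ : Measurable φ)
    (hw : Integrable (fun y => (1 + |v y|) ^ (p - 1) * (1 + ‖y‖) ^ (-m)) volume)
    (hvM : ∀ x, ‖x‖ < a → |v x| ≤ M)
    (hφL : ∀ x, |φ x| ≤ L) (hφ0 : ∀ x, a ≤ ‖x‖ → φ x = 0) :
    Integrable (fun w : Eu n × Eu n => Jp p (v w.1 - v w.2) * φ w.1 *
      K2 m r (w.1 - w.2)) (volume.prod volume) := by
  have hφi : Integrable φ volume := by
    have h1 : IntegrableOn φ (ball 0 a) volume := by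
      refine Measure.integrableOn_of_bounded (M := L) measure_ball_lt_top.ne hφ.aestronglyMeasurable ?_
      exact Filter.Eventually.of_forall hφL
    rw [← integrable_indicator_iff measurableSet_ball] at h1
    refine h1.congr (Filter.Eventually.of_forall fun x => ?_)
    by_cases hx : x ∈ ball (0 : Eu n) a
    · simp [hx]
    · simp [hx, hφ0 x (by simpa using hx)]
  have hg := (hφi.norm.const_mul ((1 + M) ^ (p - 1) * (4 / r + 1) ^ m)).mul_prod hw
  refine hg.mono' ?_ ?_
  · refine Measurable.aestronglyMeasurable ?_
    refine Measurable.mul (Measurable.mul (Jp_comp_meas (by fun_prop)) (by fun_prop)) ?_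
    exact K2_meas.comp (by fun_prop)
  · refine Filter.Eventually.of_forall fun w => ?_
    by_cases hx : ‖w.1‖ < a
    · have := J_far_bound hp hm hr (hvM w.1 hx) (v w.2) w.1 w.2 (by linarith)
      rw [mul_right_comm, norm_mul]
      calc _ ≤ (1 + M) ^ (p - 1) * (4 / r + 1) ^ m * ((1 + |v w.2|) ^ (p - 1) * (1 + ‖w.2‖) ^ (-m)) * ‖φ w.1‖ := by
            gcongr
            exact this
        _ = _ := by ring
    · simp [hφ0 w.1 (not_lt.1 hx)]

lemma lin_identity {n : ℕ} (hn : 1 ≤ n) {s p : ℝ} (hp : 1 < p) (hs0 : 0 < s * p) (hs1 : s * p < p)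
    {r : ℝ} (hr : 0 < r)
    {a M L : ℝ} (ha : a ≤ 3) {v φ : Eu n → ℝ} (hv : Measurable v) (hφ : Measurable φ) (hM : 0 ≤ M)
    (hvM : ∀ x, ‖x‖ < a → |v x| ≤ M)
    (hw : Integrable (fun y => (1 + |v y|) ^ (p - 1) * (1 + ‖y‖) ^ (-((n : ℝ) + s * p))) volume)
    (hvl : ∀ x y, ‖x‖ < a + r → ‖y‖ < a + r → |v x - v y| ≤ M * ‖x - y‖)
    (hφL : ∀ x y, |φ x - φ y| ≤ L * ‖x - y‖) (hφb : ∀ x, |φ x| ≤ L)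
    (hφ0 : ∀ x, a ≤ ‖x‖ → φ x = 0)
    (heq : ∫ x, ∫ y, Jp p (v x - v y) * (φ x - φ y) / dist x y ^ ((n : ℝ) + s * p) = 0) :
    ∫ w : Eu n × Eu n, Jp p (v w.1 - v w.2) * (φ w.1 - φ w.2) *
      K1 ((n : ℝ) + s * p) r (w.1 - w.2) ∂(volume.prod volume) =
    -2 * ∫ x, φ x * ∫ y, Jp p (v x - v y) * K2 ((n : ℝ) + s * p) r (x - y) := by
  set m := (n : ℝ) + s * p with hm
  have hm0 : 0 ≤ m := by positivity
  have i1 := int_K1 hn hp hs1 hr hv hφ hM hvl hφL hφ0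
  rw [← hm] at i1
  have i2 := int_K2 hp hm0 hr ha hv hφ hw hvM hφb hφ0
  have i3 : Integrable (fun w : Eu n × Eu n => Jp p (v w.1 - v w.2) * φ w.2 *
      K2 m r (w.1 - w.2)) (volume.prod volume) := by
    refine (i2.swap.neg).congr (Filter.Eventually.of_forall fun w => ?_)
    simp only [Pi.neg_apply, Function.comp, Prod.fst_swap, Prod.snd_swap]
    rw [← neg_sub (v w.1), Jp_neg, ← neg_sub w.1, K2_neg]; ring
  have e3 : ∫ w : Eu n × Eu n, Jp p (v w.1 - v w.2) * φ w.2 * K2 m r (w.1 - w.2) ∂(volume.prod volume) =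
      - ∫ w : Eu n × Eu n, Jp p (v w.1 - v w.2) * φ w.1 * K2 m r (w.1 - w.2) ∂(volume.prod volume) := by
    rw [← integral_prod_swap, ← integral_neg]
    refine integral_congr_ae (Filter.Eventually.of_forall fun w => ?_)
    simp only [Prod.fst_swap, Prod.snd_swap]
    rw [← neg_sub (v w.1), Jp_neg, ← neg_sub w.1, K2_neg]; ring
  have hpt : ∀ x y : Eu n, Jp p (v x - v y) * (φ x - φ y) / dist x y ^ m =
      Jp p (v x - v y) * (φ x - φ y) * K1 m r (x - y) + (Jp p (v x - v y) * φ x * K2 m r (x - y)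
       - Jp p (v x - v y) * φ y * K2 m r (x - y)) := by
    intro x y
    by_cases hxy : x = y
    · subst hxy; simp [Jp_zero]
    · rw [div_eq_mul_inv, ← Real.rpow_neg dist_nonneg, dist_eq_norm,
        K_add hr hm0 (sub_ne_zero.2 hxy)]
      ring
  have itot := i1.add (i2.sub i3)
  have h0 : ∫ w : Eu n × Eu n, (Jp p (v w.1 - v w.2) * (φ w.1 - φ w.2) * K1 m r (w.1 - w.2) +
      (Jp p (v w.1 - v w.2) * φ w.1 * K2 m r (w.1 - w.2)
       - Jp p (v w.1 - v w.2) * φ w.2 * K2 m r (w.1 - w.2))) ∂(volume.prod volume) = 0 := by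
    have := integral_prod _ itot
    simp only [Pi.add_apply, Pi.sub_apply] at this
    rw [this, ← heq]
    simp_rw [hpt]
  have h1 := integral_add i1 (i2.sub i3)
  have h2 := integral_sub i2 i3
  simp only [Pi.sub_apply] at h1
  rw [h0, h2, e3] at h1
  have h4 : ∫ w : Eu n × Eu n, Jp p (v w.1 - v w.2) * φ w.1 * K2 m r (w.1 - w.2) ∂(volume.prod volume) =
      ∫ x, φ x * ∫ y, Jp p (v x - v y) * K2 m r (x - y) := by
    rw [integral_prod _ i2]
    refine integral_congr_ae (Filter.Eventually.of_forall fun x => ?_)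
    simp only
    rw [← integral_const_mul]
    refine integral_congr_ae (Filter.Eventually.of_forall fun y => ?_)
    simp only; ring
  rw [← h4]; linarith

lemma NData.lip {n : ℕ} {s p : ℝ} {u : Eu n → ℝ} (hu : NData n s p u) :
    ∃ M : ℝ, 0 ≤ M ∧ (∀ x, ‖x‖ ≤ 2 → |u x| ≤ M) ∧
      ∀ x y, ‖x‖ ≤ 2 → ‖y‖ ≤ 2 → |u x - u y| ≤ M * ‖x - y‖ := by
  obtain ⟨Ω, hΩ, hB, hc⟩ := hu.c1
  have hcomp : IsCompact (closedBall (0 : Eu n) 2) := isCompact_closedBall _ _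
  obtain ⟨M1, hM1⟩ := hcomp.exists_bound_of_continuousOn (hc.continuousOn.mono hB)
  obtain ⟨M2, hM2⟩ := hcomp.exists_bound_of_continuousOn
    ((hc.continuousOn_fderiv_of_isOpen hΩ (by norm_num)).mono hB)
  have hconv : Convex ℝ (closedBall (0 : Eu n) 2) := convex_closedBall _ _
  refine ⟨max 0 (max M1 M2), le_max_left _ _, fun x hx => ?_, fun x y hx hy => ?_⟩
  · exact (hM1 x (by simpa using hx)).trans ((le_max_left _ _).trans (le_max_right _ _))
  · have := hconv.norm_image_sub_le_of_norm_fderiv_le (𝕜 := ℝ) (f := u) (C := M2)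
      (fun z hz => (hc.differentiableOn (by norm_num)).differentiableAt (hΩ.mem_nhds (hB hz)))
      hM2 (x := y) (y := x) (by simpa using hy) (by simpa using hx)
    refine this.trans ?_
    gcongr
    exact (le_max_right _ _).trans (le_max_right _ _)

lemma Jp_lip {γ : ℝ} (hγ : 2 ≤ γ) {M : ℝ} : ∃ C : ℝ, 0 ≤ C ∧ ∀ a b : ℝ, |a| ≤ M → |b| ≤ M →
    |Jp γ b - Jp γ a| ≤ C * |b - a| := by
  obtain ⟨c, C, hc, hC, h⟩ := Jp_two_sided (p := γ) (by linarith)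
  refine ⟨C * (2 * |M|) ^ (γ - 2), by positivity, fun a b ha hb => ?_⟩
  refine (h a b).2.trans ?_
  rw [mul_assoc]
  gcongr
  linarith [le_abs_self M]

/-- Cutoff function. -/
def cut {n : ℕ} (ρ r : ℝ) (x : Eu n) : ℝ := max 0 (min 1 ((ρ + 3 * r - ‖x‖) / r))

section cutoff
variable {n : ℕ} {ρ r : ℝ}

lemma cut_nonneg (x : Eu n) : 0 ≤ cut ρ r x := le_max_left _ _
lemma cut_le_one (x : Eu n) : cut ρ r x ≤ 1 := max_le zero_le_one (min_le_left _ _)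
lemma cut_meas : Measurable (cut ρ r : Eu n → ℝ) := by unfold cut; fun_prop
lemma cut_zero (hr : 0 < r) (x : Eu n) (hx : ρ + 3 * r ≤ ‖x‖) : cut ρ r x = 0 := by
  unfold cut
  refine max_eq_left ((min_le_right _ _).trans ?_)
  exact div_nonpos_of_nonpos_of_nonneg (by linarith) hr.le
lemma cut_one (hr : 0 < r) (x : Eu n) (hx : ‖x‖ ≤ ρ + 2 * r) : cut ρ r x = 1 := by
  unfold cut
  rw [min_eq_left, max_eq_right zero_le_one]
  rw [le_div_iff₀ hr]; linarith
lemma cut_lip (hr : 0 < r) (x y : Eu n) : |cut ρ r x - cut ρ r y| ≤ (1 / r) * ‖x - y‖ := by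
  unfold cut
  rw [max_comm, max_comm 0, min_comm, min_comm 1]
  refine (abs_max_sub_max_le_abs _ _ _).trans ((abs_inf_sub_inf_le_abs _ _ _).trans ?_)
  rw [← sub_div, abs_div, abs_of_pos hr, one_div, inv_mul_eq_div]
  gcongr
  have := abs_norm_sub_norm_le y x
  rw [norm_sub_rev] at this
  have e : ρ + 3 * r - ‖x‖ - (ρ + 3 * r - ‖y‖) = ‖y‖ - ‖x‖ := by ring
  rw [e]
  exact this

end cutoff

/-- The test function. -/
def phi {n : ℕ} (u : Eu n → ℝ) (ρ r β : ℝ) (h : Eu n) (x : Eu n) : ℝ :=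
  cut ρ r x ^ 2 * Jp (β + 1) (u (x + h) - u x)

lemma phi_meas {n : ℕ} {u : Eu n → ℝ} (hu : Measurable u) {ρ r β : ℝ} {h : Eu n} :
    Measurable (phi u ρ r β h) := by
  unfold phi
  exact (cut_meas.pow_const 2).mul (Jp_comp_meas (by fun_prop))

lemma phi_zero {n : ℕ} {u : Eu n → ℝ} {ρ r β : ℝ} (hr : 0 < r) {h : Eu n} (x : Eu n)
    (hx : ρ + 3 * r ≤ ‖x‖) : phi u ρ r β h x = 0 := by
  simp [phi, cut_zero hr x hx]

lemma phi_lip {n : ℕ} {s p : ℝ} {u : Eu n → ℝ} (hu : NData n s p u) {ρ r β : ℝ} (hβ : 1 ≤ β)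
    (hr : 0 < r) (hρr : ρ + 10 * r ≤ 2) {h : Eu n} (hh : ‖h‖ ≤ r) :
    ∃ L : ℝ, (∀ x, |phi u ρ r β h x| ≤ L) ∧ ∀ x y, |phi u ρ r β h x - phi u ρ r β h y| ≤ L * ‖x - y‖ := by
  obtain ⟨M, hM, hb, hl⟩ := hu.lip
  obtain ⟨C, hC, hJ⟩ := Jp_lip (γ := β + 1) (by linarith) (M := 2 * M)
  have hs : ∀ x : Eu n, ‖x‖ < ρ + 4 * r → ‖x‖ ≤ 2 ∧ ‖x + h‖ ≤ 2 := by
    intro x hx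
    have := norm_add_le x h
    constructor <;> linarith
  have hw : ∀ x : Eu n, ‖x‖ < ρ + 4 * r → |u (x + h) - u x| ≤ 2 * M := by
    intro x hx
    have := abs_sub (u (x + h)) (u x)
    linarith [hb _ (hs x hx).1, hb _ (hs x hx).2]
  have hJb : ∀ x : Eu n, ‖x‖ < ρ + 4 * r → |Jp (β + 1) (u (x + h) - u x)| ≤ C * (2 * M) := by
    intro x hx
    have := hJ 0 _ (by simpa using hM) (hw x hx)
    rw [Jp_zero, sub_zero, sub_zero] at this
    exact this.trans (by gcongr; exact hw x hx)
  have hJl : ∀ x y : Eu n, ‖x‖ < ρ + 4 * r → ‖y‖ < ρ + 4 * r →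
      |Jp (β + 1) (u (x + h) - u x) - Jp (β + 1) (u (y + h) - u y)| ≤ C * (2 * M) * ‖x - y‖ := by
    intro x y hx hy
    refine (hJ _ _ (hw y hy) (hw x hx)).trans ?_
    have e1 := hl (x + h) (y + h) (hs x hx).2 (hs y hy).2
    have e2 := hl x y (hs x hx).1 (hs y hy).1
    rw [add_sub_add_right_eq_sub] at e1
    have e3 : |u (x + h) - u x - (u (y + h) - u y)| ≤ 2 * M * ‖x - y‖ := by
      have := abs_sub (u (x + h) - u (y + h)) (u x - u y)
      have e : u (x + h) - u x - (u (y + h) - u y) = u (x + h) - u (y + h) - (u x - u y) := by ring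
      rw [e]; linarith
    calc _ ≤ C * (2 * M * ‖x - y‖) := by gcongr
      _ = _ := by ring
  set B := C * (2 * M) with hB
  have hB0 : 0 ≤ B := by positivity
  have hsq : ∀ x : Eu n, cut ρ r x ^ 2 ≤ 1 := fun x => pow_le_one₀ (cut_nonneg x) (cut_le_one x)
  have hbd : ∀ x, |phi u ρ r β h x| ≤ B := by
    intro x
    by_cases hx : ρ + 3 * r ≤ ‖x‖
    · rw [phi_zero hr x hx]; simpa using hB0
    · unfold phi
      rw [abs_mul, abs_of_nonneg (sq_nonneg _)]
      calc _ ≤ 1 * B := by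
            gcongr
            · exact hsq x
            · exact hJb x (by linarith)
        _ = B := one_mul _
  have hnear : ∀ x y : Eu n, ‖x‖ < ρ + 4 * r → ‖y‖ < ρ + 4 * r →
      |phi u ρ r β h x - phi u ρ r β h y| ≤ (B + 2 * B / r) * ‖x - y‖ := by
    intro x y hx hy
    unfold phi
    set jx := Jp (β + 1) (u (x + h) - u x)
    set jy := Jp (β + 1) (u (y + h) - u y)
    set ex := cut ρ r x
    set ey := cut ρ r y
    have e : ex ^ 2 * jx - ey ^ 2 * jy = ex ^ 2 * (jx - jy) + (ex + ey) * (ex - ey) * jy := by ring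
    rw [e]
    refine (abs_add_le _ _).trans ?_
    rw [abs_mul, abs_mul, abs_mul, abs_of_nonneg (sq_nonneg _)]
    have h1 : |ex + ey| ≤ 2 := by
      rw [abs_of_nonneg (add_nonneg (cut_nonneg x) (cut_nonneg y))]
      linarith [cut_le_one (ρ := ρ) (r := r) x, cut_le_one (ρ := ρ) (r := r) y]
    calc _ ≤ 1 * (B * ‖x - y‖) + 2 * (1 / r * ‖x - y‖) * B := by
          gcongr
          · exact hsq x
          · exact hJl x y hx hy
          · exact cut_lip hr x y
          · exact hJb y hy
      _ = _ := by ring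
  have hfar : ∀ x y : Eu n, ρ + 4 * r ≤ ‖y‖ →
      |phi u ρ r β h x - phi u ρ r β h y| ≤ (B + 2 * B / r) * ‖x - y‖ := by
    intro x y hy
    rw [phi_zero hr y (by linarith), sub_zero]
    by_cases hx : ρ + 3 * r ≤ ‖x‖
    · rw [phi_zero hr x hx]; simp; positivity
    · have : r ≤ ‖x - y‖ := by
        have := norm_sub_norm_le y x
        rw [norm_sub_rev] at this; linarith
      calc _ ≤ B := hbd x
        _ = B / r * r := by field_simp
        _ ≤ B / r * ‖x - y‖ := by gcongr
        _ ≤ _ := by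
          gcongr
          have : 0 ≤ B / r := by positivity
          have : 2 * B / r = 2 * (B / r) := by ring
          linarith
  refine ⟨B + 2 * B / r, fun x => (hbd x).trans ?_, fun x y => ?_⟩
  · have : 0 ≤ 2 * B / r := by positivity
    linarith
  · by_cases hx : ‖x‖ < ρ + 4 * r
    · by_cases hy : ‖y‖ < ρ + 4 * r
      · exact hnear x y hx hy
      · exact hfar x y (not_lt.1 hy)
    · rw [abs_sub_comm, norm_sub_rev]
      exact hfar y x (not_lt.1 hx)

lemma NData.eqn_shift {n : ℕ} {s p : ℝ} {u : Eu n → ℝ} (hu : NData n s p u) (φ : Eu n → ℝ)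
    (hφ : Measurable φ)
    (hL : ∃ L : ℝ, (∀ x, |φ x| ≤ L) ∧ ∀ x y, |φ x - φ y| ≤ L * ‖x - y‖) {a : ℝ}
    (h0 : ∀ x, a ≤ ‖x‖ → φ x = 0) (h : Eu n) (hh : a + ‖h‖ < 2) :
    ∫ x, ∫ y, Jp p (u (x + h) - u (y + h)) * (φ x - φ y) / dist x y ^ ((n : ℝ) + s * p) = 0 := by
  obtain ⟨L, hb, hl⟩ := hL
  have := hu.eqn (fun x => φ (x - h)) (by fun_prop) ⟨L, fun x => hb _, fun x y => by simpa using hl (x - h) (y - h)⟩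
    ⟨a + ‖h‖, hh, fun x hx => h0 _ (by have := norm_sub_norm_le x h; linarith)⟩
  rw [← this]
  rw [← integral_add_right_eq_self (fun x => ∫ y, Jp p (u x - u y) * (φ (x - h) - φ (y - h)) / dist x y ^ ((n : ℝ) + s * p)) h]
  refine integral_congr_ae (Filter.Eventually.of_forall fun x => ?_)
  simp only
  rw [← integral_add_right_eq_self (fun y => Jp p (u (x + h) - u y) * (φ (x + h - h) - φ (y - h)) / dist (x + h) y ^ ((n : ℝ) + s * p)) h]
  simp

lemma NData.weight_int {n : ℕ} {s p : ℝ} (hp : 1 < p) (hs : 0 < s * p) {u : Eu n → ℝ}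
    (hu : NData n s p u) :
    Integrable (fun y => (1 + |u y|) ^ (p - 1) * (1 + ‖y‖) ^ (-((n : ℝ) + s * p))) volume := by
  obtain ⟨C, hC, h⟩ := NData.weight (n := n) hp hs
  have hum := hu.meas
  refine ⟨by fun_prop, ?_⟩
  rw [hasFiniteIntegral_iff_ofReal (Filter.Eventually.of_forall fun y => by positivity)]
  exact (h u hu).trans_lt hC.lt_top

lemma NData.weight_int_shift {n : ℕ} {s p : ℝ} (hp : 1 < p) (hs : 0 < s * p) {u : Eu n → ℝ}
    (hu : NData n s p u) (h : Eu n) (hh : ‖h‖ ≤ 1) :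
    Integrable (fun y => (1 + |u (y + h)|) ^ (p - 1) * (1 + ‖y‖) ^ (-((n : ℝ) + s * p))) volume := by
  have h1 := ((hu.weight_int hp hs).comp_add_right h).const_mul (2 ^ ((n : ℝ) + s * p))
  have hum := hu.meas
  refine h1.mono' (by fun_prop) (Filter.Eventually.of_forall fun y => ?_)
  rw [Real.norm_of_nonneg (by positivity)]
  set m := (n : ℝ) + s * p
  have hm : 0 ≤ m := by positivity
  have e : (1 + ‖y‖) ^ (-m) ≤ 2 ^ m * (1 + ‖y + h‖) ^ (-m) := by
    have e1 : (1 + ‖y + h‖) / 2 ≤ 1 + ‖y‖ := by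
      have := norm_add_le y h
      linarith [norm_nonneg y]
    calc (1 + ‖y‖) ^ (-m) ≤ ((1 + ‖y + h‖) / 2) ^ (-m) :=
          Real.rpow_le_rpow_of_nonpos (by positivity) e1 (by linarith)
      _ = _ := by
        rw [Real.div_rpow (by positivity) (by norm_num), Real.rpow_neg (by norm_num : (0:ℝ) ≤ 2)]
        field_simp
  calc _ ≤ (1 + |u (y + h)|) ^ (p - 1) * (2 ^ m * (1 + ‖y + h‖) ^ (-m)) := by gcongr
    _ = _ := by ring

/-- The main bilinear integrand. -/
def T1 {n : ℕ} (u : Eu n → ℝ) (p m ρ r β : ℝ) (h : Eu n) (w : Eu n × Eu n) : ℝ :=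
  (Jp p (u (w.1 + h) - u (w.2 + h)) - Jp p (u w.1 - u w.2)) *
    (phi u ρ r β h w.1 - phi u ρ r β h w.2) * K1 m r (w.1 - w.2)

lemma T1_identity {n : ℕ} (hn : 1 ≤ n) {s p : ℝ} (hp : 1 < p) (hs0 : 0 < s * p) (hs1 : s * p < p)
    {u : Eu n → ℝ} (hu : NData n s p u) {ρ r β : ℝ} (hβ : 1 ≤ β) (hρ : 0 < ρ)
    (hr : 0 < r) (hρr : ρ + 10 * r ≤ 2) {h : Eu n} (hh : ‖h‖ ≤ r) :
    Integrable (T1 u p ((n : ℝ) + s * p) ρ r β h) (volume.prod volume) ∧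
    ∫ w, T1 u p ((n : ℝ) + s * p) ρ r β h w ∂(volume.prod volume) =
    -2 * ∫ x, phi u ρ r β h x * ∫ y, (Jp p (u (x + h) - u y) * K2 ((n : ℝ) + s * p) r (x + h - y)
      - Jp p (u x - u y) * K2 ((n : ℝ) + s * p) r (x - y)) := by
  set m := (n : ℝ) + s * p with hm
  have hm0 : 0 ≤ m := by positivity
  obtain ⟨M, hM, hb, hl⟩ := hu.lip
  obtain ⟨L, hφb, hφL⟩ := phi_lip hu hβ hr hρr hh
  set φ := phi u ρ r β h with hφdef
  have hφm : Measurable φ := phi_meas hu.meas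
  have hφ0 : ∀ x, ρ + 3 * r ≤ ‖x‖ → φ x = 0 := fun x hx => phi_zero hr x hx
  have hum := hu.meas
  have hum' : Measurable (fun x => u (x + h)) := by fun_prop
  have hb1 : ∀ x : Eu n, ‖x‖ < ρ + 3 * r → |u x| ≤ M := fun x hx => hb x (by linarith)
  have hn2 : ∀ x : Eu n, ‖x + h‖ ≤ ‖x‖ + r := fun x => (norm_add_le x h).trans (by linarith)
  have hb2 : ∀ x : Eu n, ‖x‖ < ρ + 3 * r → |u (x + h)| ≤ M := fun x hx => hb _ (by linarith [hn2 x])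
  have hl1 : ∀ x y : Eu n, ‖x‖ < ρ + 3 * r + r → ‖y‖ < ρ + 3 * r + r → |u x - u y| ≤ M * ‖x - y‖ :=
    fun x y hx hy => hl x y (by linarith) (by linarith)
  have hl2 : ∀ x y : Eu n, ‖x‖ < ρ + 3 * r + r → ‖y‖ < ρ + 3 * r + r →
      |u (x + h) - u (y + h)| ≤ M * ‖x - y‖ := fun x y hx hy => by
    have := hl (x + h) (y + h) (by linarith [hn2 x]) (by linarith [hn2 y])
    simpa using this
  have ha : ρ + 3 * r ≤ 3 := by linarith
  have hw1 := hu.weight_int hp hs0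
  have hw2 := hu.weight_int_shift hp hs0 h (by linarith)
  have eq1 : ∫ x, ∫ y, Jp p (u x - u y) * (φ x - φ y) / dist x y ^ m = 0 := by
    simpa using hu.eqn_shift φ hφm ⟨L, hφb, hφL⟩ hφ0 0 (by simp; linarith)
  have eq2 := hu.eqn_shift φ hφm ⟨L, hφb, hφL⟩ hφ0 h (by linarith)
  have A1 := lin_identity hn hp hs0 hs1 hr ha hum hφm hM hb1 hw1 hl1 hφL hφb hφ0 eq1
  have A2 := lin_identity (v := fun x => u (x + h)) hn hp hs0 hs1 hr ha hum' hφm hM hb2 hw2 hl2 hφL hφb hφ0 eq2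
  have i1 := int_K1 hn hp hs1 hr hum hφm hM hl1 hφL hφ0
  have i2 := int_K1 (v := fun x => u (x + h)) hn hp hs1 hr hum' hφm hM hl2 hφL hφ0
  have j1 := int_K2 (r := r) hp hm0 hr ha hum hφm hw1 hb1 hφb hφ0
  have j2 := int_K2 (r := r) (v := fun x => u (x + h)) hp hm0 hr ha hum' hφm hw2 hb2 hφb hφ0
  have k1 : Integrable (fun x => φ x * ∫ y, Jp p (u x - u y) * K2 m r (x - y)) volume := by
    refine j1.integral_prod_left.congr (Filter.Eventually.of_forall fun x => ?_)
    simp only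
    rw [← integral_const_mul]
    congr 1; funext y; ring
  have k2 : Integrable (fun x => φ x * ∫ y, Jp p (u (x + h) - u (y + h)) * K2 m r (x - y)) volume := by
    refine j2.integral_prod_left.congr (Filter.Eventually.of_forall fun x => ?_)
    simp only
    rw [← integral_const_mul]
    congr 1; funext y; ring
  have hT : ∀ w, T1 u p m ρ r β h w = Jp p (u (w.1 + h) - u (w.2 + h)) * (φ w.1 - φ w.2) * K1 m r (w.1 - w.2)
      - Jp p (u w.1 - u w.2) * (φ w.1 - φ w.2) * K1 m r (w.1 - w.2) := by
    intro w; unfold T1; ring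
  have hT' : T1 u p m ρ r β h = fun w => Jp p (u (w.1 + h) - u (w.2 + h)) * (φ w.1 - φ w.2) * K1 m r (w.1 - w.2)
      - Jp p (u w.1 - u w.2) * (φ w.1 - φ w.2) * K1 m r (w.1 - w.2) := funext hT
  refine ⟨by rw [hT']; exact i2.sub i1, ?_⟩
  rw [hT', integral_sub i2 i1, A1, A2, ← mul_sub, ← integral_sub k2 k1]
  congr 1
  refine integral_congr_ae (Filter.Eventually.of_forall fun x => ?_)
  simp only
  by_cases hx : ρ + 3 * r ≤ ‖x‖
  · simp [hφ0 x hx]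
  rw [← mul_sub]
  congr 1
  have hx3 : ‖x‖ ≤ 3 := by linarith
  have hx3' : ‖x + h‖ ≤ 3 := by linarith [hn2 x]
  rw [integral_sub (int_K2_inner hp hm0 hr hum hw1 _ _ hx3') (int_K2_inner hp hm0 hr hum hw1 _ _ hx3)]
  congr 1
  rw [← integral_add_right_eq_self (fun y => Jp p (u (x + h) - u y) * K2 m r (x + h - y)) h]
  simp

lemma phi_abs {n : ℕ} {u : Eu n → ℝ} {ρ r β : ℝ} (hβ : 1 ≤ β) {h : Eu n} (x : Eu n) :
    |phi u ρ r β h x| ≤ |u (x + h) - u x| ^ β := by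
  unfold phi
  rw [abs_mul, abs_of_nonneg (sq_nonneg _), abs_Jp (by linarith)]
  have : cut ρ r x ^ 2 ≤ 1 := pow_le_one₀ (cut_nonneg x) (cut_le_one x)
  rw [show β + 1 - 1 = β by ring]
  calc _ ≤ 1 * |u (x + h) - u x| ^ β := by gcongr
    _ = _ := one_mul _

lemma far_inner {n : ℕ} {p m β r : ℝ} (hp : 1 < p) (hm : 0 ≤ m) (hβ : 1 ≤ β) (hr : 0 < r)
    (hr1 : r ≤ 1) :
    ∃ C : ℝ, 0 ≤ C ∧ ∀ (u : Eu n → ℝ) (ρ : ℝ) (h x : Eu n), 0 < ‖h‖ → ‖h‖ ≤ r → ‖x‖ ≤ 2 →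
      ‖phi u ρ r β h x * ∫ y, (Jp p (u (x + h) - u y) * K2 m r (x + h - y)
      - Jp p (u x - u y) * K2 m r (x - y))‖ₑ ≤
      ENNReal.ofReal (C * (‖h‖ ^ ((p + β - 1) - max (p - 2) 0) *
        ((|u (x + h) - u x| / ‖h‖) ^ (p + β - 1) + (1 + |u x| + |u (x + h)|) ^ (p + β - 1)))) *
      ∫⁻ y, ENNReal.ofReal ((1 + |u y|) ^ (p - 1) * (1 + ‖y‖) ^ (-m)) := by
  obtain ⟨C, hC, hf⟩ := far_pointwise (p := p) (β := β) hp hβ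
  set κ := (4 / r + 1) ^ m with hκ
  set Λ := m * 2 ^ m / r with hΛ
  have hκ0 : 0 ≤ κ := by positivity
  have hΛ0 : 0 ≤ Λ := by positivity
  refine ⟨κ * (1 + Λ) * C, by positivity, ?_⟩
  intro u ρ h x hh0 hh hx
  set a := u x
  set b := u (x + h)
  set A := ‖h‖ ^ ((p + β - 1) - max (p - 2) 0) *
        ((|b - a| / ‖h‖) ^ (p + β - 1) + (1 + |a| + |b|) ^ (p + β - 1)) with hA
  have hA0 : 0 ≤ A := by positivity
  rw [enorm_mul]
  refine (mul_le_mul' le_rfl (enorm_integral_le_lintegral_enorm _)).trans ?_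
  rw [← lintegral_const_mul' _ _ enorm_ne_top, ← lintegral_const_mul' _ _ ENNReal.ofReal_ne_top]
  refine lintegral_mono fun y => ?_
  simp only
  rw [← enorm_mul, ← ofReal_norm, ← ENNReal.ofReal_mul (by positivity)]
  refine ENNReal.ofReal_le_ofReal ?_
  rw [norm_mul, Real.norm_eq_abs, Real.norm_eq_abs]
  have e : Jp p (b - u y) * K2 m r (x + h - y) - Jp p (a - u y) * K2 m r (x - y) =
      (Jp p (b - u y) - Jp p (a - u y)) * K2 m r (x + h - y) +
      Jp p (a - u y) * (K2 m r (x - y + h) - K2 m r (x - y)) := by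
    rw [show x - y + h = x + h - y by abel]; ring
  obtain ⟨f1, f2⟩ := hf a b (u y) ‖h‖ hh0 (by linarith)
  have hk1 := K2_le hr hm (x + h) y ((norm_add_le _ _).trans (by linarith))
  have hk2 := K2_le hr hm x y (by linarith)
  have hk3 := K2_lip hr hm (x - y) h hh
  set ω := (1 + ‖y‖) ^ (-m)
  have hω : 0 ≤ ω := by positivity
  have hk1' := K2_nonneg (m := m) hr (x + h - y)
  have hk2' := K2_nonneg (m := m) hr (x - y)
  have hφ := phi_abs (u := u) (ρ := ρ) (r := r) hβ (h := h) x
  rw [e]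
  set Y := (1 + |u y|) ^ (p - 1)
  have hY : 0 ≤ Y := by positivity
  calc _ ≤ |b - a| ^ β * (|Jp p (b - u y) - Jp p (a - u y)| * (κ * ω) +
        |Jp p (a - u y)| * (Λ * ‖h‖ * (κ * ω))) := by
        gcongr
        refine (abs_add_le _ _).trans ?_
        rw [abs_mul, abs_mul, abs_of_nonneg hk1']
        gcongr
        refine hk3.trans ?_
        gcongr
    _ = (|b - a| ^ β * |Jp p (b - u y) - Jp p (a - u y)|) * (κ * ω) +
        (|b - a| ^ β * (‖h‖ * |Jp p (a - u y)|)) * (Λ * (κ * ω)) := by ring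
    _ ≤ (C * A * Y) * (κ * ω) + (C * A * Y) * (Λ * (κ * ω)) := by
        gcongr
    _ = _ := by ring

lemma real_add3_rpow_le {q : ℝ} (hq : 0 ≤ q) {a b : ℝ} (ha : 0 ≤ a) (hb : 0 ≤ b) :
    (1 + a + b) ^ q ≤ 4 ^ q * (1 + a ^ q + b ^ q) := by
  have h1 := real_add_rpow_le hq (by positivity : 0 ≤ 1 + a) hb
  have h2 := real_add_rpow_le hq zero_le_one ha
  rw [Real.one_rpow] at h2
  have h4 : (4 : ℝ) ^ q = 2 ^ q * 2 ^ q := by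
    rw [← Real.mul_rpow (by norm_num) (by norm_num)]; norm_num
  have h5 : (1 : ℝ) ≤ 2 ^ q := Real.one_le_rpow (by norm_num) hq
  have h6 : 0 ≤ b ^ q := by positivity
  rw [h4]
  calc _ ≤ 2 ^ q * (2 ^ q * (1 + a ^ q) + 2 ^ q * b ^ q) := by
        refine h1.trans ?_
        gcongr
        nlinarith
    _ = _ := by ring

lemma T1_bound {n : ℕ} (hn : 1 ≤ n) {s p : ℝ} (hp : 1 < p) (hs0 : 0 < s * p) (hs1 : s * p < p)
    {ρ r β : ℝ} (hβ : 1 ≤ β) (hρ : 0 < ρ)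
    (hr : 0 < r) (hρr : ρ + 10 * r ≤ 2) {G : ℝ≥0∞} (hG : G ≠ ⊤) :
    ∃ C : ℝ≥0∞, C ≠ ⊤ ∧ ∀ u : Eu n → ℝ, NData n s p u →
      ∫⁻ x in ball (0 : Eu n) (ρ + 10 * r), ENNReal.ofReal (‖fderiv ℝ u x‖ ^ (p + β - 1)) ≤ G →
      ∀ h : Eu n, 0 < ‖h‖ → ‖h‖ ≤ r →
      ENNReal.ofReal (∫ w, T1 u p ((n : ℝ) + s * p) ρ r β h w ∂(volume.prod volume)) ≤
        C * ENNReal.ofReal (‖h‖ ^ ((p + β - 1) - max (p - 2) 0)) := by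
  set m := (n : ℝ) + s * p with hm
  have hm0 : 0 ≤ m := by positivity
  set q := p + β - 1 with hq
  have hq1 : 1 ≤ q := by linarith
  obtain ⟨C1, hC1, hfar⟩ := far_inner (n := n) hp hm0 hβ hr (by linarith)
  obtain ⟨W, hW, hweight⟩ := NData.weight (n := n) hp hs0
  obtain ⟨U, hU, huq⟩ := NData.u_Lq (n := n) (s := s) hp hq1 (by linarith : 0 < ρ + 10 * r) hρr hG
  set V := volume (ball (0 : Eu n) 2) with hV
  have hVt : V ≠ ⊤ := measure_ball_lt_top.ne
  refine ⟨2 * (ENNReal.ofReal C1 * (G + ENNReal.ofReal (4 ^ q) * (V + U + U)) * W), by finiteness, ?_⟩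
  intro u hu hg h hh0 hh
  have hum := hu.meas
  obtain ⟨Ω, hΩ, hB, hc⟩ := hu.c1
  obtain ⟨-, hid⟩ := T1_identity hn hp hs0 hs1 hu hβ hρ hr hρr hh
  rw [hid]
  set B := ball (0 : Eu n) (ρ + 3 * r) with hBd
  set B' := ball (0 : Eu n) (ρ + 10 * r) with hBd'
  have hBB' : B ⊆ B' := ball_subset_ball (by linarith)
  have hBm : MeasurableSet B := measurableSet_ball
  have hBm' : MeasurableSet B' := measurableSet_ball
  have hB'Ω : B' ⊆ Ω := (ball_subset_ball hρr).trans (ball_subset_closedBall.trans hB)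
  have hH : ‖h‖ ^ q ≠ 0 := by positivity
  have htrans : ∀ x ∈ B, x + h ∈ B' := by
    intro x hx
    simp only [hBd, hBd', mem_ball_zero_iff] at hx ⊢
    have := norm_add_le x h
    linarith
  -- three integrals
  have I1 : ∫⁻ x in B, ENNReal.ofReal ((|u (x + h) - u x| / ‖h‖) ^ q) ≤ G := by
    have := diff_lint hq1 hΩ hc hB'Ω hBm hBm' h (by
      intro x hx t ht
      simp only [hBd, hBd', mem_ball_zero_iff] at hx ⊢
      have h1 := norm_add_le x (t • h)
      rw [norm_smul, Real.norm_of_nonneg ht.1] at h1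
      nlinarith [ht.2, ht.1])
    calc _ = ∫⁻ x in B, ENNReal.ofReal ((‖h‖ ^ q)⁻¹) * ENNReal.ofReal (|u (x + h) - u x| ^ q) := by
          refine lintegral_congr fun x => ?_
          rw [Real.div_rpow (abs_nonneg _) hh0.le, div_eq_inv_mul, ENNReal.ofReal_mul (by positivity)]
      _ = ENNReal.ofReal ((‖h‖ ^ q)⁻¹) * ∫⁻ x in B, ENNReal.ofReal (|u (x + h) - u x| ^ q) :=
          lintegral_const_mul' _ _ ENNReal.ofReal_ne_top
      _ ≤ ENNReal.ofReal ((‖h‖ ^ q)⁻¹) * (ENNReal.ofReal (‖h‖ ^ q) * G) := by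
          refine mul_le_mul' le_rfl (this.trans (mul_le_mul' le_rfl hg))
      _ = G := by
          rw [← mul_assoc, ← ENNReal.ofReal_mul (by positivity), inv_mul_cancel₀ hH]; simp
  have I2 : ∫⁻ x in B, ENNReal.ofReal (|u x| ^ q) ≤ U :=
    (lintegral_mono_set hBB').trans (huq u hu hg)
  have I3 : ∫⁻ x in B, ENNReal.ofReal (|u (x + h)| ^ q) ≤ U :=
    (lint_translate_le hBm hBm' h htrans (fun x => ENNReal.ofReal (|u x| ^ q))).trans (huq u hu hg)
  have I4 : ∫⁻ x in B, ENNReal.ofReal ((1 + |u x| + |u (x + h)|) ^ q) ≤ ENNReal.ofReal (4 ^ q) * (V + U + U) := by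
    calc _ ≤ ∫⁻ x in B, ENNReal.ofReal (4 ^ q) * (1 + ENNReal.ofReal (|u x| ^ q) + ENNReal.ofReal (|u (x + h)| ^ q)) := by
          refine lintegral_mono fun x => ?_
          simp only
          rw [← ENNReal.ofReal_one, ← ENNReal.ofReal_add (by norm_num) (by positivity),
            ← ENNReal.ofReal_add (by positivity) (by positivity), ← ENNReal.ofReal_mul (by positivity)]
          exact ENNReal.ofReal_le_ofReal (real_add3_rpow_le (by linarith) (abs_nonneg _) (abs_nonneg _))
      _ ≤ _ := by
          rw [lintegral_const_mul' _ _ ENNReal.ofReal_ne_top, lintegral_add_left (by fun_prop), lintegral_add_left (by fun_prop)]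
          refine mul_le_mul' le_rfl (add_le_add (add_le_add ?_ I2) I3)
          simp only [lintegral_const, Measure.restrict_apply_univ, one_mul]
          exact measure_mono (ball_subset_ball (by linarith))
  set D : Eu n → ℝ := fun x => phi u ρ r β h x * ∫ y, (Jp p (u (x + h) - u y) * K2 m r (x + h - y)
      - Jp p (u x - u y) * K2 m r (x - y)) with hD
  have hstep : ‖∫ x, D x‖ₑ ≤ ENNReal.ofReal C1 * ENNReal.ofReal (‖h‖ ^ (q - max (p - 2) 0)) *
      (G + ENNReal.ofReal (4 ^ q) * (V + U + U)) * W := by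
    calc ‖∫ x, D x‖ₑ ≤ ∫⁻ x, ‖D x‖ₑ := enorm_integral_le_lintegral_enorm _
      _ = ∫⁻ x in B, ‖D x‖ₑ := by
          rw [← lintegral_indicator hBm]
          refine lintegral_congr fun x => ?_
          by_cases hx : x ∈ B
          · simp [hx]
          · have : ρ + 3 * r ≤ ‖x‖ := by simpa [hBd] using hx
            simp [hx, hD, phi_zero hr x this]
      _ ≤ ∫⁻ x in B, ENNReal.ofReal C1 * ENNReal.ofReal (‖h‖ ^ (q - max (p - 2) 0)) *
          (ENNReal.ofReal ((|u (x + h) - u x| / ‖h‖) ^ q) + ENNReal.ofReal ((1 + |u x| + |u (x + h)|) ^ q)) * W := by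
          refine setLIntegral_mono' hBm fun x hx => ?_
          have hx2 : ‖x‖ < ρ + 3 * r := by simpa [hBd] using hx
          refine (hfar u ρ h x hh0 hh (by linarith)).trans ?_
          rw [ENNReal.ofReal_mul hC1, ENNReal.ofReal_mul (by positivity), ENNReal.ofReal_add (by positivity) (by positivity), ← mul_assoc]
          exact mul_le_mul' le_rfl (hweight u hu)
      _ = ENNReal.ofReal C1 * ENNReal.ofReal (‖h‖ ^ (q - max (p - 2) 0)) *
          ((∫⁻ x in B, ENNReal.ofReal ((|u (x + h) - u x| / ‖h‖) ^ q)) + ∫⁻ x in B, ENNReal.ofReal ((1 + |u x| + |u (x + h)|) ^ q)) * W := by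
          rw [lintegral_mul_const' _ _ hW, lintegral_const_mul' _ _ (by finiteness), lintegral_add_left (by fun_prop)]
      _ ≤ _ := by
          refine mul_le_mul' (mul_le_mul' le_rfl (add_le_add I1 I4)) le_rfl
  calc ENNReal.ofReal (-2 * ∫ x, D x) ≤ ENNReal.ofReal (2 * ‖∫ x, D x‖) := by
        refine ENNReal.ofReal_le_ofReal ?_
        rw [Real.norm_eq_abs]
        linarith [neg_abs_le (∫ x, D x)]
    _ = 2 * ‖∫ x, D x‖ₑ := by
        rw [ENNReal.ofReal_mul (by norm_num), ofReal_norm]; simp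
    _ ≤ _ := mul_le_mul' le_rfl hstep
    _ = _ := by ring

lemma lint_le_of_le_add {α : Type*} [MeasurableSpace α] {μ : Measure α} {f g R : α → ℝ}
    (hg : Integrable g μ) (hR : Measurable R) (hf0 : ∀ x, 0 ≤ f x) (hR0 : ∀ x, 0 ≤ R x)
    (h : ∀ x, f x ≤ g x + R x) :
    ∫⁻ x, ENNReal.ofReal (f x) ∂μ ≤ ENNReal.ofReal (∫ x, g x ∂μ) + ∫⁻ x, ENNReal.ofReal (R x) ∂μ := by
  by_cases hT : ∫⁻ x, ENNReal.ofReal (R x) ∂μ = ⊤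
  · rw [hT]; simp
  have hRi : Integrable R μ := by
    refine ⟨hR.aestronglyMeasurable, ?_⟩
    rw [hasFiniteIntegral_iff_ofReal (Filter.Eventually.of_forall hR0)]
    exact lt_top_iff_ne_top.2 hT
  calc ∫⁻ x, ENNReal.ofReal (f x) ∂μ ≤ ∫⁻ x, ENNReal.ofReal (g x + R x) ∂μ :=
        lintegral_mono fun x => ENNReal.ofReal_le_ofReal (h x)
    _ = ENNReal.ofReal (∫ x, (g x + R x) ∂μ) := by
        exact (ofReal_integral_eq_lintegral_ofReal (hg.add hRi)
          (Filter.Eventually.of_forall fun x => (hf0 x).trans (h x))).symm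
    _ ≤ _ := by
        rw [integral_add hg hRi, ← ofReal_integral_eq_lintegral_ofReal hRi (Filter.Eventually.of_forall hR0)]
        exact ENNReal.ofReal_add_le

lemma dq_bound {n : ℕ} {q : ℝ} (hq : 1 ≤ q) {u : Eu n → ℝ} {Ω : Set (Eu n)}
    (hΩ : IsOpen Ω) (hu : ContDiffOn ℝ 1 u Ω) {a b : ℝ} (hB : ball 0 b ⊆ Ω) {G : ℝ≥0∞}
    (hG : ∫⁻ x in ball (0 : Eu n) b, ENNReal.ofReal (‖fderiv ℝ u x‖ ^ q) ≤ G)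
    (z : Eu n) (hz : a + ‖z‖ ≤ b) :
    ∫⁻ x in ball (0 : Eu n) a, ENNReal.ofReal ((|u (x + z) - u x| / ‖z‖) ^ q) ≤ G := by
  by_cases hz0 : z = 0
  · subst hz0
    simp [Real.zero_rpow (by linarith : q ≠ 0)]
  have hh0 : 0 < ‖z‖ := norm_pos_iff.2 hz0
  have hH : ‖z‖ ^ q ≠ 0 := by positivity
  have := diff_lint hq hΩ hu hB (measurableSet_ball (x := (0 : Eu n)) (ε := a)) measurableSet_ball z (by
      intro x hx t ht
      simp only [mem_ball_zero_iff] at hx ⊢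
      have h1 := norm_add_le x (t • z)
      rw [norm_smul, Real.norm_of_nonneg ht.1] at h1
      nlinarith [ht.2, ht.1])
  calc _ = ∫⁻ x in ball (0 : Eu n) a, ENNReal.ofReal ((‖z‖ ^ q)⁻¹) * ENNReal.ofReal (|u (x + z) - u x| ^ q) := by
        refine lintegral_congr fun x => ?_
        rw [Real.div_rpow (abs_nonneg _) hh0.le, div_eq_inv_mul, ENNReal.ofReal_mul (by positivity)]
    _ = ENNReal.ofReal ((‖z‖ ^ q)⁻¹) * ∫⁻ x in ball (0 : Eu n) a, ENNReal.ofReal (|u (x + z) - u x| ^ q) :=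
        lintegral_const_mul' _ _ ENNReal.ofReal_ne_top
    _ ≤ ENNReal.ofReal ((‖z‖ ^ q)⁻¹) * (ENNReal.ofReal (‖z‖ ^ q) * G) := by
        refine mul_le_mul' le_rfl (this.trans (mul_le_mul' le_rfl hG))
    _ = G := by
        rw [← mul_assoc, ← ENNReal.ofReal_mul (by positivity), inv_mul_cancel₀ hH]; simp

/-- The sum of the two increments. -/
def Sf {n : ℕ} (u : Eu n → ℝ) (h x y : Eu n) : ℝ := |u x - u y| + |u (x + h) - u (y + h)|

/-- The second order increment. -/
def df {n : ℕ} (u : Eu n → ℝ) (h x y : Eu n) : ℝ := |(u (x + h) - u x) - (u (y + h) - u y)|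

lemma SW_bound {n : ℕ} {q : ℝ} (hq : 1 ≤ q) {u : Eu n → ℝ} (hum : Measurable u) {Ω : Set (Eu n)}
    (hΩ : IsOpen Ω) (hu : ContDiffOn ℝ 1 u Ω) {a r : ℝ} (hr : 0 < r) (hB : ball 0 (a + 2 * r) ⊆ Ω) {G : ℝ≥0∞}
    (hG : ∫⁻ x in ball (0 : Eu n) (a + 2 * r), ENNReal.ofReal (‖fderiv ℝ u x‖ ^ q) ≤ G)
    (h z : Eu n) (hh : ‖h‖ ≤ r) (hz : ‖z‖ ≤ r) :
    ∫⁻ x in ball (0 : Eu n) a, ENNReal.ofReal ((Sf u h x (x + z) / ‖z‖) ^ q +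
      ((|u (x + h) - u x| + |u (x + z + h) - u (x + z)|) / ‖h‖) ^ q) ≤ ENNReal.ofReal (2 ^ q) * (4 * G) := by
  have d1 := dq_bound hq hΩ hu (a := a) hB hG z (by linarith)
  have d2 := dq_bound hq hΩ hu (a := a + r) hB hG z (by linarith)
  have d3 := dq_bound hq hΩ hu (a := a) hB hG h (by linarith)
  have d4 := dq_bound hq hΩ hu (a := a + r) hB hG h (by linarith)
  have mem : ∀ k : Eu n, ‖k‖ ≤ r → ∀ x ∈ ball (0 : Eu n) a, x + k ∈ ball (0 : Eu n) (a + r) := by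
    intro k hk x hx
    simp only [mem_ball_zero_iff] at hx ⊢
    have := norm_add_le x k
    linarith
  have d2' := (lint_translate_le measurableSet_ball measurableSet_ball h (mem h hh)
    (fun x => ENNReal.ofReal ((|u (x + z) - u x| / ‖z‖) ^ q))).trans d2
  have d4' := (lint_translate_le measurableSet_ball measurableSet_ball z (mem z hz)
    (fun x => ENNReal.ofReal ((|u (x + h) - u x| / ‖h‖) ^ q))).trans d4
  calc _ ≤ ∫⁻ x in ball (0 : Eu n) a, ENNReal.ofReal (2 ^ q) *
        ((ENNReal.ofReal ((|u (x + z) - u x| / ‖z‖) ^ q) + ENNReal.ofReal ((|u (x + h + z) - u (x + h)| / ‖z‖) ^ q)) +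
        (ENNReal.ofReal ((|u (x + h) - u x| / ‖h‖) ^ q) + ENNReal.ofReal ((|u (x + z + h) - u (x + z)| / ‖h‖) ^ q))) := by
        refine lintegral_mono fun x => ?_
        simp only
        rw [← ENNReal.ofReal_add (by positivity) (by positivity), ← ENNReal.ofReal_add (by positivity) (by positivity),
          ← ENNReal.ofReal_add (by positivity) (by positivity), ← ENNReal.ofReal_mul (by positivity)]
        refine ENNReal.ofReal_le_ofReal ?_
        rw [mul_add]
        unfold Sf
        rw [add_div, add_div, abs_sub_comm (u x), abs_sub_comm (u (x + h)), add_right_comm x z h]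
        have e1 := real_add_rpow_le (q := q) (by linarith) (by positivity : 0 ≤ |u (x + z) - u x| / ‖z‖) (by positivity : 0 ≤ |u (x + h + z) - u (x + h)| / ‖z‖)
        have e2 := real_add_rpow_le (q := q) (by linarith) (by positivity : 0 ≤ |u (x + h) - u x| / ‖h‖) (by positivity : 0 ≤ |u (x + h + z) - u (x + z)| / ‖h‖)
        exact add_le_add e1 e2
    _ ≤ ENNReal.ofReal (2 ^ q) * ((G + G) + (G + G)) := by
        rw [lintegral_const_mul' _ _ ENNReal.ofReal_ne_top, lintegral_add_left (by fun_prop),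
          lintegral_add_left (by fun_prop), lintegral_add_left (by fun_prop)]
        exact mul_le_mul' le_rfl (add_le_add (add_le_add d1 d2') (add_le_add d3 d4'))
    _ = _ := by ring

lemma near_est {n : ℕ} (hn : 1 ≤ n) {s p : ℝ} (hp : 1 < p) (hs0 : 0 < s * p) (hs1 : s * p < p)
    {ρ r β : ℝ} (hβ : 1 ≤ β) (hρ : 0 < ρ)
    (hr : 0 < r) (hρr : ρ + 10 * r ≤ 2) {G : ℝ≥0∞} (hG : G ≠ ⊤) :
    ∃ C : ℝ≥0∞, C ≠ ⊤ ∧ ∀ u : Eu n → ℝ, NData n s p u →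
      ∫⁻ x in ball (0 : Eu n) (ρ + 10 * r), ENNReal.ofReal (‖fderiv ℝ u x‖ ^ (p + β - 1)) ≤ G →
      ∀ h : Eu n, 0 < ‖h‖ → ‖h‖ ≤ r →
      ∫⁻ x in ball (0 : Eu n) (ρ + 2 * r), ∫⁻ z in ball (0 : Eu n) (r / 2),
        ENNReal.ofReal (Sf u h x (x + z) ^ (p - 2) * df u h x (x + z) ^ (β + 1) * ‖z‖ ^ (-((n : ℝ) + s * p))) ≤
        C * ENNReal.ofReal (‖h‖ ^ ((p + β - 1) - max (p - 2) 0)) := by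
  set m := (n : ℝ) + s * p with hm
  have hm0 : 0 < m := by positivity
  set q := p + β - 1 with hq
  have hq1 : 1 ≤ q := by linarith
  obtain ⟨C1, hC1, hT⟩ := T1_bound hn hp hs0 hs1 hβ hρ hr hρr hG
  obtain ⟨Ck, Ck', hCk, hCk', hkey⟩ := key_pointwise (p := p) (β := β) (L := 1 / r) hp hβ (by positivity)
  set c := 1 - (2 : ℝ) ^ (-m) with hc
  have hc0 : 0 < c := by
    have : (2 : ℝ) ^ (-m) < 1 := Real.rpow_lt_one_of_one_lt_of_neg (by norm_num) (by linarith)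
    linarith
  set Z := ∫⁻ z in ball (0 : Eu n) r, ENNReal.ofReal (‖z‖ ^ (p - m)) with hZ
  have hZt : Z ≠ ⊤ := (lint_ball_norm_rpow hn (by simp [hm]; linarith) r).ne
  refine ⟨ENNReal.ofReal c⁻¹ * (ENNReal.ofReal Ck * C1 + ENNReal.ofReal Ck' * (Z * (ENNReal.ofReal (2 ^ q) * (4 * G)))), by finiteness, ?_⟩
  intro u hu hg h hh0 hh
  have hum := hu.meas
  obtain ⟨Ω, hΩ, hB, hcd⟩ := hu.c1
  obtain ⟨hTint, -⟩ := T1_identity hn hp hs0 hs1 hu hβ hρ hr hρr hh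
  have hTb := hT u hu hg h hh0 hh
  set Hμ := ‖h‖ ^ (q - max (p - 2) 0) with hHμ
  have hHμ0 : 0 ≤ Hμ := by positivity
  set f : Eu n × Eu n → ℝ := fun w => (cut ρ r w.1 ^ 2 + cut ρ r w.2 ^ 2) *
    (Sf u h w.1 w.2 ^ (p - 2) * df u h w.1 w.2 ^ (β + 1)) * K1 m r (w.1 - w.2) with hf
  have hS0 : ∀ x y, 0 ≤ Sf u h x y := fun x y => by unfold Sf; positivity
  have hd0 : ∀ x y, 0 ≤ df u h x y := fun x y => by unfold df; positivity
  have hf0 : ∀ w, 0 ≤ f w := fun w => by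
    have := K1_nonneg (m := m) (r := r) (w.1 - w.2)
    have := hS0 w.1 w.2
    have := hd0 w.1 w.2
    simp only [hf]; positivity
  set Q : Eu n → Eu n → ℝ := fun x y => (Sf u h x y / ‖x - y‖) ^ q +
      ((|u (x + h) - u x| + |u (y + h) - u y|) / ‖h‖) ^ q with hQ
  have hQ0 : ∀ x y, 0 ≤ Q x y := fun x y => by
    have := hS0 x y
    simp only [hQ]; positivity
  set R0 : Eu n × Eu n → ℝ := fun w => Ck' * (‖w.1 - w.2‖ ^ p * Hμ * Q w.1 w.2) * K1 m r (w.1 - w.2) with hR0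
  set P : Set (Eu n × Eu n) := {w | w.1 ∈ ball (0 : Eu n) (ρ + 4 * r)} with hP
  set R : Eu n × Eu n → ℝ := P.indicator R0 with hR
  have hR00 : ∀ w, 0 ≤ R0 w := fun w => by
    have := K1_nonneg (m := m) (r := r) (w.1 - w.2)
    have := hQ0 w.1 w.2
    simp only [hR0]; positivity
  have hR0' : ∀ w, 0 ≤ R w := fun w => indicator_nonneg (fun w _ => hR00 w) w
  have hQm : Measurable (fun w : Eu n × Eu n => Q w.1 w.2) := by
    simp only [hQ, Sf]; fun_prop
  have hR0m : Measurable R0 := by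
    have := K1_meas (n := n) (m := m) (r := r)
    simp only [hR0]; fun_prop
  have hPm : MeasurableSet P := (measurableSet_ball).preimage measurable_fst
  have hRm : Measurable R := hR0m.indicator hPm
  have hfm : Measurable f := by
    have := K1_meas (n := n) (m := m) (r := r)
    have := cut_meas (n := n) (ρ := ρ) (r := r)
    simp only [hf, Sf, df]; fun_prop
  have hpt : ∀ w, f w ≤ Ck * T1 u p m ρ r β h w + R w := by
    rintro ⟨x, y⟩
    by_cases hd : r ≤ ‖x - y‖
    · have : K1 m r (x - y) = 0 := K1_zero _ hd
      simp only [hf, T1, this, mul_zero, zero_add]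
      exact hR0' _
    by_cases hxy : x = y
    · subst hxy
      have : K1 m r (x - x) = 0 := by
        rw [sub_self]
        simp only [K1, K2, norm_zero]
        rw [Real.zero_rpow (by linarith), zero_sub]
        exact max_eq_left (by simp; positivity)
      simp only [hf, T1, this, mul_zero, zero_add]
      exact hR0' _
    have hδ : 0 < ‖x - y‖ := norm_pos_iff.2 (sub_ne_zero.2 hxy)
    by_cases hxP : (x, y) ∈ P
    · rw [hR, indicator_of_mem hxP]
      have hk := hkey (u x - u y) (u (x + h) - u (y + h)) (u (x + h) - u x) (u (y + h) - u y)
        (cut ρ r x) (cut ρ r y) ‖x - y‖ ‖h‖ (cut_nonneg x) (cut_le_one x) (cut_nonneg y) (cut_le_one y)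
        (by ring) hδ hh0 (cut_lip hr x y)
      have hK := K1_nonneg (m := m) (r := r) (x - y)
      have := mul_le_mul_of_nonneg_right hk hK
      refine le_trans (le_of_eq ?_) (this.trans (le_of_eq ?_))
      · simp only [hf, Sf, df]
      · simp only [T1, phi, hR0, hQ, Sf, hHμ, hq]; ring
    · have hx4 : ρ + 4 * r ≤ ‖x‖ := by simpa [hP] using hxP
      have hy3 : ρ + 3 * r ≤ ‖y‖ := by
        have := norm_sub_norm_le x y
        linarith [not_le.1 hd]
      have hx3 : ρ + 3 * r ≤ ‖x‖ := by linarith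
      have := hR0' (x, y)
      simp only [hf, T1, cut_zero hr x hx3, cut_zero hr y hy3, phi_zero hr x hx3, phi_zero hr y hy3]
      simpa using this
  have hmain := lint_le_of_le_add (hTint.const_mul Ck) hRm hf0 hR0' hpt
  rw [integral_const_mul, ENNReal.ofReal_mul hCk.le] at hmain
  -- remainder
  have hRb : ∫⁻ w, ENNReal.ofReal (R w) ∂(volume.prod volume) ≤
      ENNReal.ofReal Ck' * (Z * (ENNReal.ofReal (2 ^ q) * (4 * G))) * ENNReal.ofReal Hμ := by
    have hB6 : ball (0 : Eu n) (ρ + 4 * r + 2 * r) ⊆ ball 0 (ρ + 10 * r) := ball_subset_ball (by linarith)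
    have hSW : ∀ z : Eu n, ‖z‖ ≤ r → ∫⁻ x in ball (0 : Eu n) (ρ + 4 * r), ENNReal.ofReal (Q x (x + z)) ≤ ENNReal.ofReal (2 ^ q) * (4 * G) := by
      intro z hz
      have := SW_bound hq1 hum hΩ hcd hr (a := ρ + 4 * r) (hB6.trans ((ball_subset_ball hρr).trans (ball_subset_closedBall.trans hB))) ((lintegral_mono_set hB6).trans hg) h z hh hz
      simpa [hQ] using this
    calc ∫⁻ w, ENNReal.ofReal (R w) ∂(volume.prod volume)
        = ∫⁻ x, ∫⁻ y, ENNReal.ofReal (R (x, y)) := lintegral_prod _ (by fun_prop)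
      _ = ∫⁻ x, ∫⁻ z, ENNReal.ofReal (R (x, x + z)) := by
          refine lintegral_congr fun x => ?_
          rw [lintegral_add_left_eq_self (fun y => ENNReal.ofReal (R (x, y))) x]
      _ = ∫⁻ z, ∫⁻ x, ENNReal.ofReal (R (x, x + z)) := by
          refine lintegral_lintegral_swap ?_
          refine Measurable.aemeasurable ?_
          exact (hRm.comp (by fun_prop : Measurable (fun w : Eu n × Eu n => (w.1, w.1 + w.2)))).ennreal_ofReal
      _ ≤ ∫⁻ z, (ball (0 : Eu n) r).indicator (fun z => ENNReal.ofReal (Ck' * Hμ) * ENNReal.ofReal (‖z‖ ^ (p - m)) * (ENNReal.ofReal (2 ^ q) * (4 * G))) z := by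
          refine lintegral_mono fun z => ?_
          simp only
          by_cases hz : r ≤ ‖z‖
          · have : ∀ x, R (x, x + z) = 0 := by
              intro x
              have : K1 m r (x - (x + z)) = 0 := K1_zero _ (by simpa using hz)
              simp only [hR, hR0, indicator, this]; simp
            simp [this]
          by_cases hz0 : z = 0
          · subst hz0
            have : ∀ x, R (x, x + 0) = 0 := by
              intro x
              have e : ‖x - (x + 0)‖ ^ p = 0 := by simp [Real.zero_rpow (by linarith : p ≠ 0)]
              simp only [hR, hR0, indicator, e]; simp
            simp only [this]; simp
          have hz' : 0 < ‖z‖ := norm_pos_iff.2 hz0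
          rw [indicator_of_mem (by simpa using hz)]
          calc ∫⁻ x, ENNReal.ofReal (R (x, x + z)) ≤ ∫⁻ x in ball (0 : Eu n) (ρ + 4 * r), ENNReal.ofReal (Ck' * Hμ) * ENNReal.ofReal (‖z‖ ^ (p - m)) * ENNReal.ofReal (Q x (x + z)) := by
                rw [← lintegral_indicator measurableSet_ball]
                refine lintegral_mono fun x => ?_
                by_cases hx : x ∈ ball (0 : Eu n) (ρ + 4 * r)
                · rw [indicator_of_mem hx]
                  have hxP : (x, x + z) ∈ P := hx
                  simp only [hR, indicator_of_mem hxP]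
                  rw [← ENNReal.ofReal_mul (by positivity), ← ENNReal.ofReal_mul (by positivity)]
                  refine ENNReal.ofReal_le_ofReal ?_
                  simp only [hR0]
                  have e1 : x - (x + z) = -z := by abel
                  rw [e1, K1_neg, norm_neg]
                  have e2 := K1_le (m := m) hr z
                  have e3 := hQ0 x (x + z)
                  have e4 : ‖z‖ ^ (p - m) = ‖z‖ ^ p * ‖z‖ ^ (-m) := by
                    rw [← Real.rpow_add hz']; congr 1
                  rw [e4]
                  calc _ ≤ Ck' * (‖z‖ ^ p * Hμ * Q x (x + z)) * ‖z‖ ^ (-m) := by gcongr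
                    _ = _ := by ring
                · have hxP : (x, x + z) ∉ P := hx
                  simp only [hR, indicator_of_notMem hxP]
                  simp
            _ = ENNReal.ofReal (Ck' * Hμ) * ENNReal.ofReal (‖z‖ ^ (p - m)) * ∫⁻ x in ball (0 : Eu n) (ρ + 4 * r), ENNReal.ofReal (Q x (x + z)) :=
                lintegral_const_mul' _ _ (by finiteness)
            _ ≤ _ := mul_le_mul' le_rfl (hSW z (not_le.1 hz).le)
      _ = _ := by
          rw [lintegral_indicator measurableSet_ball, lintegral_mul_const' _ _ (by finiteness),
            lintegral_const_mul' _ _ (by finiteness), ENNReal.ofReal_mul hCk', ← hZ]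
          ring
  -- lower bound
  have hlow : ∫⁻ x in ball (0 : Eu n) (ρ + 2 * r), ∫⁻ z in ball (0 : Eu n) (r / 2),
        ENNReal.ofReal (Sf u h x (x + z) ^ (p - 2) * df u h x (x + z) ^ (β + 1) * ‖z‖ ^ (-m)) ≤
      ENNReal.ofReal c⁻¹ * ∫⁻ w, ENNReal.ofReal (f w) ∂(volume.prod volume) := by
    rw [lintegral_prod _ (by fun_prop), ← lintegral_const_mul' _ _ (by finiteness)]
    refine (setLIntegral_mono' measurableSet_ball (fun x hx => ?_)).trans (setLIntegral_le_lintegral (ball (0 : Eu n) (ρ + 2 * r)) _)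
    rw [← lintegral_add_left_eq_self (fun y => ENNReal.ofReal (f (x, y))) x, ← lintegral_const_mul' _ _ (by finiteness)]
    refine (setLIntegral_mono' measurableSet_ball (fun z hz => ?_)).trans (setLIntegral_le_lintegral (ball (0 : Eu n) (r / 2)) _)
    rw [← ENNReal.ofReal_mul (by positivity)]
    refine ENNReal.ofReal_le_ofReal ?_
    by_cases hz0 : z = 0
    · subst hz0
      have : df u h x (x + 0) ^ (β + 1) = 0 := by
        simp only [df, add_zero, sub_self, abs_zero]
        exact Real.zero_rpow (by linarith)
      rw [this]
      have := hf0 (x, x + 0)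
      simp only [mul_zero, zero_mul]
      positivity
    have hx' : ‖x‖ < ρ + 2 * r := by simpa using hx
    have hz' : ‖z‖ < r / 2 := by simpa using hz
    simp only [hf, cut_one hr x hx'.le]
    have e1 : x - (x + z) = -z := by abel
    rw [e1, K1_neg]
    have e2 := K1_lower hr z hz0 hm0 hz'.le
    have e3 := hS0 x (x + z)
    have e4 := hd0 x (x + z)
    have e5 : ‖z‖ ^ (-m) ≤ c⁻¹ * K1 m r z := by
      rw [inv_mul_eq_div, le_div_iff₀ hc0]; linarith
    have e6 := K1_nonneg (m := m) (r := r) z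
    calc _ ≤ 1 * (Sf u h x (x + z) ^ (p - 2) * df u h x (x + z) ^ (β + 1)) * (c⁻¹ * K1 m r z) := by
          rw [one_mul]; gcongr
      _ ≤ (1 ^ 2 + cut ρ r (x + z) ^ 2) * (Sf u h x (x + z) ^ (p - 2) * df u h x (x + z) ^ (β + 1)) * (c⁻¹ * K1 m r z) := by
          gcongr
          nlinarith [sq_nonneg (cut ρ r (x + z))]
      _ = _ := by ring
  refine hlow.trans ?_
  rw [mul_assoc]
  refine mul_le_mul' le_rfl (hmain.trans ?_)
  rw [add_mul]
  refine add_le_add ?_ hRb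
  rw [mul_assoc]
  exact mul_le_mul' le_rfl hTb

lemma vol_ball_eq {n : ℕ} (hn : 1 ≤ n) {H : ℝ} (hH : 0 ≤ H) :
    volume (ball (0 : Eu n) H) = ENNReal.ofReal (H ^ (n : ℝ)) * volume (ball (0 : Eu n) 1) := by
  have := Eu_nontrivial hn
  rw [Measure.addHaar_ball _ _ hH, finrank_euclideanSpace_fin, Real.rpow_natCast]

lemma second_int {n : ℕ} (hn : 1 ≤ n) {s p : ℝ} (hp : 1 < p) (hs0 : 0 < s * p) (hs1 : s * p < p)
    {ρ r β σ : ℝ} (hβ : 1 ≤ β) (hρ : 0 < ρ) (hσ : 0 < σ) (hσ2 : 2 * σ ≤ s * p - max (p - 2) 0)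
    (hr : 0 < r) (hρr : ρ + 10 * r ≤ 2) {G : ℝ≥0∞} (hG : G ≠ ⊤) :
    ∃ C : ℝ≥0∞, C ≠ ⊤ ∧ ∀ u : Eu n → ℝ, NData n s p u →
      ∫⁻ x in ball (0 : Eu n) (ρ + 10 * r), ENNReal.ofReal (‖fderiv ℝ u x‖ ^ (p + β - 1)) ≤ G →
      ∀ h : Eu n, 0 < ‖h‖ → 4 * ‖h‖ ≤ r →
      ∫⁻ x in ball (0 : Eu n) (ρ + 2 * r), ∫⁻ z in ball (0 : Eu n) (2 * ‖h‖),
        ENNReal.ofReal (df u h x (x + z) ^ (p + β - 1)) ≤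
        C * ENNReal.ofReal (‖h‖ ^ ((n : ℝ) + (p + β - 1) + σ)) := by
  obtain ⟨C1, hC1, hT⟩ := near_est hn hp hs0 hs1 hβ hρ hr hρr hG
  set m := (n : ℝ) + s * p with hm
  have hm0 : 0 < m := by positivity
  set q := p + β - 1 with hq
  have hq1 : 1 ≤ q := by linarith
  have hv1 : volume (ball (0 : Eu n) 1) ≠ ⊤ := measure_ball_lt_top.ne
  refine ⟨ENNReal.ofReal (2 ^ m) * C1 + ENNReal.ofReal (2 ^ q * 2 ^ (n : ℝ)) * volume (ball (0 : Eu n) 1) * (ENNReal.ofReal (2 ^ q) * (4 * G)), by finiteness, ?_⟩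
  intro u hu hg h hh0 hh
  have hum := hu.meas
  obtain ⟨Ω, hΩ, hB, hcd⟩ := hu.c1
  have hNE := hT u hu hg h hh0 (by linarith)
  set H := ‖h‖ with hHd
  have hH1 : H ≤ 1 := by linarith
  set ε := H ^ σ with hε
  have hε0 : 0 < ε := by positivity
  have hε1 : ε ≤ 1 := Real.rpow_le_one hh0.le hH1 hσ.le
  set κ := max (2 - p) 0 with hκ
  have hκ0 : 0 ≤ κ := le_max_right _ _
  have hκ1 : κ ≤ 1 := max_le (by linarith) (by norm_num)
  have hS0 : ∀ x y, 0 ≤ Sf u h x y := fun x y => by unfold Sf; positivity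
  have hd0 : ∀ x y, 0 ≤ df u h x y := fun x y => by unfold df; positivity
  have hdS : ∀ x y, df u h x y ≤ Sf u h x y := fun x y => by
    unfold df Sf
    have : u (x + h) - u x - (u (y + h) - u y) = (u (x + h) - u (y + h)) - (u x - u y) := by ring
    rw [this]
    have := abs_sub (u (x + h) - u (y + h)) (u x - u y)
    linarith
  have hSm : Measurable (fun w : Eu n × Eu n => Sf u h w.1 (w.1 + w.2)) := by
    unfold Sf; fun_prop
  have hdm : Measurable (fun w : Eu n × Eu n => df u h w.1 (w.1 + w.2)) := by
    unfold df; fun_prop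
  have hSm1 : ∀ x, Measurable (fun z : Eu n => Sf u h x (x + z)) := fun x => by
    unfold Sf; fun_prop
  have hdm1 : ∀ x, Measurable (fun z : Eu n => df u h x (x + z)) := fun x => by
    unfold df; fun_prop
  set a1 := ε ^ (-κ) * (2 * H) ^ m with ha1
  set a2 := ε ^ q * (2 * H) ^ q with ha2
  have ha10 : 0 ≤ a1 := by positivity
  have ha20 : 0 ≤ a2 := by positivity
  set F1 : Eu n → Eu n → ℝ := fun x z => Sf u h x (x + z) ^ (p - 2) * df u h x (x + z) ^ (β + 1) * ‖z‖ ^ (-m) with hF1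
  set F2 : Eu n → Eu n → ℝ := fun x z => (Sf u h x (x + z) / ‖z‖) ^ q + ((|u (x + h) - u x| + |u (x + z + h) - u (x + z)|) / ‖h‖) ^ q with hF2
  have hF10 : ∀ x z, 0 ≤ F1 x z := fun x z => by
    have := hS0 x (x + z); have := hd0 x (x + z); simp only [hF1]; positivity
  have hF20 : ∀ x z, 0 ≤ F2 x z := fun x z => by
    have := hS0 x (x + z); simp only [hF2]; positivity
  have hF1m : Measurable (fun w : Eu n × Eu n => F1 w.1 w.2) := by
    simp only [hF1]; fun_prop
  have hF2m : Measurable (fun w : Eu n × Eu n => F2 w.1 w.2) := by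
    simp only [hF2]; fun_prop
  have pw : ∀ x z : Eu n, z ∈ ball (0 : Eu n) (2 * H) → ENNReal.ofReal (df u h x (x + z) ^ q) ≤
      ENNReal.ofReal a1 * ENNReal.ofReal (F1 x z) + ENNReal.ofReal a2 * ENNReal.ofReal (F2 x z) := by
    intro x z hz
    rw [← ENNReal.ofReal_mul ha10, ← ENNReal.ofReal_mul ha20, ← ENNReal.ofReal_add (mul_nonneg ha10 (hF10 _ _)) (mul_nonneg ha20 (hF20 _ _))]
    refine ENNReal.ofReal_le_ofReal ?_
    by_cases hz0 : z = 0
    · have e : df u h x (x + z) = 0 := by simp [hz0, df]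
      rw [e, Real.zero_rpow (by linarith)]
      exact add_nonneg (mul_nonneg ha10 (hF10 _ _)) (mul_nonneg ha20 (hF20 _ _))
    have hz' : 0 < ‖z‖ := norm_pos_iff.2 hz0
    have hz2 : ‖z‖ ≤ 2 * H := by simpa using (mem_ball_zero_iff.1 hz).le
    have h1 := conv_pointwise hp (by linarith : p ≤ q) hε0 hε1 (hd0 x (x + z)) (hdS x (x + z))
    rw [show q + 2 - p = β + 1 by rw [hq]; ring] at h1
    refine h1.trans (add_le_add ?_ ?_)
    · have e1 : 1 ≤ (2 * H) ^ m * ‖z‖ ^ (-m) := by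
        rw [Real.rpow_neg hz'.le, ← div_eq_mul_inv, ← Real.div_rpow (by positivity) hz'.le]
        exact Real.one_le_rpow ((one_le_div hz').2 hz2) hm0.le
      have e2 : 0 ≤ ε ^ (-κ) * (Sf u h x (x + z) ^ (p - 2) * df u h x (x + z) ^ (β + 1)) := by
        have := hS0 x (x + z); have := hd0 x (x + z); positivity
      calc _ ≤ ε ^ (-κ) * (Sf u h x (x + z) ^ (p - 2) * df u h x (x + z) ^ (β + 1)) * ((2 * H) ^ m * ‖z‖ ^ (-m)) :=
            le_mul_of_one_le_right e2 e1
        _ = _ := by simp only [ha1, hF1]; ring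
    · have := hS0 x (x + z)
      calc ε ^ q * Sf u h x (x + z) ^ q = ε ^ q * (‖z‖ * (Sf u h x (x + z) / ‖z‖)) ^ q := by
            rw [mul_div_cancel₀ _ hz'.ne']
        _ = ε ^ q * (‖z‖ ^ q * (Sf u h x (x + z) / ‖z‖) ^ q) := by
            rw [Real.mul_rpow hz'.le (by positivity)]
        _ ≤ ε ^ q * ((2 * H) ^ q * F2 x z) := by
            have : (Sf u h x (x + z) / ‖z‖) ^ q ≤ F2 x z := by
              simp only [hF2]
              exact le_add_of_nonneg_right (by positivity)
            gcongr
        _ = _ := by simp only [ha2]; ring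
  have hSW : ∀ z : Eu n, ‖z‖ ≤ r → ∫⁻ x in ball (0 : Eu n) (ρ + 2 * r), ENNReal.ofReal (F2 x z) ≤ ENNReal.ofReal (2 ^ q) * (4 * G) := by
    intro z hz
    have hB6 : ball (0 : Eu n) (ρ + 2 * r + 2 * r) ⊆ ball 0 (ρ + 10 * r) := ball_subset_ball (by linarith)
    exact SW_bound hq1 hum hΩ hcd hr (a := ρ + 2 * r) (hB6.trans ((ball_subset_ball hρr).trans (ball_subset_closedBall.trans hB))) ((lintegral_mono_set hB6).trans hg) h z (by linarith) hz
  have I2 : ∫⁻ x in ball (0 : Eu n) (ρ + 2 * r), ∫⁻ z in ball (0 : Eu n) (2 * H), ENNReal.ofReal (F2 x z) ≤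
      volume (ball (0 : Eu n) (2 * H)) * (ENNReal.ofReal (2 ^ q) * (4 * G)) := by
    rw [lintegral_lintegral_swap hF2m.ennreal_ofReal.aemeasurable]
    calc _ ≤ ∫⁻ z in ball (0 : Eu n) (2 * H), (ENNReal.ofReal (2 ^ q) * (4 * G)) := by
          refine setLIntegral_mono' measurableSet_ball fun z hz => hSW z ?_
          have := mem_ball_zero_iff.1 hz
          linarith
      _ = _ := by rw [setLIntegral_const, mul_comm]
  calc _ ≤ ∫⁻ x in ball (0 : Eu n) (ρ + 2 * r), ∫⁻ z in ball (0 : Eu n) (2 * H), (ENNReal.ofReal a1 * ENNReal.ofReal (F1 x z) + ENNReal.ofReal a2 * ENNReal.ofReal (F2 x z)) :=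
        lintegral_mono fun x => setLIntegral_mono' measurableSet_ball fun z hz => pw x z hz
    _ = ENNReal.ofReal a1 * (∫⁻ x in ball (0 : Eu n) (ρ + 2 * r), ∫⁻ z in ball (0 : Eu n) (2 * H), ENNReal.ofReal (F1 x z)) + ENNReal.ofReal a2 * ∫⁻ x in ball (0 : Eu n) (ρ + 2 * r), ∫⁻ z in ball (0 : Eu n) (2 * H), ENNReal.ofReal (F2 x z) := by
        have hm1 : ∀ x, Measurable fun z => ENNReal.ofReal (F1 x z) := fun x => (hF1m.comp measurable_prodMk_left).ennreal_ofReal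
        have hm2 : ∀ x, Measurable fun z => ENNReal.ofReal (F2 x z) := fun x => (hF2m.comp measurable_prodMk_left).ennreal_ofReal
        have hM1 : Measurable fun x => ∫⁻ z in ball (0 : Eu n) (2 * H), ENNReal.ofReal (F1 x z) := hF1m.ennreal_ofReal.lintegral_prod_right'
        rw [← lintegral_const_mul' _ _ ENNReal.ofReal_ne_top, ← lintegral_const_mul' _ _ ENNReal.ofReal_ne_top, ← lintegral_add_left (hM1.const_mul _)]
        refine lintegral_congr fun x => ?_
        rw [lintegral_add_left ((hm1 x).const_mul _), lintegral_const_mul' _ _ ENNReal.ofReal_ne_top, lintegral_const_mul' _ _ ENNReal.ofReal_ne_top]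
    _ ≤ ENNReal.ofReal a1 * (C1 * ENNReal.ofReal (H ^ (q - max (p - 2) 0))) + ENNReal.ofReal a2 * (volume (ball (0 : Eu n) (2 * H)) * (ENNReal.ofReal (2 ^ q) * (4 * G))) := by
        refine add_le_add (mul_le_mul' le_rfl ?_) (mul_le_mul' le_rfl I2)
        refine le_trans ?_ hNE
        exact lintegral_mono fun x => lintegral_mono_set (ball_subset_ball (by linarith))
    _ = ENNReal.ofReal (a1 * H ^ (q - max (p - 2) 0)) * C1 + ENNReal.ofReal (a2 * (2 * H) ^ (n : ℝ)) * (volume (ball (0 : Eu n) 1) * (ENNReal.ofReal (2 ^ q) * (4 * G))) := by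
        rw [vol_ball_eq hn (by positivity : 0 ≤ 2 * H), ENNReal.ofReal_mul ha10, ENNReal.ofReal_mul ha20]
        ring
    _ ≤ ENNReal.ofReal (2 ^ m * H ^ ((n : ℝ) + q + σ)) * C1 + ENNReal.ofReal ((2 ^ q * 2 ^ (n : ℝ)) * H ^ ((n : ℝ) + q + σ)) * (volume (ball (0 : Eu n) 1) * (ENNReal.ofReal (2 ^ q) * (4 * G))) := by
        refine add_le_add (mul_le_mul' (ENNReal.ofReal_le_ofReal ?_) le_rfl) (mul_le_mul' (ENNReal.ofReal_le_ofReal ?_) le_rfl)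
        · simp only [ha1, hε]
          rw [Real.mul_rpow (by norm_num) hh0.le, ← Real.rpow_mul hh0.le]
          calc H ^ (σ * -κ) * (2 ^ m * H ^ m) * H ^ (q - max (p - 2) 0) = 2 ^ m * (H ^ (σ * -κ) * H ^ m * H ^ (q - max (p - 2) 0)) := by ring
            _ = 2 ^ m * H ^ (σ * -κ + m + (q - max (p - 2) 0)) := by
              rw [Real.rpow_add hh0 (σ * -κ + m) (q - max (p - 2) 0), Real.rpow_add hh0 (σ * -κ) m]
            _ ≤ _ := by
              refine mul_le_mul_of_nonneg_left (Real.rpow_le_rpow_of_exponent_ge hh0 hH1 ?_) (by positivity)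
              rw [hm]; nlinarith
        · simp only [ha2, hε]
          rw [Real.mul_rpow (by norm_num) hh0.le, Real.mul_rpow (by norm_num) hh0.le, ← Real.rpow_mul hh0.le]
          calc H ^ (σ * q) * (2 ^ q * H ^ q) * (2 ^ (n : ℝ) * H ^ (n : ℝ)) = (2 ^ q * 2 ^ (n : ℝ)) * (H ^ (σ * q) * H ^ q * H ^ (n : ℝ)) := by ring
            _ = (2 ^ q * 2 ^ (n : ℝ)) * H ^ (σ * q + q + (n : ℝ)) := by rw [Real.rpow_add hh0, Real.rpow_add hh0]
            _ ≤ _ := by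
              refine mul_le_mul_of_nonneg_left (Real.rpow_le_rpow_of_exponent_ge hh0 hH1 ?_) (by positivity)
              nlinarith
    _ = _ := by
        rw [ENNReal.ofReal_mul (by positivity : (0 : ℝ) ≤ 2 ^ m), ENNReal.ofReal_mul (by positivity : (0 : ℝ) ≤ 2 ^ q * 2 ^ (n : ℝ))]
        ring

lemma second_diff {n : ℕ} (hn : 1 ≤ n) {q σ : ℝ} (hq : 1 ≤ q) {ρ r : ℝ} {C : ℝ≥0∞} {u : Eu n → ℝ} (hum : Measurable u)
    (h : Eu n) (hh0 : 0 < ‖h‖) (hh : 4 * ‖h‖ ≤ r)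
    (hC : ∫⁻ x in ball (0 : Eu n) (ρ + 2 * r), ∫⁻ z in ball (0 : Eu n) (2 * ‖h‖),
        ENNReal.ofReal (df u h x (x + z) ^ q) ≤ C * ENNReal.ofReal (‖h‖ ^ ((n : ℝ) + q + σ))) :
    ∫⁻ x in ball (0 : Eu n) (ρ + r), ENNReal.ofReal (|u (x + h + h) - 2 * u (x + h) + u x| ^ q) ≤
      ENNReal.ofReal (2 ^ q) * 2 * (volume (ball (0 : Eu n) 1))⁻¹ * C * ENNReal.ofReal (‖h‖ ^ (q + σ)) := by
  set V := volume (ball (0 : Eu n) 1) with hV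
  have hV0 : V ≠ 0 := (measure_ball_pos _ _ (by norm_num)).ne'
  have hVt : V ≠ ⊤ := measure_ball_lt_top.ne
  set H := ‖h‖ with hHd
  set D : Eu n → ℝ≥0∞ := fun x => ENNReal.ofReal (|u (x + h + h) - 2 * u (x + h) + u x| ^ q) with hD
  have hd0 : ∀ x y, 0 ≤ df u h x y := fun x y => by unfold df; positivity
  have hdm2 : Measurable (fun w : Eu n × Eu n => df u h w.1 w.2) := by
    unfold df; fun_prop
  have pw : ∀ x z, D x ≤ ENNReal.ofReal (2 ^ q) * (ENNReal.ofReal (df u h x (x + z) ^ q) + ENNReal.ofReal (df u h (x + h) (x + z) ^ q)) := by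
    intro x z
    have h1 := hd0 x (x + z)
    have h2 := hd0 (x + h) (x + z)
    rw [← ENNReal.ofReal_add (by positivity) (by positivity), ← ENNReal.ofReal_mul (by positivity)]
    refine ENNReal.ofReal_le_ofReal (le_trans ?_ (real_add_rpow_le (by linarith) h1 h2))
    refine Real.rpow_le_rpow (abs_nonneg _) ?_ (by linarith)
    unfold df
    have : u (x + h + h) - 2 * u (x + h) + u x = (u (x + h + h) - u (x + h) - (u (x + z + h) - u (x + z))) - (u (x + h) - u x - (u (x + z + h) - u (x + z))) := by ring
    rw [this]
    have := abs_sub (u (x + h + h) - u (x + h) - (u (x + z + h) - u (x + z))) (u (x + h) - u x - (u (x + z + h) - u (x + z)))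
    linarith
  have mem : ∀ x ∈ ball (0 : Eu n) (ρ + r), x + h ∈ ball (0 : Eu n) (ρ + 2 * r) := by
    intro x hx
    simp only [mem_ball_zero_iff] at hx ⊢
    have := norm_add_le x h
    linarith
  have J1 : ∫⁻ x in ball (0 : Eu n) (ρ + r), ∫⁻ z in ball (0 : Eu n) H, ENNReal.ofReal (df u h x (x + z) ^ q) ≤
      C * ENNReal.ofReal (H ^ ((n : ℝ) + q + σ)) := by
    refine le_trans ?_ hC
    refine (lintegral_mono_set (ball_subset_ball (by linarith))).trans (lintegral_mono fun x => lintegral_mono_set (ball_subset_ball (by linarith)))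
  have J2 : ∫⁻ x in ball (0 : Eu n) (ρ + r), ∫⁻ z in ball (0 : Eu n) H, ENNReal.ofReal (df u h (x + h) (x + z) ^ q) ≤
      C * ENNReal.ofReal (H ^ ((n : ℝ) + q + σ)) := by
    refine le_trans ?_ hC
    refine le_trans ?_ (lint_translate_le measurableSet_ball measurableSet_ball h mem
      (fun x => ∫⁻ z in ball (0 : Eu n) (2 * H), ENNReal.ofReal (df u h x (x + z) ^ q)))
    refine lintegral_mono fun x => ?_
    have := lint_translate_le (A := ball (0 : Eu n) H) (B := ball (0 : Eu n) (2 * H)) measurableSet_ball measurableSet_ball (-h) (by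
      intro z hz
      simp only [mem_ball_zero_iff] at hz ⊢
      have := norm_add_le z (-h)
      rw [norm_neg] at this
      linarith) (fun z => ENNReal.ofReal (df u h (x + h) (x + h + z) ^ q))
    refine le_trans (le_of_eq ?_) this
    refine lintegral_congr fun z => ?_
    rw [show x + h + (z + -h) = x + z by abel]
  have main : volume (ball (0 : Eu n) H) * ∫⁻ x in ball (0 : Eu n) (ρ + r), D x ≤
      ENNReal.ofReal (2 ^ q) * (C * ENNReal.ofReal (H ^ ((n : ℝ) + q + σ)) + C * ENNReal.ofReal (H ^ ((n : ℝ) + q + σ))) := by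
    have hDm : Measurable D := by simp only [hD]; fun_prop
    rw [← lintegral_const_mul _ hDm]
    calc _ ≤ ∫⁻ x in ball (0 : Eu n) (ρ + r), ENNReal.ofReal (2 ^ q) * ((∫⁻ z in ball (0 : Eu n) H, ENNReal.ofReal (df u h x (x + z) ^ q)) + ∫⁻ z in ball (0 : Eu n) H, ENNReal.ofReal (df u h (x + h) (x + z) ^ q)) := by
          refine lintegral_mono fun x => ?_
          simp only
          have m1 : Measurable fun z => ENNReal.ofReal (df u h x (x + z) ^ q) := by
            have : Measurable fun z => df u h x (x + z) := by unfold df; fun_prop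
            fun_prop
          rw [← lintegral_add_left m1, ← lintegral_const_mul' _ _ ENNReal.ofReal_ne_top, mul_comm, ← setLIntegral_const]
          exact lintegral_mono fun z => pw x z
      _ ≤ _ := by
          rw [lintegral_const_mul' _ _ ENNReal.ofReal_ne_top]
          refine mul_le_mul' le_rfl ?_
          rw [lintegral_add_left]
          · exact add_le_add J1 J2
          · have : Measurable (fun w : Eu n × Eu n => ENNReal.ofReal (df u h w.1 (w.1 + w.2) ^ q)) := by
              unfold df; fun_prop
            exact this.lintegral_prod_right'
  rw [vol_ball_eq hn hh0.le, show (n : ℝ) + q + σ = n + (q + σ) by ring, Real.rpow_add hh0, ENNReal.ofReal_mul (by positivity)] at main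
  set a := ENNReal.ofReal (H ^ (n : ℝ)) with ha
  have ha0 : a ≠ 0 := by rw [ha]; simp; positivity
  have hat : a ≠ ⊤ := ENNReal.ofReal_ne_top
  have haV0 : a * V ≠ 0 := mul_ne_zero ha0 hV0
  have haVt : a * V ≠ ⊤ := ENNReal.mul_ne_top hat hVt
  rw [mul_comm, ← ENNReal.le_div_iff_mul_le (Or.inl haV0) (Or.inl haVt)] at main
  refine main.trans (le_of_eq ?_)
  rw [div_eq_mul_inv, ENNReal.mul_inv (Or.inl ha0) (Or.inl hat)]
  calc _ = (a * a⁻¹) * (ENNReal.ofReal (2 ^ q) * 2 * V⁻¹ * C * ENNReal.ofReal (H ^ (q + σ))) := by ring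
    _ = _ := by rw [ENNReal.mul_inv_cancel ha0 hat, one_mul]

lemma tsum_rpow_le {q : ℝ} (hq : 0 < q) {θ : ℝ≥0∞} (h0 : θ ≠ 0) (ht : θ ≠ ⊤) (b : ℕ → ℝ≥0∞) :
    (∑' k, b k) ^ q ≤ ((1 - θ)⁻¹) ^ q * ∑' j, (θ⁻¹ ^ j * b j) ^ q := by
  set S := (∑' j, (θ⁻¹ ^ j * b j) ^ q) ^ (1 / q) with hS
  have hSq : S ^ q = ∑' j, (θ⁻¹ ^ j * b j) ^ q := by
    rw [hS, ← ENNReal.rpow_mul, one_div, inv_mul_cancel₀ hq.ne', ENNReal.rpow_one]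
  have hb : ∀ k, b k ≤ θ ^ k * S := by
    intro k
    have h1 : (θ⁻¹ ^ k * b k) ≤ S := by
      rw [hS, one_div, ENNReal.le_rpow_inv_iff hq]
      exact ENNReal.le_tsum (f := fun j => (θ⁻¹ ^ j * b j) ^ q) k
    calc b k = θ ^ k * (θ⁻¹ ^ k * b k) := by
          rw [← mul_assoc, ← mul_pow, ENNReal.mul_inv_cancel h0 ht, one_pow, one_mul]
      _ ≤ _ := mul_le_mul' le_rfl h1
  calc (∑' k, b k) ^ q ≤ (∑' k, θ ^ k * S) ^ q := ENNReal.rpow_le_rpow (ENNReal.tsum_le_tsum hb) hq.le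
    _ = _ := by rw [ENNReal.tsum_mul_right, ENNReal.tsum_geometric, ENNReal.mul_rpow_of_nonneg _ _ hq.le, hSq]

lemma dq_tsum {n : ℕ} {u : Eu n → ℝ} {x : Eu n} (hd : DifferentiableAt ℝ u x) (h : Eu n) :
    ENNReal.ofReal |fderiv ℝ u x h - (u (x + h) - u x)| ≤
      ∑' k : ℕ, ENNReal.ofReal (2 ^ k * |u (x + ((2 : ℝ) ^ (k + 1))⁻¹ • h + ((2 : ℝ) ^ (k + 1))⁻¹ • h) -
        2 * u (x + ((2 : ℝ) ^ (k + 1))⁻¹ • h) + u x|) := by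
  set f : ℕ → ℝ := fun k => (2 : ℝ) ^ k • (u (x + ((2 : ℝ) ^ k)⁻¹ • h) - u x) with hf
  have hlim : Filter.Tendsto f Filter.atTop (nhds (fderiv ℝ u x h)) := by
    refine hd.hasFDerivAt.lim h (c := fun k : ℕ => (2 : ℝ) ^ k) ?_
    simp only [norm_pow, Real.norm_ofNat]
    exact tendsto_pow_atTop_atTop_of_one_lt (by norm_num)
  have := edist_le_tsum_of_edist_le_of_tendsto₀ (f := f) (a := fderiv ℝ u x h)
    (fun k : ℕ => ENNReal.ofReal (2 ^ k * |u (x + ((2 : ℝ) ^ (k + 1))⁻¹ • h + ((2 : ℝ) ^ (k + 1))⁻¹ • h) -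
        2 * u (x + ((2 : ℝ) ^ (k + 1))⁻¹ • h) + u x|)) (by
      intro k
      rw [edist_dist, Real.dist_eq]
      refine ENNReal.ofReal_le_ofReal (le_of_eq ?_)
      have e : x + ((2 : ℝ) ^ (k + 1))⁻¹ • h + ((2 : ℝ) ^ (k + 1))⁻¹ • h = x + ((2 : ℝ) ^ k)⁻¹ • h := by
        rw [add_assoc, ← add_smul]
        congr 2
        rw [pow_succ]; field_simp; norm_num
      rw [e]
      simp only [hf, smul_eq_mul, Nat.succ_eq_add_one]
      rw [← abs_of_pos (by positivity : (0 : ℝ) < 2 ^ k), ← abs_mul, abs_of_pos (by positivity : (0 : ℝ) < 2 ^ k), pow_succ]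
      congr 1; ring) hlim
  rw [edist_comm, edist_dist, Real.dist_eq] at this
  simpa [hf] using this

lemma deriv_diff {n : ℕ} {q σ ρ r : ℝ} (hq : 1 ≤ q) (hσ : 0 < σ) {C : ℝ≥0∞} {u : Eu n → ℝ} (hum : Measurable u)
    (hdif : ∀ x ∈ ball (0 : Eu n) (ρ + r), DifferentiableAt ℝ u x)
    (hSD : ∀ h : Eu n, 0 < ‖h‖ → 4 * ‖h‖ ≤ r → ∫⁻ x in ball (0 : Eu n) (ρ + r),
      ENNReal.ofReal (|u (x + h + h) - 2 * u (x + h) + u x| ^ q) ≤ C * ENNReal.ofReal (‖h‖ ^ (q + σ)))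
    (h : Eu n) (hh0 : 0 < ‖h‖) (hh : 4 * ‖h‖ ≤ r) :
    ∫⁻ x in ball (0 : Eu n) (ρ + r), ENNReal.ofReal (|fderiv ℝ u x h - (u (x + h) - u x)| ^ q) ≤
      ((1 - ENNReal.ofReal (2 ^ (-(σ / (2 * q)))))⁻¹) ^ q * (1 - ENNReal.ofReal (2 ^ (-(σ / 2))))⁻¹ * C
        * ENNReal.ofReal (‖h‖ ^ (q + σ)) := by
  have hq0 : 0 < q := by linarith
  set θ := ENNReal.ofReal (2 ^ (-(σ / (2 * q)))) with hθ
  have hθ0 : θ ≠ 0 := by rw [hθ]; simp; positivity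
  have hθt : θ ≠ ⊤ := ENNReal.ofReal_ne_top
  have hθi : ∀ k : ℕ, θ⁻¹ ^ k = ENNReal.ofReal ((2 : ℝ) ^ ((k : ℝ) * (σ / (2 * q)))) := by
    intro k
    rw [hθ, ← ENNReal.ofReal_inv_of_pos (by positivity), ← ENNReal.ofReal_pow (by positivity), ← Real.rpow_neg (by norm_num), neg_neg,
      ← Real.rpow_natCast, ← Real.rpow_mul (by norm_num), mul_comm]
  set v : ℕ → Eu n := fun k => ((2 : ℝ) ^ (k + 1))⁻¹ • h with hv
  have hvn : ∀ k, ‖v k‖ = (2 : ℝ) ^ (-((k : ℝ) + 1)) * ‖h‖ := by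
    intro k
    rw [hv]; simp only [norm_smul, norm_inv, norm_pow, Real.norm_ofNat]
    rw [Real.rpow_neg (by norm_num), ← Nat.cast_succ, Real.rpow_natCast]
  have hvle : ∀ k, ‖v k‖ ≤ ‖h‖ := by
    intro k
    rw [hvn]
    refine mul_le_of_le_one_left hh0.le (Real.rpow_le_one_of_one_le_of_nonpos (by norm_num) ?_)
    have : (0 : ℝ) ≤ k := Nat.cast_nonneg k
    linarith
  set b : ℕ → Eu n → ℝ := fun k x => 2 ^ k * |u (x + v k + v k) - 2 * u (x + v k) + u x| with hb
  have hb0 : ∀ k x, 0 ≤ b k x := fun k x => by simp only [hb]; positivity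
  have hbm : ∀ k, Measurable (b k) := fun k => by simp only [hb]; fun_prop
  have est : ∀ k, ∫⁻ x in ball (0 : Eu n) (ρ + r), (θ⁻¹ ^ k * ENNReal.ofReal (b k x)) ^ q ≤
      (C * ENNReal.ofReal (‖h‖ ^ (q + σ))) * ENNReal.ofReal (2 ^ (-(σ / 2))) ^ k := by
    intro k
    have hvp : 0 < ‖v k‖ := by rw [hvn]; positivity
    have h1 := hSD (v k) hvp (by linarith [hvle k])
    have e : ∀ x, (θ⁻¹ ^ k * ENNReal.ofReal (b k x)) ^ q = ENNReal.ofReal ((2 : ℝ) ^ ((k : ℝ) * (σ / 2) + k * q)) *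
        ENNReal.ofReal (|u (x + v k + v k) - 2 * u (x + v k) + u x| ^ q) := by
      intro x
      rw [hθi, ← ENNReal.ofReal_mul (by positivity), ENNReal.ofReal_rpow_of_nonneg (mul_nonneg (by positivity) (hb0 _ _)) hq0.le,
        ← ENNReal.ofReal_mul (by positivity)]
      congr 1
      simp only [hb]
      rw [Real.mul_rpow (by positivity) (by positivity), Real.mul_rpow (by positivity) (by positivity), ← mul_assoc]
      congr 1
      rw [← Real.rpow_natCast, ← Real.rpow_mul (by norm_num), ← Real.rpow_mul (by norm_num), ← Real.rpow_add (by norm_num)]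
      congr 1; field_simp
    simp only [e]
    rw [lintegral_const_mul' _ _ ENNReal.ofReal_ne_top]
    calc _ ≤ ENNReal.ofReal ((2 : ℝ) ^ ((k : ℝ) * (σ / 2) + k * q)) * (C * ENNReal.ofReal (‖v k‖ ^ (q + σ))) := mul_le_mul' le_rfl h1
      _ = C * ENNReal.ofReal ((2 : ℝ) ^ ((k : ℝ) * (σ / 2) + k * q) * ‖v k‖ ^ (q + σ)) := by
          rw [ENNReal.ofReal_mul (by positivity)]; ring
      _ ≤ C * ENNReal.ofReal (‖h‖ ^ (q + σ) * (2 ^ (-(σ / 2))) ^ k) := by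
          refine mul_le_mul' le_rfl (ENNReal.ofReal_le_ofReal ?_)
          rw [hvn, Real.mul_rpow (by positivity) hh0.le, ← mul_assoc, mul_comm, ← Real.rpow_mul (by norm_num), ← Real.rpow_add (by norm_num),
            ← Real.rpow_natCast, ← Real.rpow_mul (by norm_num)]
          refine mul_le_mul_of_nonneg_left (Real.rpow_le_rpow_of_exponent_le (by norm_num) ?_) (by positivity)
          have : (0 : ℝ) ≤ k := Nat.cast_nonneg k
          nlinarith
      _ = _ := by rw [ENNReal.ofReal_mul (by positivity), ENNReal.ofReal_pow (by positivity), mul_assoc]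
  calc _ ≤ ∫⁻ x in ball (0 : Eu n) (ρ + r), ((1 - θ)⁻¹) ^ q * ∑' k, (θ⁻¹ ^ k * ENNReal.ofReal (b k x)) ^ q := by
        refine setLIntegral_mono' measurableSet_ball fun x hx => ?_
        refine le_trans ?_ (tsum_rpow_le hq0 hθ0 hθt _)
        rw [← ENNReal.ofReal_rpow_of_nonneg (abs_nonneg _) hq0.le]
        exact ENNReal.rpow_le_rpow (dq_tsum (hdif x hx) h) hq0.le
    _ = ((1 - θ)⁻¹) ^ q * ∑' k, ∫⁻ x in ball (0 : Eu n) (ρ + r), (θ⁻¹ ^ k * ENNReal.ofReal (b k x)) ^ q := by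
        have hm : ∀ k, Measurable fun x => (θ⁻¹ ^ k * ENNReal.ofReal (b k x)) ^ q := fun k => by
          have := hbm k
          fun_prop
        rw [lintegral_const_mul _ (Measurable.tsum hm), lintegral_tsum fun k => (hm k).aemeasurable]
    _ ≤ ((1 - θ)⁻¹) ^ q * ∑' k : ℕ, (C * ENNReal.ofReal (‖h‖ ^ (q + σ))) * ENNReal.ofReal (2 ^ (-(σ / 2))) ^ k :=
        mul_le_mul' le_rfl (ENNReal.tsum_le_tsum est)
    _ = _ := by rw [ENNReal.tsum_mul_left, ENNReal.tsum_geometric]; ring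

lemma gain_lemma {α : Type*} [MeasurableSpace α] {ν : Measure α} {F : α → ℝ≥0∞} {Gk : ℕ → α → ℝ≥0∞}
    (hF : ∀ x, F x ≠ ⊤) (hGm : ∀ k, Measurable (Gk k)) {A B lam mu : ℝ≥0∞} {κ : ℝ} (hκ : 0 < κ)
    (hA0 : A ≠ 0) (hAt : A ≠ ⊤) (hlam : 2 ≤ lam)
    (h1 : ∀ k, ∀ᵐ x ∂ν, F x ≤ Gk k x + A * lam ^ k) (h2 : ∀ k, ∫⁻ x, Gk k x ∂ν ≤ B * mu ^ k) :
    ∫⁻ x, F x ^ (1 + κ) ∂ν ≤ (2 * A) ^ (1 + κ) * ν univ + (2 * A * lam) ^ κ * 2 * B * (1 - lam ^ κ * mu)⁻¹ := by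
  have pw : ∀ᵐ x ∂ν, F x ^ (1 + κ) ≤ (2 * A) ^ (1 + κ) + ∑' k, (2 * A * lam ^ (k + 1)) ^ κ * (2 * Gk k x) := by
    have h1' := ae_all_iff.2 h1
    filter_upwards [h1'] with x hx
    have hex : ∃ k : ℕ, F x ≤ 2 * A * lam ^ k := by
      obtain ⟨k, hk⟩ := ENNReal.exists_nat_gt (ENNReal.div_ne_top (hF x) (mul_ne_zero two_ne_zero hA0))
      refine ⟨k, ?_⟩
      have h3 : F x ≤ k * (2 * A) := (ENNReal.div_le_iff (mul_ne_zero two_ne_zero hA0) (ENNReal.mul_ne_top (by simp) hAt)).1 hk.le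
      refine h3.trans ?_
      rw [mul_comm]
      refine mul_le_mul' le_rfl ?_
      calc (k : ℝ≥0∞) ≤ ((2 ^ k : ℕ) : ℝ≥0∞) := by exact_mod_cast Nat.lt_two_pow_self.le
        _ = 2 ^ k := by push_cast; rfl
        _ ≤ _ := by gcongr
    classical
    have hsp := Nat.find_spec hex
    rcases hk : Nat.find hex with _ | k
    · rw [hk, pow_zero, mul_one] at hsp
      exact (ENNReal.rpow_le_rpow hsp (by linarith)).trans le_self_add
    · rw [hk] at hsp
      have hnk : ¬ F x ≤ 2 * A * lam ^ k := Nat.find_min hex (by omega)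
      push Not at hnk
      have hFG : F x ≤ 2 * Gk k x := by
        by_contra hcon
        push Not at hcon
        have h4 : 2 * F x ≤ 2 * Gk k x + 2 * A * lam ^ k := by
          calc 2 * F x ≤ 2 * (Gk k x + A * lam ^ k) := mul_le_mul' le_rfl (hx k)
            _ = _ := by ring
        have := h4.trans_lt (ENNReal.add_lt_add hcon hnk)
        rw [two_mul] at this
        exact lt_irrefl _ this
      calc F x ^ (1 + κ) = F x ^ κ * F x := by
            rw [add_comm, ENNReal.rpow_add_of_nonneg _ _ hκ.le zero_le_one, ENNReal.rpow_one]
        _ ≤ (2 * A * lam ^ (k + 1)) ^ κ * (2 * Gk k x) := mul_le_mul' (ENNReal.rpow_le_rpow hsp hκ.le) hFG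
        _ ≤ ∑' k, (2 * A * lam ^ (k + 1)) ^ κ * (2 * Gk k x) := ENNReal.le_tsum (f := fun k => (2 * A * lam ^ (k + 1)) ^ κ * (2 * Gk k x)) k
        _ ≤ _ := le_add_self
  calc _ ≤ ∫⁻ x, ((2 * A) ^ (1 + κ) + ∑' k, (2 * A * lam ^ (k + 1)) ^ κ * (2 * Gk k x)) ∂ν := lintegral_mono_ae pw
    _ = (2 * A) ^ (1 + κ) * ν univ + ∑' k, (2 * A * lam ^ (k + 1)) ^ κ * (2 * ∫⁻ x, Gk k x ∂ν) := by
        rw [lintegral_add_left measurable_const, lintegral_const, lintegral_tsum fun k => (((hGm k).const_mul _).const_mul _).aemeasurable]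
        congr 2
        ext k
        rw [lintegral_const_mul _ ((hGm k).const_mul _), lintegral_const_mul _ (hGm k)]
    _ ≤ (2 * A) ^ (1 + κ) * ν univ + ∑' k : ℕ, (2 * A * lam) ^ κ * 2 * B * (lam ^ κ * mu) ^ k := by
        refine add_le_add le_rfl (ENNReal.tsum_le_tsum fun k => ?_)
        calc (2 * A * lam ^ (k + 1)) ^ κ * (2 * ∫⁻ x, Gk k x ∂ν) ≤ (2 * A * lam ^ (k + 1)) ^ κ * (2 * (B * mu ^ k)) :=
              mul_le_mul' le_rfl (mul_le_mul' le_rfl (h2 k))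
          _ = _ := by
              rw [pow_succ, show 2 * A * (lam ^ k * lam) = (2 * A * lam) * lam ^ k by ring, ENNReal.mul_rpow_of_nonneg _ _ hκ.le, mul_pow,
                ← ENNReal.rpow_natCast lam, ← ENNReal.rpow_natCast (lam ^ κ), ← ENNReal.rpow_mul, ← ENNReal.rpow_mul, mul_comm κ]
              ring
    _ = _ := by rw [ENNReal.tsum_mul_left, ENNReal.tsum_geometric]

lemma one_scale {n : ℕ} (hn : 1 ≤ n) {q σ ρ r : ℝ} (hq : 1 ≤ q) (hr : 0 < r)
    {C CD G : ℝ≥0∞} {u : Eu n → ℝ} (hum : Measurable u) {Ω : Set (Eu n)} (hΩ : IsOpen Ω) (hu : ContDiffOn ℝ 1 u Ω)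
    (hB : ball 0 (ρ + 10 * r) ⊆ Ω)
    (hG : ∫⁻ x in ball (0 : Eu n) (ρ + 10 * r), ENNReal.ofReal (‖fderiv ℝ u x‖ ^ q) ≤ G)
    (e : Eu n) (he : ‖e‖ = 1) (H : ℝ) (hH0 : 0 < H) (hH : 4 * H ≤ r)
    (hC : ∫⁻ x in ball (0 : Eu n) (ρ + 2 * r), ∫⁻ z in ball (0 : Eu n) (2 * H),
        ENNReal.ofReal (df u (H • e) x (x + z) ^ q) ≤ C * ENNReal.ofReal (H ^ ((n : ℝ) + q + σ)))
    (hD : ∫⁻ x in ball (0 : Eu n) (ρ + r), ENNReal.ofReal (|fderiv ℝ u x (H • e) - (u (x + H • e) - u x)| ^ q) ≤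
      CD * ENNReal.ofReal (H ^ (q + σ))) :
    ∃ Gf : Eu n → ℝ≥0∞, Measurable Gf ∧
      (∀ x ∈ ball (0 : Eu n) ρ, ENNReal.ofReal (|fderiv ℝ u x e| ^ q) ≤ Gf x +
        ENNReal.ofReal (2 ^ q) * ENNReal.ofReal (2 ^ q) * (volume (ball (0 : Eu n) 1))⁻¹ * G * (ENNReal.ofReal (H ^ (n : ℝ)))⁻¹) ∧
      ∫⁻ x in ball (0 : Eu n) ρ, Gf x ≤
        ENNReal.ofReal (2 ^ q) * (CD + ENNReal.ofReal (2 ^ q) * (volume (ball (0 : Eu n) 1))⁻¹ * C) * ENNReal.ofReal (H ^ σ) := by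
  set V := volume (ball (0 : Eu n) 1) with hV
  have hV0 : V ≠ 0 := (measure_ball_pos _ _ (by norm_num)).ne'
  have hVt : V ≠ ⊤ := measure_ball_lt_top.ne
  set h := H • e with hh
  have hhn : ‖h‖ = H := by rw [hh, norm_smul, he, mul_one, Real.norm_of_nonneg hH0.le]
  set a := ENNReal.ofReal (H ^ q) with ha
  have ha0 : a ≠ 0 := by rw [ha]; simp; positivity
  have hat : a ≠ ⊤ := ENNReal.ofReal_ne_top
  set b := ENNReal.ofReal (H ^ (n : ℝ)) with hb
  have hb0 : b ≠ 0 := by rw [hb]; simp; positivity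
  have hbt : b ≠ ⊤ := ENNReal.ofReal_ne_top
  set t := ENNReal.ofReal (2 ^ q) with ht
  have htt : t ≠ ⊤ := ENNReal.ofReal_ne_top
  have hvB : volume (ball (0 : Eu n) H) = b * V := vol_ball_eq hn hH0.le
  have hbV0 : b * V ≠ 0 := mul_ne_zero hb0 hV0
  have hbVt : b * V ≠ ⊤ := ENNReal.mul_ne_top hbt hVt
  set τ : Eu n → ℝ := fun x => u (x + h) - u x with hτ
  have hτm : Measurable τ := by simp only [hτ]; fun_prop
  set Dx : Eu n → ℝ≥0∞ := fun x => ENNReal.ofReal (|fderiv ℝ u x h - (u (x + h) - u x)| ^ q) with hDx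
  have hDm : Measurable Dx := by
    have := measurable_fderiv_apply_const ℝ u h
    simp only [hDx]; fun_prop
  set Zx : Eu n → ℝ≥0∞ := fun x => ∫⁻ z in ball (0 : Eu n) H, ENNReal.ofReal (df u h x (x + z) ^ q) with hZx
  have hZm : Measurable Zx := by
    have : Measurable (fun w : Eu n × Eu n => ENNReal.ofReal (df u h w.1 (w.1 + w.2) ^ q)) := by
      unfold df; fun_prop
    exact this.lintegral_prod_right'
  have hd0 : ∀ x y, 0 ≤ df u h x y := fun x y => by unfold df; positivity
  have hτG : ∫⁻ x in ball (0 : Eu n) (ρ + r), ENNReal.ofReal (|τ x| ^ q) ≤ a * G := by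
    have := diff_lint hq hΩ hu hB (measurableSet_ball (x := (0 : Eu n)) (ε := ρ + r)) measurableSet_ball h (by
      intro x hx t ht
      simp only [mem_ball_zero_iff] at hx ⊢
      have h1 := norm_add_le x (t • h)
      rw [norm_smul, Real.norm_of_nonneg ht.1, hhn] at h1
      nlinarith [ht.2, ht.1])
    refine this.trans ?_
    rw [hhn]
    exact mul_le_mul' le_rfl hG
  refine ⟨fun x => t * a⁻¹ * (Dx x + t * (b * V)⁻¹ * Zx x), by fun_prop, ?_, ?_⟩
  · intro x hx
    have hx' := mem_ball_zero_iff.1 hx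
    have s1 : ∀ α β : ℝ, ENNReal.ofReal (|α + β| ^ q) ≤ t * (ENNReal.ofReal (|α| ^ q) + ENNReal.ofReal (|β| ^ q)) := by
      intro α β
      rw [← ENNReal.ofReal_add (by positivity) (by positivity), ← ENNReal.ofReal_mul (by positivity)]
      refine ENNReal.ofReal_le_ofReal (le_trans ?_ (real_add_rpow_le (by linarith) (abs_nonneg _) (abs_nonneg _)))
      exact Real.rpow_le_rpow (abs_nonneg _) (abs_add_le _ _) (by linarith)
    have e1 : a * ENNReal.ofReal (|fderiv ℝ u x e| ^ q) ≤ t * (Dx x + ENNReal.ofReal (|τ x| ^ q)) := by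
      have := s1 (fderiv ℝ u x h - (u (x + h) - u x)) (τ x)
      refine le_trans (le_of_eq ?_) this
      rw [ha, ← ENNReal.ofReal_mul (by positivity), ← Real.mul_rpow hH0.le (abs_nonneg _)]
      congr 2
      simp only [hτ]
      rw [sub_add_cancel, hh, map_smul, smul_eq_mul, abs_mul, abs_of_pos hH0]
    have e2 : b * V * ENNReal.ofReal (|τ x| ^ q) ≤ t * (Zx x + a * G) := by
      rw [← hvB, mul_comm, ← setLIntegral_const]
      calc _ ≤ ∫⁻ z in ball (0 : Eu n) H, t * (ENNReal.ofReal (df u h x (x + z) ^ q) + ENNReal.ofReal (|τ (z + x)| ^ q)) := by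
            refine lintegral_mono fun z => ?_
            have := s1 (u (x + h) - u x - (u (x + z + h) - u (x + z))) (τ (z + x))
            simp only [hτ, df] at this ⊢
            rw [add_comm z x, sub_add_cancel] at this
            rwa [add_comm z x]
        _ = t * (Zx x + ∫⁻ z in ball (0 : Eu n) H, ENNReal.ofReal (|τ (z + x)| ^ q)) := by
            rw [lintegral_const_mul' _ _ htt, lintegral_add_left]
            unfold df; fun_prop
        _ ≤ _ := by
            refine mul_le_mul' le_rfl (add_le_add le_rfl (le_trans ?_ hτG))
            refine lint_translate_le measurableSet_ball measurableSet_ball x ?_ (fun y => ENNReal.ofReal (|τ y| ^ q))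
            intro z hz
            simp only [mem_ball_zero_iff] at hz ⊢
            have := norm_add_le z x
            linarith
    have e2' : ENNReal.ofReal (|τ x| ^ q) ≤ (b * V)⁻¹ * (t * (Zx x + a * G)) := by
      rw [mul_comm, ← div_eq_mul_inv, ENNReal.le_div_iff_mul_le (Or.inl hbV0) (Or.inl hbVt), mul_comm]
      exact e2
    have e1' : ENNReal.ofReal (|fderiv ℝ u x e| ^ q) ≤ a⁻¹ * (t * (Dx x + ENNReal.ofReal (|τ x| ^ q))) := by
      rw [mul_comm a⁻¹, ← div_eq_mul_inv, ENNReal.le_div_iff_mul_le (Or.inl ha0) (Or.inl hat), mul_comm]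
      exact e1
    calc _ ≤ a⁻¹ * (t * (Dx x + (b * V)⁻¹ * (t * (Zx x + a * G)))) :=
          e1'.trans (mul_le_mul' le_rfl (mul_le_mul' le_rfl (add_le_add le_rfl e2')))
      _ = t * a⁻¹ * (Dx x + t * (b * V)⁻¹ * Zx x) + (a * a⁻¹) * (t * t * (b * V)⁻¹ * G) := by ring
      _ = _ := by
        rw [ENNReal.mul_inv_cancel ha0 hat, ENNReal.mul_inv (Or.inl hb0) (Or.inl hbt)]; ring
  · have hD' : ∫⁻ x in ball (0 : Eu n) ρ, Dx x ≤ CD * ENNReal.ofReal (H ^ (q + σ)) :=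
      (lintegral_mono_set (ball_subset_ball (by linarith))).trans hD
    have hZ' : ∫⁻ x in ball (0 : Eu n) ρ, Zx x ≤ C * ENNReal.ofReal (H ^ ((n : ℝ) + q + σ)) := by
      refine le_trans ?_ hC
      refine (lintegral_mono_set (ball_subset_ball (by linarith))).trans (lintegral_mono fun x => lintegral_mono_set (ball_subset_ball (by linarith)))
    rw [lintegral_const_mul _ (by fun_prop), lintegral_add_left hDm, lintegral_const_mul _ hZm]
    rw [Real.rpow_add hH0, ENNReal.ofReal_mul (by positivity)] at hD'
    rw [Real.rpow_add hH0, Real.rpow_add hH0, ENNReal.ofReal_mul (by positivity), ENNReal.ofReal_mul (by positivity)] at hZ'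
    rw [← ha] at hD'
    rw [← ha, ← hb] at hZ'
    set w := ENNReal.ofReal (H ^ σ) with hw
    calc _ ≤ t * a⁻¹ * (CD * (a * w) + t * (b * V)⁻¹ * (C * (b * a * w))) :=
          mul_le_mul' le_rfl (add_le_add hD' (mul_le_mul' le_rfl hZ'))
      _ = (a * a⁻¹) * (t * (CD + (b * b⁻¹) * (t * V⁻¹ * C)) * w) := by
          rw [ENNReal.mul_inv (Or.inl hb0) (Or.inl hbt)]; ring
      _ = _ := by rw [ENNReal.mul_inv_cancel ha0 hat, ENNReal.mul_inv_cancel hb0 hbt]; ring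

lemma dir_gain {n : ℕ} (hn : 1 ≤ n) {q σ ρ r κ : ℝ} (hq : 1 ≤ q) (hσ : 0 < σ) (hr : 0 < r) (hκ : 0 < κ)
    (hκσ : n * κ < σ) {C G : ℝ≥0∞} (hCt : C ≠ ⊤) (hGt : G ≠ ⊤) :
    ∃ C' : ℝ≥0∞, C' ≠ ⊤ ∧ ∀ u : Eu n → ℝ, Measurable u → ∀ Ω : Set (Eu n), IsOpen Ω → ContDiffOn ℝ 1 u Ω →
      ball 0 (ρ + 10 * r) ⊆ Ω →
      ∫⁻ x in ball (0 : Eu n) (ρ + 10 * r), ENNReal.ofReal (‖fderiv ℝ u x‖ ^ q) ≤ G →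
      (∀ h : Eu n, 0 < ‖h‖ → 4 * ‖h‖ ≤ r →
        ∫⁻ x in ball (0 : Eu n) (ρ + 2 * r), ∫⁻ z in ball (0 : Eu n) (2 * ‖h‖),
        ENNReal.ofReal (df u h x (x + z) ^ q) ≤ C * ENNReal.ofReal (‖h‖ ^ ((n : ℝ) + q + σ))) →
      ∀ e : Eu n, ‖e‖ = 1 → ∫⁻ x in ball (0 : Eu n) ρ, ENNReal.ofReal (|fderiv ℝ u x e| ^ (q * (1 + κ))) ≤ C' := by
  set V := volume (ball (0 : Eu n) 1) with hV
  have hV0 : V ≠ 0 := (measure_ball_pos _ _ (by norm_num)).ne'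
  have hVi : V⁻¹ ≠ ⊤ := ENNReal.inv_ne_top.2 hV0
  have lt1 : ∀ x : ℝ, x < 0 → (1 - ENNReal.ofReal (2 ^ x))⁻¹ ≠ ⊤ := by
    intro x hx
    rw [ENNReal.inv_ne_top]
    refine (tsub_pos_of_lt ?_).ne'
    rw [← ENNReal.ofReal_one]
    exact (ENNReal.ofReal_lt_ofReal_iff (by norm_num)).2 (Real.rpow_lt_one_of_one_lt_of_neg (by norm_num) hx)
  have hq0 : 0 < q := by linarith
  set CD := ((1 - ENNReal.ofReal (2 ^ (-(σ / (2 * q)))))⁻¹) ^ q * (1 - ENNReal.ofReal (2 ^ (-(σ / 2))))⁻¹ *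
    (ENNReal.ofReal (2 ^ q) * 2 * V⁻¹ * C) with hCD
  have hCDt : CD ≠ ⊤ := by
    have h1 := lt1 (-(σ / (2 * q))) (by have : 0 < σ / (2 * q) := by positivity
                                        linarith)
    have h2 := lt1 (-(σ / 2)) (by linarith)
    have h3 : ((1 - ENNReal.ofReal (2 ^ (-(σ / (2 * q)))))⁻¹) ^ q ≠ ⊤ := ENNReal.rpow_ne_top_of_nonneg hq0.le h1
    rw [hCD]
    exact ENNReal.mul_ne_top (ENNReal.mul_ne_top h3 h2) (by finiteness)
  set H0 := r / 4 with hH0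
  have hH0p : 0 < H0 := by positivity
  set b0 := ENNReal.ofReal (H0 ^ (n : ℝ)) with hb0
  have hb00 : b0 ≠ 0 := by rw [hb0]; simp; positivity
  have hb0i : b0⁻¹ ≠ ⊤ := ENNReal.inv_ne_top.2 hb00
  set A := ENNReal.ofReal (2 ^ q) * ENNReal.ofReal (2 ^ q) * V⁻¹ * G * b0⁻¹ + 1 with hA
  have hAt : A ≠ ⊤ := by rw [hA]; finiteness
  have hA0 : A ≠ 0 := by rw [hA]; simp
  set B := ENNReal.ofReal (2 ^ q) * (CD + ENNReal.ofReal (2 ^ q) * V⁻¹ * C) * ENNReal.ofReal (H0 ^ σ) with hB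
  have hBt : B ≠ ⊤ := by rw [hB]; finiteness
  set lam := ENNReal.ofReal (2 ^ (n : ℝ)) with hlam
  have hlam2 : 2 ≤ lam := by
    rw [hlam, ← ENNReal.ofReal_ofNat]
    refine ENNReal.ofReal_le_ofReal ?_
    have : (1 : ℝ) ≤ n := by exact_mod_cast hn
    calc (2 : ℝ) = 2 ^ (1 : ℝ) := by simp
      _ ≤ _ := Real.rpow_le_rpow_of_exponent_le (by norm_num) this
  set mu := ENNReal.ofReal (2 ^ (-σ)) with hmu
  have hlm : (1 - lam ^ κ * mu)⁻¹ ≠ ⊤ := by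
    have : lam ^ κ * mu = ENNReal.ofReal (2 ^ (n * κ - σ)) := by
      rw [hlam, hmu, ENNReal.ofReal_rpow_of_nonneg (by positivity) hκ.le, ← ENNReal.ofReal_mul (by positivity),
        ← Real.rpow_mul (by norm_num), ← Real.rpow_add (by norm_num)]
      rfl
    rw [this]
    exact lt1 _ (by linarith)
  refine ⟨(2 * A) ^ (1 + κ) * volume (ball (0 : Eu n) ρ) + (2 * A * lam) ^ κ * 2 * B * (1 - lam ^ κ * mu)⁻¹, ?_, ?_⟩
  · have h1 : (2 * A) ^ (1 + κ) ≠ ⊤ := ENNReal.rpow_ne_top_of_nonneg (by linarith) (by finiteness)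
    have h2 : (2 * A * lam) ^ κ ≠ ⊤ := ENNReal.rpow_ne_top_of_nonneg (by linarith) (by finiteness)
    have h3 : volume (ball (0 : Eu n) ρ) ≠ ⊤ := measure_ball_lt_top.ne
    exact ENNReal.add_ne_top.2 ⟨ENNReal.mul_ne_top h1 h3, ENNReal.mul_ne_top (by finiteness) hlm⟩
  intro u hum Ω hΩ hu hBΩ hG hsec e he
  have hdif : ∀ x ∈ ball (0 : Eu n) (ρ + r), DifferentiableAt ℝ u x := fun x hx =>
    (hu.differentiableOn (by norm_num)).differentiableAt (hΩ.mem_nhds (hBΩ (ball_subset_ball (by linarith) hx)))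
  have hSD : ∀ h : Eu n, 0 < ‖h‖ → 4 * ‖h‖ ≤ r → _ := fun h h0 h4 => second_diff (ρ := ρ) (σ := σ) hn hq hum h h0 h4 (hsec h h0 h4)
  set Hk : ℕ → ℝ := fun k => H0 * ((2 : ℝ) ^ k)⁻¹ with hHk
  have hHk0 : ∀ k, 0 < Hk k := fun k => by simp only [hHk]; positivity
  have hHk4 : ∀ k, 4 * Hk k ≤ r := fun k => by
    have h1 : ((2 : ℝ) ^ k)⁻¹ ≤ 1 := inv_le_one_of_one_le₀ (one_le_pow₀ (by norm_num))
    have : Hk k ≤ H0 := mul_le_of_le_one_right hH0p.le h1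
    linarith
  have hn' : ∀ k, ‖Hk k • e‖ = Hk k := fun k => by
    rw [norm_smul, he, mul_one, Real.norm_of_nonneg (hHk0 k).le]
  have hex := fun k => one_scale (σ := σ) (C := C) (CD := CD) hn hq hr hum hΩ hu hBΩ hG e he (Hk k) (hHk0 k) (hHk4 k)
    (by have := hsec (Hk k • e) (by rw [hn']; exact hHk0 k) (by rw [hn']; exact hHk4 k)
        rwa [hn'] at this)
    (by have := deriv_diff hq hσ hum hdif hSD (Hk k • e) (by rw [hn']; exact hHk0 k) (by rw [hn']; exact hHk4 k)
        rwa [hn'] at this)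
  choose Gf hGm hGp hGi using hex
  have epow : ∀ (k : ℕ) (y : ℝ), Hk k ^ y = H0 ^ y * ((2 : ℝ) ^ (-y)) ^ k := by
    intro k y
    simp only [hHk]
    rw [Real.mul_rpow hH0p.le (by positivity), ← Real.rpow_natCast, ← Real.rpow_neg (by norm_num), ← Real.rpow_mul (by norm_num), ← Real.rpow_natCast, ← Real.rpow_mul (by norm_num)]
    congr 2; ring
  have := gain_lemma (ν := volume.restrict (ball (0 : Eu n) ρ)) (F := fun x => ENNReal.ofReal (|fderiv ℝ u x e| ^ q)) (Gk := Gf)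
    (fun _ => ENNReal.ofReal_ne_top) hGm (A := A) (B := B) (lam := lam) (mu := mu) hκ hA0 hAt hlam2 (by
      intro k
      refine (ae_restrict_iff' measurableSet_ball).2 (Filter.Eventually.of_forall fun x hx => ?_)
      refine (hGp k x hx).trans (add_le_add le_rfl ?_)
      have : (ENNReal.ofReal (Hk k ^ (n : ℝ)))⁻¹ = b0⁻¹ * lam ^ k := by
        rw [epow, ENNReal.ofReal_mul (by positivity), ENNReal.mul_inv (Or.inl hb00) (Or.inl ENNReal.ofReal_ne_top), hlam]
        congr 1
        rw [← ENNReal.ofReal_inv_of_pos (by positivity), ← ENNReal.ofReal_pow (by positivity), ← inv_pow, Real.rpow_neg (by norm_num), inv_inv]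
      rw [this, ← mul_assoc]
      exact mul_le_mul' le_self_add le_rfl) (by
      intro k
      refine (hGi k).trans (le_of_eq ?_)
      rw [epow, ENNReal.ofReal_mul (by positivity), ENNReal.ofReal_pow (by positivity), hB, hmu]
      ring)
  rw [Measure.restrict_apply_univ] at this
  refine le_trans (le_of_eq ?_) this
  refine lintegral_congr fun x => ?_
  rw [ENNReal.ofReal_rpow_of_nonneg (by positivity) (by linarith), ← Real.rpow_mul (abs_nonneg _)]

lemma opNorm_le_sum {n : ℕ} (T : Eu n →L[ℝ] ℝ) : ‖T‖ ≤ ∑ i, |T (EuclideanSpace.single i (1 : ℝ))| := by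
  refine T.opNorm_le_bound (by positivity) fun x => ?_
  have hx : x = ∑ i, x i • EuclideanSpace.single i (1 : ℝ) := by
    have := (EuclideanSpace.basisFun (Fin n) ℝ).sum_repr x
    simpa using this.symm
  have : T x = ∑ i, x i * T (EuclideanSpace.single i (1 : ℝ)) := by
    conv_lhs => rw [hx]
    simp
  rw [this, Finset.sum_mul]
  refine (norm_sum_le _ _).trans (Finset.sum_le_sum fun i _ => ?_)
  rw [norm_mul, mul_comm, Real.norm_eq_abs (T _)]
  exact mul_le_mul_of_nonneg_left (PiLp.norm_apply_le x i) (abs_nonneg _)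

def Good (n : ℕ) (s p q : ℝ) : Prop := ∀ ρ : ℝ, 0 < ρ → ρ < 2 → ∃ C : ℝ≥0∞, C ≠ ⊤ ∧ ∀ u : Eu n → ℝ, NData n s p u →
  ∫⁻ x in ball (0 : Eu n) ρ, ENNReal.ofReal (‖fderiv ℝ u x‖ ^ q) ≤ C

lemma good_step {n : ℕ} (hn : 1 ≤ n) {s p q σ κ : ℝ} (hp : 1 < p) (hs0 : 0 < s * p) (hs1 : s * p < p) (hq : p ≤ q)
    (hσ : 0 < σ) (hσ2 : 2 * σ ≤ s * p - max (p - 2) 0) (hκ : 0 < κ) (hκσ : n * κ < σ) (hg : Good n s p q) :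
    Good n s p (q * (1 + κ)) := by
  intro ρ hρ hρ2
  set r := (2 - ρ) / 20 with hr
  have hr0 : 0 < r := by rw [hr]; linarith
  have hρr : ρ + 10 * r < 2 := by rw [hr]; linarith
  obtain ⟨G, hGt, hG⟩ := hg (ρ + 10 * r) (by linarith) hρr
  obtain ⟨C, hCt, hC⟩ := second_int hn hp hs0 hs1 (β := q - p + 1) (by linarith) hρ hσ hσ2 hr0 hρr.le hGt
  rw [show p + (q - p + 1) - 1 = q by ring] at hC
  obtain ⟨C', hCt', hC'⟩ := dir_gain (ρ := ρ) hn (q := q) (by linarith) hσ hr0 hκ hκσ hCt hGt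
  refine ⟨ENNReal.ofReal ((n : ℝ) ^ (q * (1 + κ) - 1)) * (n * C'), by finiteness, ?_⟩
  intro u hu
  obtain ⟨Ω, hΩ, hB, hcd⟩ := hu.c1
  have hBΩ : ball (0 : Eu n) (ρ + 10 * r) ⊆ Ω := ((ball_subset_ball hρr.le).trans (ball_subset_closedBall.trans hB))
  have hdir := hC' u hu.meas Ω hΩ hcd hBΩ (hG u hu) (hC u hu (hG u hu))
  have hQ : 1 ≤ q * (1 + κ) := by nlinarith
  calc _ ≤ ∫⁻ x in ball (0 : Eu n) ρ, ENNReal.ofReal ((n : ℝ) ^ (q * (1 + κ) - 1)) *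
        ∑ i : Fin n, ENNReal.ofReal (|fderiv ℝ u x (EuclideanSpace.single i (1 : ℝ))| ^ (q * (1 + κ))) := by
        refine lintegral_mono fun x => ?_
        simp only
        rw [← ENNReal.ofReal_sum_of_nonneg (fun i _ => by positivity), ← ENNReal.ofReal_mul (by positivity)]
        refine ENNReal.ofReal_le_ofReal ?_
        have := Real.rpow_sum_le_const_mul_sum_rpow Finset.univ (fun i : Fin n => fderiv ℝ u x (EuclideanSpace.single i (1 : ℝ))) hQ
        rw [Finset.card_univ, Fintype.card_fin] at this
        exact (Real.rpow_le_rpow (norm_nonneg _) (opNorm_le_sum _) (by linarith)).trans this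
    _ = ENNReal.ofReal ((n : ℝ) ^ (q * (1 + κ) - 1)) *
        ∑ i : Fin n, ∫⁻ x in ball (0 : Eu n) ρ, ENNReal.ofReal (|fderiv ℝ u x (EuclideanSpace.single i (1 : ℝ))| ^ (q * (1 + κ))) := by
        rw [lintegral_const_mul' _ _ ENNReal.ofReal_ne_top, lintegral_finsetSum]
        intro i _
        have := measurable_fderiv_apply_const ℝ u (EuclideanSpace.single i (1 : ℝ))
        fun_prop
    _ ≤ ENNReal.ofReal ((n : ℝ) ^ (q * (1 + κ) - 1)) * ∑ i : Fin n, C' :=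
        mul_le_mul' le_rfl (Finset.sum_le_sum fun i _ => hdir _ (by simp))
    _ = _ := by simp

lemma good_all {n : ℕ} (hn : 1 ≤ n) {s p : ℝ} (hp : 1 < p) (hs0 : 0 < s * p) (hs1 : s * p < p)
    (hsp : max (p - 2) 0 < s * p) {q : ℝ} (hq : p ≤ q) : Good n s p q := by
  set σ := (s * p - max (p - 2) 0) / 2 with hσ
  have hσ0 : 0 < σ := by rw [hσ]; linarith
  have hn0 : (0 : ℝ) < n := by exact_mod_cast hn
  set κ := σ / (2 * n) with hκ
  have hκ0 : 0 < κ := by positivity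
  have hκσ : n * κ < σ := by rw [hκ]; field_simp; linarith
  have hall : ∀ k : ℕ, Good n s p (p * (1 + κ) ^ k) := by
    intro k
    induction k with
    | zero =>
      intro ρ hρ hρ2
      refine ⟨1, by simp, fun u hu => ?_⟩
      rw [pow_zero, mul_one]
      exact (lintegral_mono_set (ball_subset_ball hρ2.le)).trans hu.grad
    | succ k ih =>
      rw [pow_succ, ← mul_assoc]
      refine good_step hn hp hs0 hs1 ?_ hσ0 (by rw [hσ]; linarith) hκ0 hκσ ih
      exact le_mul_of_one_le_right (by linarith) (one_le_pow₀ (by linarith))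
  obtain ⟨k, hk⟩ := pow_unbounded_of_one_lt q (by linarith : 1 < 1 + κ)
  have hQ : q ≤ p * (1 + κ) ^ k := by nlinarith [pow_pos (by linarith : 0 < 1 + κ) k]
  intro ρ hρ hρ2
  obtain ⟨C, hCt, hC⟩ := hall k ρ hρ hρ2
  have hv : volume (ball (0 : Eu n) ρ) ≠ ⊤ := measure_ball_lt_top.ne
  refine ⟨volume (ball (0 : Eu n) ρ) + C, by finiteness, fun u hu => ?_⟩
  calc _ ≤ ∫⁻ x in ball (0 : Eu n) ρ, (1 + ENNReal.ofReal (‖fderiv ℝ u x‖ ^ (p * (1 + κ) ^ k))) := by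
        refine lintegral_mono fun x => ?_
        simp only
        rw [← ENNReal.ofReal_one, ← ENNReal.ofReal_add (by norm_num) (by positivity)]
        refine ENNReal.ofReal_le_ofReal ?_
        rcases le_total ‖fderiv ℝ u x‖ 1 with h | h
        · have h1 := Real.rpow_le_one (norm_nonneg _) h (by linarith : 0 ≤ q)
          have : 0 ≤ ‖fderiv ℝ u x‖ ^ (p * (1 + κ) ^ k) := by positivity
          linarith
        · have := Real.rpow_le_rpow_of_exponent_le h hQ
          linarith
    _ ≤ _ := by
        rw [lintegral_add_left measurable_const, setLIntegral_const, one_mul]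
        exact add_le_add le_rfl (hC u hu)

lemma lint_affine {n : ℕ} {R : ℝ} (hR : 0 < R) (x₀ : Eu n) (f : Eu n → ℝ≥0∞) :
    ∫⁻ x, f (x₀ + R • x) = ENNReal.ofReal ((R ^ n)⁻¹) * ∫⁻ x, f x := by
  have h1 := lintegral_map_equiv (μ := (volume : Measure (Eu n))) (fun x => f (x₀ + x)) (Homeomorph.smulOfNeZero R hR.ne').toMeasurableEquiv
  have h2 : ⇑(Homeomorph.smulOfNeZero R hR.ne' : Eu n ≃ₜ Eu n).toMeasurableEquiv = fun x => R • x := rfl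
  rw [h2, Measure.map_addHaar_smul volume hR.ne', lintegral_smul_measure, lintegral_add_left_eq_self, finrank_euclideanSpace_fin,
    abs_of_pos (by positivity)] at h1
  exact h1.symm

lemma lint_affine_set {n : ℕ} {R : ℝ} (hR : 0 < R) (x₀ : Eu n) (f : Eu n → ℝ≥0∞) {S T : Set (Eu n)}
    (hS : MeasurableSet S) (hT : MeasurableSet T) (hST : ∀ x, x ∈ S ↔ x₀ + R • x ∈ T) :
    ∫⁻ x in S, f (x₀ + R • x) = ENNReal.ofReal ((R ^ n)⁻¹) * ∫⁻ x in T, f x := by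
  rw [← lintegral_indicator hS, ← lintegral_indicator hT, ← lint_affine hR x₀]
  refine lintegral_congr fun x => ?_
  by_cases hx : x ∈ S
  · rw [indicator_of_mem hx, indicator_of_mem ((hST x).1 hx)]
  · rw [indicator_of_notMem hx, indicator_of_notMem (fun h => hx ((hST x).2 h))]

lemma int_affine {n : ℕ} {R : ℝ} (hR : 0 < R) (x₀ : Eu n) (f : Eu n → ℝ) :
    ∫ x, f (x₀ + R • x) = (R ^ n)⁻¹ * ∫ x, f x := by
  have h1 := Measure.integral_comp_smul (volume : Measure (Eu n)) (fun x => f (x₀ + x)) R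
  rw [h1, integral_add_left_eq_self, finrank_euclideanSpace_fin, abs_of_pos (by positivity), smul_eq_mul]

lemma int_affine_set {n : ℕ} {R : ℝ} (hR : 0 < R) (x₀ : Eu n) (f : Eu n → ℝ) {S T : Set (Eu n)}
    (hS : MeasurableSet S) (hT : MeasurableSet T) (hST : ∀ x, x ∈ S ↔ x₀ + R • x ∈ T) :
    ∫ x in S, f (x₀ + R • x) = (R ^ n)⁻¹ * ∫ x in T, f x := by
  rw [← integral_indicator hS, ← integral_indicator hT, ← int_affine hR x₀]
  refine integral_congr_ae (Filter.Eventually.of_forall fun x => ?_)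
  simp only
  by_cases hx : x ∈ S
  · rw [indicator_of_mem hx, indicator_of_mem ((hST x).1 hx)]
  · rw [indicator_of_notMem hx, indicator_of_notMem (fun h => hx ((hST x).2 h))]

lemma mem_affine_ball {n : ℕ} {R : ℝ} (hR : 0 < R) (x₀ x : Eu n) (a : ℝ) :
    x ∈ ball (0 : Eu n) a ↔ x₀ + R • x ∈ ball x₀ (a * R) := by
  rw [mem_ball_zero_iff, mem_ball, dist_eq_norm, add_sub_cancel_left, norm_smul, Real.norm_of_nonneg hR.le, mul_comm,
    mul_lt_mul_iff_left₀ hR]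

lemma test_Lp {n : ℕ} {p : ℝ} (hp : 1 < p) {ψ : Eu n → ℝ} {L M : ℝ} {x₀ : Eu n}
    (hb : ∀ x, |ψ x| ≤ L) (hz : ∀ x, x ∉ ball x₀ M → ψ x = 0) :
    ∫⁻ x, ENNReal.ofReal (|ψ x| ^ p) < ⊤ := by
  calc _ ≤ ∫⁻ x, (ball x₀ M).indicator (fun _ => ENNReal.ofReal (L ^ p)) x := by
        refine lintegral_mono fun x => ?_
        by_cases hx : x ∈ ball x₀ M
        · rw [indicator_of_mem hx]
          exact ENNReal.ofReal_le_ofReal (Real.rpow_le_rpow (abs_nonneg _) (hb x) (by linarith))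
        · rw [indicator_of_notMem hx]
          simp only [hz x hx]
          simp [Real.zero_rpow (by linarith : p ≠ 0)]
    _ = ENNReal.ofReal (L ^ p) * volume (ball x₀ M) := by
        rw [lintegral_indicator measurableSet_ball, setLIntegral_const]
    _ < ⊤ := ENNReal.mul_lt_top ENNReal.ofReal_lt_top measure_ball_lt_top

lemma test_gag {n : ℕ} (hn : 1 ≤ n) {s p : ℝ} (hp : 1 < p) (hs0 : 0 < s * p) (hs1 : s * p < p) {ψ : Eu n → ℝ} {L M : ℝ} {x₀ : Eu n}
    (hb : ∀ x, |ψ x| ≤ L) (hl : ∀ x y, |ψ x - ψ y| ≤ L * ‖x - y‖) (hz : ∀ x, x ∉ ball x₀ M → ψ x = 0) :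
    gagliardoE n s p univ ψ < ⊤ := by
  set m := (n : ℝ) + s * p with hm
  have hm0 : 0 < m := by positivity
  have hL : 0 ≤ L := (abs_nonneg _).trans (hb 0)
  set g1 : Eu n → ℝ≥0∞ := (ball (0 : Eu n) 1).indicator fun z => ENNReal.ofReal (L ^ p) * ENNReal.ofReal (‖z‖ ^ (p - m)) with hg1
  set g2 : Eu n → ℝ≥0∞ := fun z => ENNReal.ofReal ((2 * L) ^ p * 2 ^ m) * ENNReal.ofReal ((1 + ‖z‖) ^ (-m)) with hg2
  set g : Eu n → ℝ≥0∞ := fun z => g1 z + g2 z with hg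
  have hg1m : Measurable g1 := by
    refine Measurable.indicator ?_ measurableSet_ball
    fun_prop
  have hg2m : Measurable g2 := by simp only [hg2]; fun_prop
  have hgm : Measurable g := hg1m.add hg2m
  have hgn : ∀ z, g (-z) = g z := by
    intro z
    simp only [hg, hg1, hg2, indicator, mem_ball_zero_iff, norm_neg]
  have hgi : ∫⁻ z, g z ≠ ⊤ := by
    simp only [hg]
    rw [lintegral_add_left hg1m]
    refine ENNReal.add_ne_top.2 ⟨?_, ?_⟩
    · simp only [hg1]
      rw [lintegral_indicator measurableSet_ball, lintegral_const_mul' _ _ ENNReal.ofReal_ne_top]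
      exact ENNReal.mul_ne_top ENNReal.ofReal_ne_top (lint_ball_norm_rpow hn (by rw [hm]; linarith) 1).ne
    · simp only [hg2]
      rw [lintegral_const_mul' _ _ ENNReal.ofReal_ne_top]
      refine ENNReal.mul_ne_top ENNReal.ofReal_ne_top ?_
      have hi : Integrable (fun x : Eu n => (1 + ‖x‖) ^ (-m)) := integrable_one_add_norm (by
        rw [finrank_euclideanSpace_fin, hm]; linarith)
      have := hi.2
      rw [hasFiniteIntegral_iff_ofReal (Filter.Eventually.of_forall fun x => by positivity)] at this
      exact this.ne
  have pw : ∀ x y, ENNReal.ofReal (|ψ x - ψ y| ^ p / dist x y ^ m) ≤ g (y - x) := by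
    intro x y
    rw [← hgn, neg_sub, dist_eq_norm]
    by_cases hxy : x = y
    · simp [hxy, Real.zero_rpow (by linarith : p ≠ 0)]
    have hpos : 0 < ‖x - y‖ := norm_pos_iff.2 (sub_ne_zero.2 hxy)
    by_cases h1 : x - y ∈ ball (0 : Eu n) 1
    · refine le_trans ?_ (le_self_add : g1 (x - y) ≤ _)
      simp only [hg1]
      rw [indicator_of_mem h1, ← ENNReal.ofReal_mul (by positivity)]
      refine ENNReal.ofReal_le_ofReal ?_
      rw [Real.rpow_sub hpos, ← mul_div_assoc, ← Real.mul_rpow hL hpos.le]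
      gcongr
      exact hl x y
    · refine le_trans ?_ (le_add_self : g2 (x - y) ≤ _)
      simp only [hg2]
      rw [← ENNReal.ofReal_mul (by positivity)]
      refine ENNReal.ofReal_le_ofReal ?_
      have h1' : 1 ≤ ‖x - y‖ := by simpa using h1
      have h2 : |ψ x - ψ y| ≤ 2 * L := by
        have := abs_sub (ψ x) (ψ y)
        linarith [hb x, hb y]
      have h3 : (1 + ‖x - y‖) ^ m ≤ 2 ^ m * ‖x - y‖ ^ m := by
        rw [← Real.mul_rpow (by norm_num) hpos.le]
        exact Real.rpow_le_rpow (by positivity) (by linarith) hm0.le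
      rw [Real.rpow_neg (by positivity), ← div_eq_mul_inv, div_le_div_iff₀ (by positivity) (by positivity)]
      calc |ψ x - ψ y| ^ p * (1 + ‖x - y‖) ^ m ≤ (2 * L) ^ p * (2 ^ m * ‖x - y‖ ^ m) := by gcongr
        _ = _ := by ring
  set A := ball x₀ M with hA
  have pw2 : ∀ x y, ENNReal.ofReal (|ψ x - ψ y| ^ p / dist x y ^ m) ≤ A.indicator (fun _ => g (y - x)) x + A.indicator (fun y => g (y - x)) y := by
    intro x y
    by_cases hx : x ∈ A
    · rw [indicator_of_mem hx]; exact (pw x y).trans le_self_add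
    by_cases hy : y ∈ A
    · rw [indicator_of_mem hy]; exact (pw x y).trans le_add_self
    · rw [hz x hx, hz y hy]; simp [Real.zero_rpow (by linarith : p ≠ 0)]
  have hgmm : Measurable (fun w : Eu n × Eu n => g (w.2 - w.1)) := hgm.comp (by fun_prop)
  have hAm : MeasurableSet A := measurableSet_ball
  have m1 : Measurable (fun w : Eu n × Eu n => A.indicator (fun _ => g (w.2 - w.1)) w.1) := by
    have : (fun w : Eu n × Eu n => A.indicator (fun _ => g (w.2 - w.1)) w.1) = (Prod.fst ⁻¹' A).indicator (fun w : Eu n × Eu n => g (w.2 - w.1)) := by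
      ext w; rfl
    rw [this]
    exact hgmm.indicator (hAm.preimage measurable_fst)
  have m2 : Measurable (fun w : Eu n × Eu n => A.indicator (fun y => g (y - w.1)) w.2) := by
    have : (fun w : Eu n × Eu n => A.indicator (fun y => g (y - w.1)) w.2) = (Prod.snd ⁻¹' A).indicator (fun w : Eu n × Eu n => g (w.2 - w.1)) := by
      ext w; rfl
    rw [this]
    exact hgmm.indicator (hAm.preimage measurable_snd)
  have I1 : ∫⁻ x, ∫⁻ y, A.indicator (fun _ => g (y - x)) x = volume A * ∫⁻ z, g z := by
    have : ∀ x, ∫⁻ y, A.indicator (fun _ => g (y - x)) x = A.indicator (fun _ => ∫⁻ z, g z) x := by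
      intro x
      by_cases hx : x ∈ A
      · simp only [indicator_of_mem hx]
        exact lintegral_sub_right_eq_self g x
      · simp only [indicator_of_notMem hx]; simp
    simp only [this]
    rw [lintegral_indicator hAm, setLIntegral_const, mul_comm]
  have I2 : ∫⁻ x, ∫⁻ y, A.indicator (fun y => g (y - x)) y = volume A * ∫⁻ z, g z := by
    rw [lintegral_lintegral_swap m2.aemeasurable]
    have : ∀ y, ∫⁻ x, A.indicator (fun y => g (y - x)) y = A.indicator (fun _ => ∫⁻ z, g z) y := by
      intro y
      by_cases hy : y ∈ A
      · simp only [indicator_of_mem hy]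
        exact lintegral_sub_left_eq_self g y
      · simp only [indicator_of_notMem hy]; simp
    simp only [this]
    rw [lintegral_indicator hAm, setLIntegral_const, mul_comm]
  unfold gagliardoE
  rw [Measure.restrict_univ]
  calc _ ≤ ∫⁻ x, ∫⁻ y, (A.indicator (fun _ => g (y - x)) x + A.indicator (fun y => g (y - x)) y) :=
        lintegral_mono fun x => lintegral_mono fun y => pw2 x y
    _ = volume A * (∫⁻ z, g z) + volume A * ∫⁻ z, g z := by
        refine Eq.trans ?_ (congrArg₂ (· + ·) I1 I2)
        show _ = (∫⁻ x, ∫⁻ y, A.indicator (fun _ => g (y - x)) x) + ∫⁻ x, ∫⁻ y, A.indicator (fun y => g (y - x)) y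
        rw [← lintegral_add_left m1.lintegral_prod_right']
        refine lintegral_congr fun x => ?_
        exact lintegral_add_left (m1.comp measurable_prodMk_left) _
    _ < ⊤ := by
        have : volume A ≠ ⊤ := measure_ball_lt_top.ne
        exact ENNReal.add_lt_top.2 ⟨(ENNReal.mul_ne_top this hgi).lt_top, (ENNReal.mul_ne_top this hgi).lt_top⟩

lemma norm_gradient {n : ℕ} (u : Eu n → ℝ) (x : Eu n) : ‖gradient u x‖ = ‖fderiv ℝ u x‖ := by
  unfold gradient
  exact LinearIsometryEquiv.norm_map _ _

lemma fderiv_affine {n : ℕ} {R lam c : ℝ} (x₀ : Eu n) (u : Eu n → ℝ) (x : Eu n) (hl : 0 < lam) (hR : 0 < R)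
    (hd : DifferentiableAt ℝ u (x₀ + R • x)) :
    ‖fderiv ℝ (fun y => (u (x₀ + R • y) - c) / lam) x‖ = R / lam * ‖fderiv ℝ u (x₀ + R • x)‖ := by
  have h1 : HasFDerivAt (fun y : Eu n => x₀ + R • y) (R • ContinuousLinearMap.id ℝ (Eu n)) x :=
    ((hasFDerivAt_id x).const_smul R).const_add x₀
  have h2 : HasFDerivAt (fun y => (u (x₀ + R • y) - c)) ((fderiv ℝ u (x₀ + R • x)).comp (R • ContinuousLinearMap.id ℝ (Eu n))) x :=
    (hd.hasFDerivAt.comp x h1).sub_const c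
  have h3 : HasFDerivAt (fun y => (u (x₀ + R • y) - c) / lam) (lam⁻¹ • ((fderiv ℝ u (x₀ + R • x)).comp (R • ContinuousLinearMap.id ℝ (Eu n)))) x := by
    have := h2.const_smul lam⁻¹
    refine this.congr_of_eventuallyEq (Filter.Eventually.of_forall fun y => ?_)
    simp [div_eq_inv_mul]
  rw [h3.fderiv, ContinuousLinearMap.comp_smul, ContinuousLinearMap.comp_id, smul_smul, norm_smul, Real.norm_of_nonneg (by positivity)]
  ring

lemma affine_grad {n : ℕ} {R lam c a : ℝ} (hR : 0 < R) (hl : 0 < lam) (x₀ : Eu n) (u : Eu n → ℝ) {Ω : Set (Eu n)} (hΩ : IsOpen Ω)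
    (hu : ContDiffOn ℝ 1 u Ω) (hB : ball x₀ (a * R) ⊆ Ω) {r : ℝ} :
    ∫⁻ x in ball (0 : Eu n) a, ENNReal.ofReal (‖fderiv ℝ (fun y => (u (x₀ + R • y) - c) / lam) x‖ ^ r)
      = ENNReal.ofReal ((R / lam) ^ r * (R ^ n)⁻¹) * ∫⁻ x in ball x₀ (a * R), ENNReal.ofReal (‖fderiv ℝ u x‖ ^ r) := by
  have h1 : ∫⁻ x in ball (0 : Eu n) a, ENNReal.ofReal (‖fderiv ℝ (fun y => (u (x₀ + R • y) - c) / lam) x‖ ^ r)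
      = ∫⁻ x in ball (0 : Eu n) a, ENNReal.ofReal ((R / lam) ^ r) * ENNReal.ofReal (‖fderiv ℝ u (x₀ + R • x)‖ ^ r) := by
    refine setLIntegral_congr_fun measurableSet_ball fun x hx => ?_
    have hx' : x₀ + R • x ∈ Ω := hB ((mem_affine_ball hR x₀ x a).1 hx)
    have hd : DifferentiableAt ℝ u (x₀ + R • x) :=
      (hu.differentiableOn one_ne_zero).differentiableAt (hΩ.mem_nhds hx')
    rw [fderiv_affine x₀ u x hl hR hd, Real.mul_rpow (by positivity) (norm_nonneg _), ENNReal.ofReal_mul (by positivity)]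
  rw [h1, lintegral_const_mul' _ _ ENNReal.ofReal_ne_top,
    lint_affine_set hR x₀ (fun x => ENNReal.ofReal (‖fderiv ℝ u x‖ ^ r)) measurableSet_ball measurableSet_ball
      (fun x => mem_affine_ball hR x₀ x a), ENNReal.ofReal_mul (by positivity), mul_assoc]

lemma affine_tail {n : ℕ} {s p R lam : ℝ} (hR : 0 < R) (hl : 0 < lam) (x₀ : Eu n) (w : Eu n → ℝ) :
    ∫⁻ x in (ball (0 : Eu n) 2)ᶜ, ENNReal.ofReal (|w (x₀ + R • x) / lam| ^ (p - 1) / ‖x‖ ^ ((n : ℝ) + s * p))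
      = ENNReal.ofReal ((lam ^ (p - 1))⁻¹ * R ^ (s * p)) *
        ∫⁻ x in (ball x₀ (2 * R))ᶜ, ENNReal.ofReal (|w x| ^ (p - 1) / dist x x₀ ^ ((n : ℝ) + s * p)) := by
  have h1 : ∀ x : Eu n, ENNReal.ofReal (|w (x₀ + R • x) / lam| ^ (p - 1) / ‖x‖ ^ ((n : ℝ) + s * p))
      = ENNReal.ofReal ((lam ^ (p - 1))⁻¹ * R ^ ((n : ℝ) + s * p)) *
        ENNReal.ofReal (|w (x₀ + R • x)| ^ (p - 1) / dist (x₀ + R • x) x₀ ^ ((n : ℝ) + s * p)) := by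
    intro x
    rw [← ENNReal.ofReal_mul (by positivity), dist_eq_norm, add_sub_cancel_left, norm_smul, Real.norm_of_nonneg hR.le,
      Real.mul_rpow hR.le (norm_nonneg _), abs_div, abs_of_pos hl, Real.div_rpow (abs_nonneg _) hl.le]
    congr 1
    have h2 : 0 < R ^ ((n : ℝ) + s * p) := by positivity
    have h3 : 0 < lam ^ (p - 1) := by positivity
    field_simp
  simp only [h1]
  rw [lintegral_const_mul' _ _ ENNReal.ofReal_ne_top,
    lint_affine_set hR x₀ (fun x => ENNReal.ofReal (|w x| ^ (p - 1) / dist x x₀ ^ ((n : ℝ) + s * p)))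
      measurableSet_ball.compl measurableSet_ball.compl
      (fun x => not_congr (mem_affine_ball hR x₀ x 2)), ← mul_assoc, ← ENNReal.ofReal_mul (by positivity)]
  congr 2
  rw [Real.rpow_add hR, Real.rpow_natCast]
  field_simp

lemma affine_eqn {n : ℕ} (hn : 1 ≤ n) {s p R lam c : ℝ} (hp : 1 < p) (hs0 : 0 < s * p) (hs1 : s * p < p) (hR : 0 < R) (hl : 0 < lam) (x₀ : Eu n)
    (u : Eu n → ℝ) {Ω : Set (Eu n)} (hw : IsLocalWeakSolution n p s Ω (fun _ => 0) u) (hB : closedBall x₀ (2 * R) ⊆ Ω)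
    (φ : Eu n → ℝ) (hφ : Measurable φ) (hL : ∃ L : ℝ, (∀ x, |φ x| ≤ L) ∧ ∀ x y, |φ x - φ y| ≤ L * ‖x - y‖)
    (hr : ∃ r < (2 : ℝ), ∀ x, r ≤ ‖x‖ → φ x = 0) :
    ∫ x, ∫ y, Jp p ((u (x₀ + R • x) - c) / lam - (u (x₀ + R • y) - c) / lam) * (φ x - φ y) / dist x y ^ ((n : ℝ) + s * p) = 0 := by
  obtain ⟨L, hb, hLip⟩ := hL
  obtain ⟨r, hr2, hz⟩ := hr
  have hL0 : 0 ≤ L := (abs_nonneg _).trans (hb 0)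
  set ψ : Eu n → ℝ := fun X => φ (R⁻¹ • (X - x₀)) with hψ
  have hψφ : ∀ x, ψ (x₀ + R • x) = φ x := by
    intro x
    simp only [hψ, add_sub_cancel_left, smul_smul, inv_mul_cancel₀ hR.ne', one_smul]
  have hψm : Measurable ψ := hφ.comp (by fun_prop)
  set L' := max L (L / R)
  have hψb : ∀ x, |ψ x| ≤ L' := fun x => (hb _).trans (le_max_left _ _)
  have hψl : ∀ x y, |ψ x - ψ y| ≤ L' * ‖x - y‖ := by
    intro x y
    refine (hLip _ _).trans ?_
    rw [← smul_sub, norm_smul, Real.norm_of_nonneg (by positivity), sub_sub_sub_cancel_right, ← mul_assoc, ← div_eq_mul_inv]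
    gcongr
    exact le_max_right _ _
  have hψz : ∀ x, x ∉ ball x₀ (2 * R) → ψ x = 0 := by
    intro x hx
    refine hz _ ?_
    rw [mem_ball, not_lt, dist_eq_norm] at hx
    rw [norm_smul, Real.norm_of_nonneg (by positivity)]
    have : 2 ≤ R⁻¹ * ‖x - x₀‖ := by
      rw [← div_eq_inv_mul, le_div_iff₀ hR]; exact hx
    linarith
  have key := hw.2.2.2 ψ hψm ⟨closedBall x₀ (2 * R), isCompact_closedBall _ _, hB,
    Filter.Eventually.of_forall fun x hx => hψz x (fun h => hx (ball_subset_closedBall h))⟩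
    (test_Lp hp hψb hψz) (test_gag hn hp hs0 hs1 hψb hψl hψz)
  simp only [zero_mul, integral_zero] at key
  set F : Eu n → Eu n → ℝ := fun x y =>
    |u x - u y| ^ (p - 2) * (u x - u y) * (ψ x - ψ y) / dist x y ^ ((n : ℝ) + s * p) with hF
  have hpt : ∀ x y : Eu n, Jp p ((u (x₀ + R • x) - c) / lam - (u (x₀ + R • y) - c) / lam) * (φ x - φ y) / dist x y ^ ((n : ℝ) + s * p)
      = ((lam ^ (p - 2) * lam)⁻¹ * R ^ ((n : ℝ) + s * p)) * F (x₀ + R • x) (x₀ + R • y) := by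
    intro x y
    simp only [hF, hψφ]
    rw [← sub_div, sub_sub_sub_cancel_right, Jp, abs_div, abs_of_pos hl, Real.div_rpow (abs_nonneg _) hl.le,
      dist_add_left, dist_smul₀, Real.norm_of_nonneg hR.le, Real.mul_rpow hR.le dist_nonneg]
    have h2 : 0 < R ^ ((n : ℝ) + s * p) := by positivity
    have h3 : 0 < lam ^ (p - 2) := by positivity
    field_simp
  simp only [hpt, integral_const_mul]
  have h1 : ∀ x : Eu n, ∫ y, F (x₀ + R • x) (x₀ + R • y) = (R ^ n)⁻¹ * ∫ y, F (x₀ + R • x) y :=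
    fun x => int_affine hR x₀ _
  simp only [h1, integral_const_mul]
  rw [int_affine hR x₀ (fun x => ∫ y, F x y), key]
  simp

lemma affine_NData {n : ℕ} (hn : 1 ≤ n) {s p R lam : ℝ} (hp : 1 < p) (hs0 : 0 < s * p) (hs1 : s * p < p) (hR : 0 < R) (hl : 0 < lam) (x₀ : Eu n)
    (u : Eu n → ℝ) {Ω : Set (Eu n)} (hΩ : IsOpen Ω) (hu : ContDiffOn ℝ 1 u Ω)
    (hw : IsLocalWeakSolution n p s Ω (fun _ => 0) u) (hB : closedBall x₀ (2 * R) ⊆ Ω)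
    (hg : ENNReal.ofReal (R ^ (1 - (n : ℝ) / p)) *
      (∫⁻ x in ball x₀ (2 * R), ENNReal.ofReal (‖fderiv ℝ u x‖ ^ p)) ^ (1 / p) ≤ ENNReal.ofReal lam)
    (ht : tailE n s p (fun x => u x - ⨍ y in ball x₀ (2 * R), u y) x₀ (2 * R) ≤ ENNReal.ofReal lam) :
    NData n s p (fun x => (u (x₀ + R • x) - ⨍ y in ball x₀ (2 * R), u y) / lam) where
  meas := by
    have := hw.1
    exact ((this.comp (by fun_prop : Measurable fun x : Eu n => x₀ + R • x)).sub_const _).div_const _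
  c1 := by
    refine ⟨(fun x => x₀ + R • x) ⁻¹' Ω, hΩ.preimage (by fun_prop), ?_, ?_⟩
    · intro x hx
      refine hB ?_
      rw [mem_closedBall_zero_iff] at hx
      rw [mem_closedBall, dist_eq_norm, add_sub_cancel_left, norm_smul, Real.norm_of_nonneg hR.le, mul_comm]
      gcongr
    · refine ContDiffOn.div_const (ContDiffOn.sub (hu.comp (g := u) (f := fun x : Eu n => x₀ + R • x) ?_ fun x hx => hx) contDiffOn_const) _
      exact ContDiff.contDiffOn (by fun_prop)
  eqn := fun φ hφ hL hr => affine_eqn hn hp hs0 hs1 hR hl x₀ u hw hB φ hφ hL hr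
  grad := by
    rw [affine_grad hR hl x₀ u hΩ hu (ball_subset_closedBall.trans hB)]
    have h := ENNReal.rpow_le_rpow hg (by linarith : 0 ≤ p)
    rw [ENNReal.mul_rpow_of_nonneg _ _ (by linarith), ← ENNReal.rpow_mul, one_div, inv_mul_cancel₀ (by linarith), ENNReal.rpow_one,
      ENNReal.ofReal_rpow_of_nonneg (by positivity) (by linarith), ENNReal.ofReal_rpow_of_nonneg hl.le (by linarith)] at h
    have e : (R / lam) ^ p * (R ^ n)⁻¹ = (lam ^ p)⁻¹ * (R ^ (1 - (n : ℝ) / p)) ^ p := by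
      rw [← Real.rpow_mul hR.le, sub_mul, one_mul, div_mul_cancel₀ _ (by linarith), Real.rpow_sub hR, Real.rpow_natCast,
        Real.div_rpow hR.le hl.le]
      have h3 : 0 < lam ^ p := by positivity
      field_simp
    rw [e, ENNReal.ofReal_mul (by positivity), mul_assoc]
    calc _ ≤ ENNReal.ofReal (lam ^ p)⁻¹ * ENNReal.ofReal (lam ^ p) := by gcongr
      _ = 1 := by
        have h3 : 0 < lam ^ p := by positivity
        rw [← ENNReal.ofReal_mul (by positivity), inv_mul_cancel₀ h3.ne', ENNReal.ofReal_one]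
  tail := by
    rw [affine_tail hR hl x₀ (fun x => u x - ⨍ y in ball x₀ (2 * R), u y)]
    unfold tailE at ht
    have h := ENNReal.rpow_le_rpow ht (by linarith : 0 ≤ p - 1)
    rw [← ENNReal.rpow_mul, one_div, inv_mul_cancel₀ (by linarith), ENNReal.rpow_one,
      ENNReal.ofReal_rpow_of_nonneg hl.le (by linarith)] at h
    rw [ENNReal.ofReal_mul (by positivity), mul_assoc]
    have h3 : 0 < lam ^ (p - 1) := by positivity
    calc _ ≤ ENNReal.ofReal (lam ^ (p - 1))⁻¹ * ENNReal.ofReal (lam ^ (p - 1)) := by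
          gcongr
          refine le_trans ?_ h
          gcongr
          linarith
      _ = 1 := by
        rw [← ENNReal.ofReal_mul (by positivity), inv_mul_cancel₀ h3.ne', ENNReal.ofReal_one]
  mean := by
    rw [int_affine_set hR x₀ (fun x => (u x - ⨍ y in ball x₀ (2 * R), u y) / lam) measurableSet_ball measurableSet_ball
      (fun x => mem_affine_ball hR x₀ x 2), integral_div]
    have hi : IntegrableOn u (ball x₀ (2 * R)) :=
      ((hu.continuousOn.mono hB).integrableOn_compact (isCompact_closedBall _ _)).mono_set ball_subset_closedBall
    have h0 : ∫ x in ball x₀ (2 * R), (u x - ⨍ y in ball x₀ (2 * R), u y) = 0 := by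
      have : IsFiniteMeasure (volume.restrict (ball x₀ (2 * R))) := ⟨by simp [measure_ball_lt_top]⟩
      exact integral_sub_average (volume.restrict (ball x₀ (2 * R))) u
    rw [h0]; simp

lemma main_pos {n : ℕ} (hn : 1 ≤ n) {s p : ℝ} (hp : 1 < p) (hs0 : 0 < s * p) (hs1 : s * p < p)
    (hsp : max (p - 2) 0 < s * p) {q : ℝ} (hq : p ≤ q) : ∃ c : ℝ, 0 < c ∧
        ∀ (Ω : Set (Eu n)) (u : Eu n → ℝ), IsOpen Ω →
          IsLocalWeakSolution n p s Ω (fun _ => 0) u →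
          ContDiffOn ℝ 1 u Ω →
          ∀ (x₀ : Eu n) (R : ℝ), 0 < R →
            closedBall x₀ (2 * R) ⊆ Ω →
            (∫⁻ x in ball x₀ R, ENNReal.ofReal (‖fderiv ℝ u x‖ ^ q)) ^ (1 / q) ≤
              ENNReal.ofReal (c * R ^ ((n : ℝ) / q - 1)) *
                (ENNReal.ofReal (R ^ (1 - (n : ℝ) / p)) *
                    (∫⁻ x in ball x₀ (2 * R), ENNReal.ofReal (‖fderiv ℝ u x‖ ^ p)) ^ (1 / p) +
                  tailE n s p (fun x => u x - ⨍ y in ball x₀ (2 * R), u y) x₀ (2 * R)) := by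
  obtain ⟨C, hC, hG⟩ := good_all hn hp hs0 hs1 hsp hq 1 one_pos one_lt_two
  have hq0 : 0 < q := by linarith
  refine ⟨(C ^ (1 / q)).toReal + 1, by positivity, fun Ω u hΩ hw hu x₀ R hR hB => ?_⟩
  set c := (C ^ (1 / q)).toReal + 1 with hc
  have hc0 : 0 < c := by positivity
  have hCc : C ^ (1 / q) ≤ ENNReal.ofReal c := by
    have h1 : C ^ (1 / q) ≠ ⊤ := ENNReal.rpow_ne_top_of_nonneg (by positivity) hC
    rw [← ENNReal.ofReal_toReal h1]
    exact ENNReal.ofReal_le_ofReal (by rw [hc]; linarith)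
  set G := ENNReal.ofReal (R ^ (1 - (n : ℝ) / p)) *
      (∫⁻ x in ball x₀ (2 * R), ENNReal.ofReal (‖fderiv ℝ u x‖ ^ p)) ^ (1 / p) with hGdef
  set T := tailE n s p (fun x => u x - ⨍ y in ball x₀ (2 * R), u y) x₀ (2 * R) with hT
  have hk : 0 < c * R ^ ((n : ℝ) / q - 1) := by positivity
  by_cases hΛ : G + T = ⊤
  · rw [hΛ, ENNReal.mul_top (by simpa using hk)]
    exact le_top
  set Λ := (G + T).toReal with hΛd
  have hΛe : G + T = ENNReal.ofReal Λ := (ENNReal.ofReal_toReal hΛ).symm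
  have hΛ0 : 0 ≤ Λ := ENNReal.toReal_nonneg
  set I := ∫⁻ x in ball x₀ R, ENNReal.ofReal (‖fderiv ℝ u x‖ ^ q) with hI
  have key : ∀ lam, Λ < lam → I ^ (1 / q) ≤ ENNReal.ofReal (c * R ^ ((n : ℝ) / q - 1) * lam) := by
    intro lam hlam
    have hl : 0 < lam := hΛ0.trans_lt hlam
    have hle : G + T ≤ ENNReal.ofReal lam := hΛe ▸ ENNReal.ofReal_le_ofReal hlam.le
    have hN := affine_NData hn hp hs0 hs1 hR hl x₀ u hΩ hu hw hB (le_self_add.trans hle) (le_add_self.trans hle)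
    have h1 := hG _ hN
    rw [affine_grad hR hl x₀ u hΩ hu ((ball_subset_closedBall.trans (closedBall_subset_closedBall (by linarith))).trans hB), one_mul] at h1
    set k := R / lam * (R ^ ((n : ℝ) / q))⁻¹ with hkd
    have hk0 : 0 < k := by positivity
    have e : (R / lam) ^ q * (R ^ n)⁻¹ = k ^ q := by
      rw [hkd, Real.mul_rpow (by positivity) (by positivity), Real.inv_rpow (by positivity), ← Real.rpow_mul hR.le,
        div_mul_cancel₀ _ hq0.ne', Real.rpow_natCast]
    rw [e] at h1
    have h2 := ENNReal.rpow_le_rpow h1 (by positivity : 0 ≤ 1 / q)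
    rw [ENNReal.mul_rpow_of_nonneg _ _ (by positivity), ENNReal.ofReal_rpow_of_nonneg (by positivity) (by positivity),
      ← Real.rpow_mul hk0.le, mul_one_div_cancel hq0.ne', Real.rpow_one] at h2
    have e2 : c * R ^ ((n : ℝ) / q - 1) * lam = k⁻¹ * c := by
      rw [hkd, Real.rpow_sub hR, Real.rpow_one]
      field_simp
    rw [e2, ENNReal.ofReal_mul (by positivity)]
    calc I ^ (1 / q) = ENNReal.ofReal k⁻¹ * (ENNReal.ofReal k * I ^ (1 / q)) := by
          rw [← mul_assoc, ← ENNReal.ofReal_mul (by positivity), inv_mul_cancel₀ hk0.ne', ENNReal.ofReal_one, one_mul]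
      _ ≤ _ := by gcongr; exact h2.trans hCc
  rw [hΛe, ← ENNReal.ofReal_mul hk.le]
  have hcont : Continuous fun lam : ℝ => ENNReal.ofReal (c * R ^ ((n : ℝ) / q - 1) * lam) :=
    ENNReal.continuous_ofReal.comp (by fun_prop)
  have hten : Filter.Tendsto (fun lam : ℝ => ENNReal.ofReal (c * R ^ ((n : ℝ) / q - 1) * lam)) (nhdsWithin Λ (Ioi Λ))
      (nhds (ENNReal.ofReal (c * R ^ ((n : ℝ) / q - 1) * Λ))) := (hcont.tendsto Λ).mono_left nhdsWithin_le_nhds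
  refine ge_of_tendsto hten ?_
  filter_upwards [self_mem_nhdsWithin] with lam hlam using key lam hlam


theorem gradient_Lq_estimate_homogeneous (n : ℕ) (p s : ℝ) (hp : 1 < p)
    (hs₁ : max (p - 2) 0 / p < s) (hs₂ : s < 1) :
    ∀ q : ℝ, p ≤ q →
      ∃ c : ℝ, 0 < c ∧
        ∀ (Ω : Set (EuclideanSpace ℝ (Fin n))) (u : EuclideanSpace ℝ (Fin n) → ℝ),
          IsOpen Ω → Bornology.IsBounded Ω →
          IsLocalWeakSolution n p s Ω (fun _ => 0) u →
          ContDiffOn ℝ 1 u Ω →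
          ∀ (x₀ : EuclideanSpace ℝ (Fin n)) (R : ℝ), 0 < R →
            closedBall x₀ (2 * R) ⊆ Ω →
            (∫⁻ x in ball x₀ R, ENNReal.ofReal (‖gradient u x‖ ^ q)) ^ (1 / q) ≤
              ENNReal.ofReal (c * R ^ ((n : ℝ) / q - 1)) *
                (ENNReal.ofReal (R ^ (1 - (n : ℝ) / p)) *
                    (∫⁻ x in ball x₀ (2 * R), ENNReal.ofReal (‖gradient u x‖ ^ p)) ^ (1 / p) +
                  tailE n s p (fun x => u x - ⨍ y in ball x₀ (2 * R), u y) x₀ (2 * R)) := by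
  intro q hq
  have hp0 : 0 < p := by linarith
  have hsp : max (p - 2) 0 < s * p := (div_lt_iff₀ hp0).1 hs₁
  have hs0 : 0 < s * p := (le_max_right _ _).trans_lt hsp
  have hs1 : s * p < p := by nlinarith
  rcases Nat.eq_zero_or_pos n with rfl | hn
  · refine ⟨1, one_pos, fun Ω u _ _ _ _ x₀ R hR _ => ?_⟩
    have h0 : ∀ x, gradient u x = 0 := fun x => Subsingleton.elim _ _
    have hq0 : 0 < q := by linarith
    simp only [h0, norm_zero, Real.zero_rpow hq0.ne', ENNReal.ofReal_zero, lintegral_zero]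
    rw [ENNReal.zero_rpow_of_pos (by positivity)]
    exact zero_le
  · obtain ⟨c, hc, H⟩ := main_pos (n := n) hn hp hs0 hs1 hsp hq
    refine ⟨c, hc, fun Ω u hΩ _ hw hu x₀ R hR hB => ?_⟩
    have := H Ω u hΩ hw hu x₀ R hR hB
    simp only [norm_gradient]
    exact this
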